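/- arXiv:1601.00944 — 4 statements merged into one kernel-verified Lean document; each statement's English description precedes it below -/
import Mathlib

section
/- For every n ≥ 1, 2·5^{n/4 − 2} ≤ S_n ≤ 5^{n/4} + 3·2^{n/2 − 1}; in particular S_n = Θ(5^{n/4}), i.e., there exist constants c₁, c₂ > 0 such that c₁·5^{n/4} ≤ S_n ≤ c₂·5^{n/4} for all n ≥ 1. -/
open SimpleGraph

/-- The type of subtrees of a graph `G`: vertex subsets inducing a connected
(hence nonempty) subgraph. -/
def GraphSubtree {V : Type*} (G : SimpleGraph V) : Type _ :=
  {S : Set V // (G.induce S).Connected}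

/-- Two subtrees are isomorphic if their induced subgraphs are isomorphic as graphs. -/
def SubtreeIso {V : Type*} (G : SimpleGraph V) (S T : GraphSubtree G) : Prop :=
  Nonempty (G.induce S.1 ≃g G.induce T.1)

/-- `ns G`: the number of isomorphism classes of subtrees of `G`. -/
noncomputable def ns {V : Type*} (G : SimpleGraph V) : ℕ :=
  Nat.card (Quot (SubtreeIso G))

/-- Subtrees of `G` containing the root `r`. -/
def RootedSubtree {V : Type*} (G : SimpleGraph V) (r : V) : Type _ :=
  {S : Set V // r ∈ S ∧ (G.induce S).Connected}

/-- Root-preserving isomorphism of rooted subtrees. -/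
def RootedSubtreeIso {V : Type*} (G : SimpleGraph V) (r : V)
    (S T : RootedSubtree G r) : Prop :=
  ∃ f : G.induce S.1 ≃g G.induce T.1, f ⟨r, S.2.1⟩ = ⟨r, T.2.1⟩

/-- `nr G r`: the number of root-preserving isomorphism classes of subtrees
of `G` containing `r`. -/
noncomputable def nr {V : Type*} (G : SimpleGraph V) (r : V) : ℕ :=
  Nat.card (Quot (RootedSubtreeIso G r))

/-- `maxNS n` (written `S_n` in the paper): the maximum of `ns T` over all
trees `T` with `n` vertices. -/
noncomputable def maxNS (n : ℕ) : ℕ :=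
  sSup {k | ∃ G : SimpleGraph (Fin n), G.IsTree ∧ ns G = k}

/-- `maxNR n` (written `R_n` in the paper): the maximum of `nr T` over all
rooted trees `T` with `n` vertices. -/
noncomputable def maxNR (n : ℕ) : ℕ :=
  sSup {k | ∃ (G : SimpleGraph (Fin n)) (r : Fin n), G.IsTree ∧ nr G r = k}

/-- Rooted trees, built from single vertices by attaching the root of one tree as a new child of
the root of another. -/
inductive RTree : Type
  | single : RTree
  | graft : RTree → RTree → RTree

namespace RTree

/-- Number of vertices. -/
def size : RTree → ℕ
  | single => 1
  | graft a b => a.size + b.size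

/-- The list of branches at the root. -/
def branches : RTree → List RTree
  | single => []
  | graft a b => b :: a.branches

theorem size_pos (t : RTree) : 1 ≤ t.size := by
  induction t with
  | single => simp [size]
  | graft a b iha ihb => simp only [size]; omega

theorem size_eq_sum_branches (t : RTree) : t.size = 1 + (t.branches.map size).sum := by
  induction t with
  | single => simp [size, branches]
  | graft a b iha ihb => simp only [size, branches, List.map_cons, List.sum_cons]; omega

end RTree

/-- Coefficients describing an upper bound for the size of a sum of sets of multisets. -/
structure SumState where
  (k P E F m : ℕ)

namespace SumState

/-- Main bound. -/
def U (s : SumState) : ℕ := (s.k + 1) * s.P + (s.k + 2) * s.E + s.F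

/-- Increment of the main bound. -/
def V (s : SumState) : ℕ := (s.k + 2) * s.P + s.E

/-- Branch kinds: `0` is the four-vertex tree with five rooted subtrees, `i + 1` stands for all
other trees with `i + 1` vertices. -/
def kindCoeff : ℕ → ℕ
  | 0 => 4
  | 1 => 0
  | 2 => 1
  | 3 => 2
  | 4 => 3
  | 5 => 6
  | 6 => 10
  | _ => 15

/-- Number of vertices of a branch of a given kind. -/
def kindSize : ℕ → ℕ
  | 0 => 4
  | i + 1 => i + 1

/-- Effect of adding a branch on the bound. -/
def add (s : SumState) (i : ℕ) : SumState :=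
  if i = 1 then ⟨s.k + 1, s.P, s.E, s.F, s.m + 1⟩
  else ⟨s.k, kindCoeff i * s.P, kindCoeff i * s.E + s.P, kindCoeff i * s.F + s.E,
    s.m + kindSize i⟩

/-- The state of a single vertex. -/
def initial : SumState := ⟨0, 1, 0, 0, 1⟩

theorem add_right_comm (s : SumState) (i j : ℕ) : (s.add i).add j = (s.add j).add i := by
  rcases eq_or_ne i 1 with rfl | hi
  · rcases eq_or_ne j 1 with rfl | hj
    · rfl
    · simp only [add, hj, if_true, if_false, SumState.mk.injEq, true_and]; ring
  · rcases eq_or_ne j 1 with rfl | hj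
    · simp only [add, hi, if_true, if_false, SumState.mk.injEq, true_and]; ring
    · simp only [add, hi, hj, if_false, SumState.mk.injEq, true_and]
      refine ⟨?_, ?_, ?_, ?_⟩ <;> ring

instance : RightCommutative add := ⟨add_right_comm⟩

/-- A bound below `5 ^ (m / 4)` with a gap of one. -/
def strong (s : SumState) : Bool := (s.U + 1) ^ 4 ≤ 5 ^ s.m

/-- The bound which is wanted for a state. -/
def good (s : SumState) : Bool := s.U ^ 4 ≤ 5 ^ s.m && (s.m < 8 || s.strong)

/-- A sufficient criterion for a strong bound to persist when branches are added. -/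
def persistent (s : SumState) (K : List ℕ) : Bool :=
  s.strong && 100 * s.V ≤ 118 * s.U && (2 ≤ s.k || !K.contains 1)

/-- A search establishing that all states reachable by adding branches are good. -/
def search : ℕ → SumState → List ℕ → Bool
  | 0, _, _ => false
  | _ + 1, s, [] => s.good
  | n + 1, s, i :: K => s.persistent (i :: K) || (search n (s.add i) (i :: K) && search n s K)

theorem persistent_add {s : SumState} {K : List ℕ} (h : s.persistent K) {i : ℕ} (hi : i ∈ K) (h1 : 1 ≤ i)
    (h7 : i ≤ 7) : (s.add i).persistent K := by
  simp only [persistent, strong, Bool.and_eq_true, decide_eq_true_eq, Bool.or_eq_true] at h ⊢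
  obtain ⟨⟨hs, hV⟩, hk⟩ := h
  have hVP : s.P ≤ s.V := by unfold V; nlinarith [Nat.zero_le (s.k * s.P)]
  have key : ∀ c d x : ℕ, 100 * x ≤ c * (s.U + 1) → c ^ 4 ≤ 100 ^ 4 * 5 ^ d →
      x ^ 4 ≤ 5 ^ (s.m + d) := by
    intro c d x hx hc
    have h2 := Nat.pow_le_pow_left hx 4
    have h3 : (c * (s.U + 1)) ^ 4 ≤ (100 ^ 4 * 5 ^ d) * 5 ^ s.m := by
      rw [mul_pow]; exact Nat.mul_le_mul hc hs
    rw [mul_pow] at h2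
    rw [pow_add]
    have := h2.trans h3
    nlinarith
  by_cases hi1 : i = 1
  · subst hi1
    have hk2 : 2 ≤ s.k := by
      rcases hk with hk | hk
      · exact hk
      · simp [hi] at hk
    have hU' : (s.add 1).U = s.U + s.P + s.E := by simp [add, U]; ring
    have hV' : (s.add 1).V = s.V + s.P := by simp [add, V]; ring
    have hU : 3 * s.P + 4 * s.E ≤ s.U := by
      unfold U; nlinarith [Nat.mul_le_mul_right s.P hk2, Nat.mul_le_mul_right s.E hk2]
    refine ⟨⟨?_, ?_⟩, Or.inl (by simp [add]; omega)⟩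
    · rw [hU']
      exact key 149 1 _ (by omega) (by norm_num)
    · rw [hU', hV']; omega
  · have hU' : (s.add i).U = kindCoeff i * s.U + s.V := by simp [add, U, V, hi1]; ring
    have hV' : (s.add i).V = kindCoeff i * s.V + s.P := by simp [add, V, hi1]; ring
    have hm' : (s.add i).m = s.m + kindSize i := by simp [add, hi1]
    refine ⟨⟨?_, ?_⟩, ?_⟩
    · rw [hU', hm']
      refine key (100 * kindCoeff i + 118) _ _ (by nlinarith) ?_
      interval_cases i <;> simp_all [kindCoeff, kindSize]
    · rw [hU', hV']
      nlinarith [Nat.mul_le_mul_left (kindCoeff i) hV]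
    · simpa [add, hi1] using hk

theorem good_of_persistent {s : SumState} {K : List ℕ} (h : s.persistent K) : s.good := by
  simp only [persistent, strong, Bool.and_eq_true, decide_eq_true_eq] at h
  simp only [good, strong, Bool.and_eq_true, Bool.or_eq_true, decide_eq_true_eq]
  exact ⟨le_trans (Nat.pow_le_pow_left (Nat.le_succ _) 4) h.1.1, Or.inr h.1.1⟩

theorem good_foldl_of_persistent {K : List ℕ} (hK : ∀ i ∈ K, 1 ≤ i ∧ i ≤ 7) (L : List ℕ) :
    ∀ s : SumState, s.persistent K → (∀ i ∈ L, i ∈ K) → (L.foldl add s).good := by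
  induction L with
  | nil => intro s hs _; exact good_of_persistent hs
  | cons i L ih =>
    intro s hs hL
    have hi := hL i (by simp)
    exact ih _ (persistent_add hs hi (hK i hi).1 (hK i hi).2) fun j hj => hL j (by simp [hj])

theorem good_foldl_of_search (n : ℕ) : ∀ (s : SumState) (K L : List ℕ),
    (∀ i ∈ K, 1 ≤ i ∧ i ≤ 7) → search n s K → (∀ i ∈ L, i ∈ K) → (L.foldl add s).good := by
  induction n with
  | zero => intro s K L _ h; simp [search] at h
  | succ n ih =>
    intro s K L hK h hL
    cases K with
    | nil =>
      have : L = [] := List.eq_nil_iff_forall_not_mem.2 fun i hi => by simpa using hL i hi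
      subst this
      simpa [search] using h
    | cons i K =>
      simp only [search, Bool.or_eq_true, Bool.and_eq_true] at h
      rcases h with h | ⟨h1, h2⟩
      · exact good_foldl_of_persistent hK L s h hL
      · by_cases hi : i ∈ L
        · rw [(List.perm_cons_erase hi).foldl_eq, List.foldl_cons]
          exact ih _ _ _ hK h1 fun j hj => hL j (List.mem_of_mem_erase hj)
        · refine ih _ _ _ (fun j hj => hK j (by simp [hj])) h2 fun j hj => ?_
          rcases List.mem_cons.1 (hL j hj) with rfl | h
          · exact absurd hj hi
          · exact h

theorem search_initial : search 40 initial [1, 7, 6, 5, 4, 3, 2] = true := by decide +kernel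

theorem search_initial_add_zero : search 40 (initial.add 0) [1, 7, 6, 5, 4, 3, 2] = true := by
  decide +kernel

theorem good_foldl (s : SumState) (hs : s = initial ∨ s = initial.add 0) (L : List ℕ)
    (hL : ∀ i ∈ L, 1 ≤ i ∧ i ≤ 7) : (L.foldl add s).good := by
  refine good_foldl_of_search 40 s [1, 7, 6, 5, 4, 3, 2] L (by simp) ?_ fun i hi => ?_
  · rcases hs with rfl | rfl
    · exact search_initial
    · exact search_initial_add_zero
  · have := hL i hi
    simp only [List.mem_cons, List.not_mem_nil, or_false]
    omega

theorem foldl_add_m (L : List ℕ) : ∀ s : SumState,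
    (L.foldl add s).m = s.m + (L.map kindSize).sum := by
  induction L with
  | nil => simp
  | cons i L ih =>
    intro s
    rw [List.foldl_cons, ih, List.map_cons, List.sum_cons, ← Nat.add_assoc]
    congr 1
    unfold add
    split_ifs with h
    · subst h; rfl
    · rfl

/-- Bound for a sum with additional summands of the sizes one and two. -/
def ev (s : SumState) (j k : ℕ) : ℕ :=
  s.P * (∑ b ∈ Finset.range (j + 1), (s.k + k + 1 + b)) + s.E * (s.k + k + 2 + j) + s.F

theorem ev_zero (s : SumState) : s.ev 0 0 = s.U := by
  simp [ev, U]; ring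

theorem ev_add_one (s : SumState) (j k : ℕ) : (s.add 1).ev j k = s.ev j (k + 1) := by
  simp only [ev, add, if_true]
  have : s.k + 1 + k = s.k + (k + 1) := by ring
  rw [this]

theorem ev_add (s : SumState) {i : ℕ} (hi : i ≠ 1) (hc : 1 ≤ kindCoeff i) (j k : ℕ) :
    (s.add i).ev j k = (kindCoeff i - 1) * s.ev j k + s.ev (j + 1) k := by
  obtain ⟨c, hc⟩ := Nat.exists_eq_add_of_le hc
  simp only [ev, add, hi, if_false, hc, Finset.sum_range_succ _ (j + 1)]
  rw [Nat.add_sub_cancel_left]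
  ring

end SumState

open scoped Pointwise

namespace RTree

section Options

variable {Q : Type} [DecidableEq Q]

/-- The elements of `Q` which arise from rooted subtrees, when the single vertex is interpreted as
`o` and grafting as `g`. -/
def opts (o : Q) (g : Q → Q → Q) : RTree → Finset Q
  | single => {o}
  | graft a b => opts o g a ∪ Finset.image₂ g (opts o g a) (opts o g b)

/-- Either nothing or one element of `X`. -/
def choices (X : Finset Q) : Finset (Multiset Q) := insert 0 (X.image fun x => {x})

/-- All multisets obtained by choosing at most one option for each tree of a list. -/
def choiceSum (o : Q) (g : Q → Q → Q) (L : List RTree) : Finset (Multiset Q) :=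
  (L.map fun b => choices (opts o g b)).sum

variable {o : Q} {g : Q → Q → Q}

theorem mem_choices {X : Finset Q} {m : Multiset Q} :
    m ∈ choices X ↔ m = 0 ∨ ∃ x ∈ X, m = {x} := by
  simp [choices, eq_comm]

theorem card_choices_le (X : Finset Q) : (choices X).card ≤ X.card + 1 :=
  (Finset.card_insert_le _ _).trans (Nat.succ_le_succ Finset.card_image_le)

theorem choiceSum_cons (b : RTree) (L : List RTree) :
    choiceSum o g (b :: L) = choices (opts o g b) + choiceSum o g L := by
  simp [choiceSum]

theorem choiceSum_perm {L L' : List RTree} (h : L.Perm L') :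
    choiceSum o g L = choiceSum o g L' :=
  (h.map _).sum_eq

theorem opts_eq_image [RightCommutative g] (t : RTree) :
    opts o g t = (choiceSum o g t.branches).image (Multiset.foldl g o) := by
  induction t with
  | single => simp [opts, branches, choiceSum]
  | graft a b iha _ =>
    ext q
    simp only [opts, branches, choiceSum_cons, Finset.mem_union, Finset.mem_image₂, iha,
      Finset.mem_image, Finset.mem_add, mem_choices]
    constructor
    · rintro (⟨m, hm, rfl⟩ | ⟨_, ⟨m, hm, rfl⟩, x, hx, rfl⟩)
      · exact ⟨m, ⟨0, Or.inl rfl, m, hm, zero_add m⟩, rfl⟩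
      · exact ⟨m + {x}, ⟨{x}, Or.inr ⟨x, hx, rfl⟩, m, hm, add_comm _ _⟩,
          Multiset.foldl_add g o m {x}⟩
    · rintro ⟨_, ⟨y, rfl | ⟨x, hx, rfl⟩, m, hm, rfl⟩, rfl⟩
      · exact Or.inl ⟨m, hm, by rw [zero_add]⟩
      · exact Or.inr ⟨_, ⟨m, hm, rfl⟩, x, hx, by
          rw [add_comm, Multiset.foldl_add]; rfl⟩

theorem card_opts_le [RightCommutative g] (t : RTree) :
    (opts o g t).card ≤ (choiceSum o g t.branches).card := by
  rw [opts_eq_image]; exact Finset.card_image_le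

theorem base_mem_opts (t : RTree) : o ∈ opts o g t := by
  induction t with
  | single => simp [opts]
  | graft a b iha _ => exact Finset.mem_union_left _ iha

theorem edge_mem_opts {t : RTree} (ht : t.size ≠ 1) : g o o ∈ opts o g t := by
  cases t with
  | single => exact absurd rfl ht
  | graft a b =>
    exact Finset.mem_union_right _ (Finset.mem_image₂_of_mem (base_mem_opts a) (base_mem_opts b))

theorem eq_single_of_size {t : RTree} (ht : t.size = 1) : t = single := by
  cases t with
  | single => rfl
  | graft a b =>
    have := a.size_pos
    have := b.size_pos
    simp only [size] at ht
    omega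

theorem exists_of_mem_nsmul_choices_singleton (k : ℕ) : ∀ m ∈ k • choices ({o} : Finset Q),
    ∃ a ≤ k, m = a • {o} := by
  induction k with
  | zero => intro m hm; exact ⟨0, le_rfl, by simpa using hm⟩
  | succ k ih =>
    intro m hm
    rw [succ_nsmul, Finset.mem_add] at hm
    obtain ⟨x, hx, y, hy, rfl⟩ := hm
    obtain ⟨a, ha, rfl⟩ := ih x hx
    rcases mem_choices.1 hy with rfl | ⟨z, hz, rfl⟩
    · exact ⟨a, ha.trans (Nat.le_succ k), by simp⟩
    · rw [Finset.mem_singleton.1 hz]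
      exact ⟨a + 1, Nat.succ_le_succ ha, by rw [succ_nsmul]⟩

theorem exists_of_mem_nsmul_choices_pair (p : Q) (k : ℕ) :
    ∀ m ∈ k • choices ({o, p} : Finset Q),
      ∃ a b, a + b ≤ k ∧ m = a • {o} + b • {p} := by
  induction k with
  | zero => intro m hm; exact ⟨0, 0, le_rfl, by simpa using hm⟩
  | succ k ih =>
    intro m hm
    rw [succ_nsmul, Finset.mem_add] at hm
    obtain ⟨x, hx, y, hy, rfl⟩ := hm
    obtain ⟨a, b, ha, rfl⟩ := ih x hx
    rcases mem_choices.1 hy with rfl | ⟨z, hz, rfl⟩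
    · exact ⟨a, b, by omega, by simp⟩
    · rcases Finset.mem_insert.1 hz with rfl | hz
      · exact ⟨a + 1, b, by omega, by rw [succ_nsmul, add_right_comm]⟩
      · rw [Finset.mem_singleton.1 hz]
        exact ⟨a, b + 1, by omega, by rw [succ_nsmul, add_assoc]⟩

theorem card_nsmul_add_nsmul_le (p : Q) (j k : ℕ) :
    (j • choices ({o, p} : Finset Q) + k • choices ({o} : Finset Q)).card ≤
      ∑ b ∈ Finset.range (j + 1), (k + 1 + b) := by
  have hsub : j • choices ({o, p} : Finset Q) + k • choices ({o} : Finset Q) ⊆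
      ((Finset.range (j + 1)).sigma fun b => Finset.range (k + 1 + b)).image
        fun x : (_ : ℕ) × ℕ => (x.2 • {o} + (j - x.1) • {p} : Multiset Q) := by
    intro m hm
    obtain ⟨x, hx, y, hy, rfl⟩ := Finset.mem_add.1 hm
    obtain ⟨a, b, hab, rfl⟩ := exists_of_mem_nsmul_choices_pair p j x hx
    obtain ⟨c, hc, rfl⟩ := exists_of_mem_nsmul_choices_singleton k y hy
    refine Finset.mem_image.2 ⟨⟨j - b, a + c⟩, ?_, ?_⟩
    · simp only [Finset.mem_sigma, Finset.mem_range]; omega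
    · have : j - (j - b) = b := by omega
      simp only [this, add_nsmul]
      abel
  refine (Finset.card_le_card hsub).trans (Finset.card_image_le.trans ?_)
  rw [Finset.card_sigma]
  simp

theorem card_add_choices_le (W X : Finset Q) (Y : Finset (Multiset Q)) (h : W ⊆ X) :
    (Y + choices X).card ≤ (X.card - W.card) * Y.card + (Y + choices W).card := by
  have hsub : Y + choices X ⊆ (Y + (X \ W).image fun x => {x}) ∪ (Y + choices W) := by
    intro m hm
    obtain ⟨y, hy, x, hx, rfl⟩ := Finset.mem_add.1 hm
    rcases mem_choices.1 hx with rfl | ⟨z, hz, rfl⟩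
    · exact Finset.mem_union_right _ (Finset.add_mem_add hy (mem_choices.2 (Or.inl rfl)))
    · by_cases hzW : z ∈ W
      · exact Finset.mem_union_right _
          (Finset.add_mem_add hy (mem_choices.2 (Or.inr ⟨z, hzW, rfl⟩)))
      · exact Finset.mem_union_left _ (Finset.add_mem_add hy
          (Finset.mem_image_of_mem _ (Finset.mem_sdiff.2 ⟨hz, hzW⟩)))
  refine (Finset.card_le_card hsub).trans ((Finset.card_union_le _ _).trans ?_)
  gcongr
  refine Finset.card_add_le.trans ?_
  rw [mul_comm, ← Finset.card_sdiff_of_subset h]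
  exact Nat.mul_le_mul_right _ Finset.card_image_le

theorem card_choiceSum_add_le (hp : g o o ≠ o) (κ : RTree → ℕ) (L : List RTree)
    (hL : ∀ b ∈ L, (κ b = 1 ∧ b = single) ∨ (κ b ≠ 1 ∧ 1 ≤ SumState.kindCoeff (κ b) ∧
      b.size ≠ 1 ∧ (opts o g b).card ≤ SumState.kindCoeff (κ b) + 1)) :
    ∀ j k : ℕ, (choiceSum o g L + (j • choices {o, g o o} + k • choices {o})).card ≤
      ((L.map κ).foldl SumState.add SumState.initial).ev j k := by
  induction L using List.reverseRecOn with
  | nil =>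
    intro j k
    refine le_trans (le_of_eq ?_) ((card_nsmul_add_nsmul_le (o := o) (g o o) j k).trans (le_of_eq ?_))
    · simp [choiceSum]
    · simp [SumState.ev, SumState.initial]
  | append_singleton L b ih =>
    intro j k
    have ih := ih fun c hc => hL c (by simp [hc])
    have hperm : choiceSum o g (L ++ [b]) = choices (opts o g b) + choiceSum o g L := by
      rw [choiceSum_perm List.perm_append_comm, List.singleton_append, choiceSum_cons]
    rw [hperm, List.map_append, List.foldl_append, List.map_singleton, List.foldl_cons,
      List.foldl_nil]
    rcases hL b (by simp) with ⟨h1, rfl⟩ | ⟨h1, h2, h3, h4⟩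
    · rw [h1, SumState.ev_add_one]
      refine le_trans (le_of_eq ?_) (ih j (k + 1))
      rw [succ_nsmul]
      simp only [opts]
      congr 1
      abel
    · rw [SumState.ev_add _ h1 h2]
      have hW : ({o, g o o} : Finset Q) ⊆ opts o g b := by
        intro x hx
        rcases Finset.mem_insert.1 hx with rfl | hx
        · exact base_mem_opts b
        · rw [Finset.mem_singleton.1 hx]; exact edge_mem_opts h3
      have := card_add_choices_le _ _
        (choiceSum o g L + (j • choices {o, g o o} + k • choices {o})) hW
      rw [Finset.card_pair hp.symm] at this
      refine le_trans (le_of_eq ?_) (this.trans (Nat.add_le_add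
        (Nat.mul_le_mul (by omega) (ih j k)) (le_trans (le_of_eq ?_) (ih (j + 1) k))))
      · congr 1; abel
      · rw [succ_nsmul]; congr 1; abel

theorem card_choiceSum_le (hp : g o o ≠ o) (κ : RTree → ℕ) (L : List RTree)
    (hL : ∀ b ∈ L, (κ b = 1 ∧ b = single) ∨ (κ b ≠ 1 ∧ 1 ≤ SumState.kindCoeff (κ b) ∧
      b.size ≠ 1 ∧ (opts o g b).card ≤ SumState.kindCoeff (κ b) + 1)) :
    (choiceSum o g L).card ≤ ((L.map κ).foldl SumState.add SumState.initial).U := by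
  simpa [SumState.ev_zero] using card_choiceSum_add_le hp κ L hL 0 0

theorem exists_perm_cons_of_mem {α : Type*} {a : α} {L : List α} (h : a ∈ L) :
    ∃ L', L.Perm (a :: L') := by
  obtain ⟨s, t, rfl⟩ := List.append_of_mem h
  exact ⟨s ++ t, List.perm_middle⟩

theorem zero_mem_choiceSum (L : List RTree) : 0 ∈ choiceSum o g L := by
  induction L with
  | nil => simp [choiceSum]
  | cons b L ih =>
    rw [choiceSum_cons]
    exact Finset.mem_add.2 ⟨0, mem_choices.2 (Or.inl rfl), 0, ih, add_zero 0⟩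

theorem card_choiceSum_cons_le (b : RTree) (L : List RTree) :
    (choiceSum o g (b :: L)).card ≤ ((opts o g b).card + 1) * (choiceSum o g L).card := by
  rw [choiceSum_cons]
  exact Finset.card_add_le.trans (Nat.mul_le_mul_right _ (card_choices_le _))

theorem card_choiceSum_cons_cons_lt (b b' : RTree) (L : List RTree) :
    (choiceSum o g (b :: b' :: L)).card <
      ((opts o g b).card + 1) * (choiceSum o g (b' :: L)).card := by
  rw [choiceSum_cons]
  set A := choices (opts o g b)
  set B := choiceSum o g (b' :: L) with hB
  have hA : ({o} : Multiset Q) ∈ A := mem_choices.2 (Or.inr ⟨o, base_mem_opts b, rfl⟩)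
  have hB' : ({o} : Multiset Q) ∈ B := by
    rw [hB, choiceSum_cons]
    exact Finset.mem_add.2 ⟨{o}, mem_choices.2 (Or.inr ⟨o, base_mem_opts b', rfl⟩), 0,
      zero_mem_choiceSum L, add_zero _⟩
  have hmem : (({o} : Multiset Q), (0 : Multiset Q)) ∈ A ×ˢ B :=
    Finset.mk_mem_product hA (zero_mem_choiceSum _)
  have hsub : A + B ⊆ ((A ×ˢ B).erase ({o}, 0)).image fun x => x.1 + x.2 := by
    intro m hm
    obtain ⟨x, hx, y, hy, rfl⟩ := Finset.mem_add.1 hm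
    by_cases h : (x, y) = (({o} : Multiset Q), (0 : Multiset Q))
    · obtain ⟨rfl, rfl⟩ := Prod.mk.inj h
      refine Finset.mem_image.2 ⟨(0, {o}), Finset.mem_erase.2 ⟨fun h => ?_,
        Finset.mk_mem_product (mem_choices.2 (Or.inl rfl)) hB'⟩, add_comm _ _⟩
      simpa using (Prod.mk.inj h).2
    · exact Finset.mem_image.2 ⟨(x, y), Finset.mem_erase.2 ⟨h, Finset.mk_mem_product hx hy⟩, rfl⟩
  have h1 := (Finset.card_le_card hsub).trans Finset.card_image_le
  have h2 := Finset.card_erase_lt_of_mem hmem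
  rw [Finset.card_product] at h2
  exact (h1.trans_lt h2).trans_le (Nat.mul_le_mul_right _ (card_choices_le _))

theorem card_add_self_le {M : Type*} [AddCommMonoid M] [DecidableEq M] (A : Finset M) :
    (A + A).card ≤ (A.card + 1).choose 2 := by
  rw [← Finset.card_sym2]
  have hsub : A + A ⊆ A.sym2.image (Sym2.lift ⟨fun x y => x + y, add_comm⟩) := by
    intro m hm
    obtain ⟨x, hx, y, hy, rfl⟩ := Finset.mem_add.1 hm
    exact Finset.mem_image.2 ⟨s(x, y), Finset.mk_mem_sym2_iff.2 ⟨hx, hy⟩, rfl⟩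
  exact (Finset.card_le_card hsub).trans Finset.card_image_le

/-- The rooted subtrees of a vertex with a pendant vertex and a pendant path of length two. -/
def spiderOpts (o : Q) (g : Q → Q → Q) : Finset Q :=
  {o, g o o, g o (g o o), g (g o o) o, g (g o o) (g o o)}

theorem card_spiderOpts_le : (spiderOpts o g).card ≤ 5 := Finset.card_le_five

theorem opts_of_size_two {t : RTree} (ht : t.size = 2) : opts o g t = {o, g o o} := by
  cases t with
  | single => simp [size] at ht
  | graft a b =>
    have := a.size_pos
    have := b.size_pos
    simp only [size] at ht
    obtain rfl := eq_single_of_size (t := a) (by omega)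
    obtain rfl := eq_single_of_size (t := b) (by omega)
    ext; simp [opts]

theorem opts_of_size_three [RightCommutative g] {t : RTree} (ht : t.size = 3) :
    opts o g t = {o, g o o, g o (g o o)} ∨ opts o g t = {o, g o o, g (g o o) o} := by
  cases t with
  | single => simp [size] at ht
  | graft a b =>
    have := a.size_pos
    have := b.size_pos
    simp only [size] at ht
    obtain ⟨ha, hb⟩ | ⟨ha, hb⟩ : (a.size = 1 ∧ b.size = 2) ∨ (a.size = 2 ∧ b.size = 1) := by omega
    · obtain rfl := eq_single_of_size ha
      left
      ext
      simp only [opts, opts_of_size_two hb, Finset.mem_union, Finset.mem_insert,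
        Finset.mem_singleton, Finset.image₂_singleton_left, Finset.image_insert,
        Finset.image_singleton]
    · obtain rfl := eq_single_of_size hb
      right
      ext
      simp only [opts, opts_of_size_two ha, Finset.mem_union, Finset.mem_insert,
        Finset.mem_singleton, Finset.image₂_singleton_right, Finset.image_insert,
        Finset.image_singleton]
      tauto

theorem opts_of_size_four [RightCommutative g] {t : RTree} (ht : t.size = 4) :
    opts o g t = spiderOpts o g ∨ (opts o g t).card ≤ 4 := by
  cases t with
  | single => simp [size] at ht
  | graft a b =>
    have := a.size_pos
    have := b.size_pos
    simp only [size] at ht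
    obtain ⟨ha, hb⟩ | ⟨ha, hb⟩ | ⟨ha, hb⟩ : (a.size = 1 ∧ b.size = 3) ∨ (a.size = 2 ∧ b.size = 2) ∨
      (a.size = 3 ∧ b.size = 1) := by omega
    · obtain rfl := eq_single_of_size ha
      right
      have hb : (opts o g b).card ≤ 3 := by
        rcases opts_of_size_three (o := o) (g := g) hb with h | h <;> rw [h] <;>
          exact Finset.card_le_three
      simp only [opts]
      refine (Finset.card_union_le _ _).trans ?_
      have := Finset.card_image₂_le g {o} (opts o g b)
      simp only [Finset.card_singleton] at this ⊢
      omega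
    · left
      ext
      simp only [opts, opts_of_size_two ha, opts_of_size_two hb, spiderOpts, Finset.mem_union,
        Finset.mem_insert, Finset.mem_singleton, Finset.mem_image₂]
      constructor
      · rintro ((h | h) | ⟨x, (rfl | rfl), y, (rfl | rfl), rfl⟩) <;> simp_all
      · rintro (h | h | h | h | h)
        · simp [h]
        · simp [h]
        · exact Or.inr ⟨o, by simp, g o o, by simp, h.symm⟩
        · exact Or.inr ⟨g o o, by simp, o, by simp, h.symm⟩
        · exact Or.inr ⟨g o o, by simp, g o o, by simp, h.symm⟩
    · obtain rfl := eq_single_of_size hb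
      rcases opts_of_size_three (o := o) (g := g) ha with h | h
      · left
        ext
        have hc : g (g o (g o o)) o = g (g o o) (g o o) := RightCommutative.right_comm _ _ _
        simp only [opts, h, spiderOpts, Finset.mem_union, Finset.mem_insert,
          Finset.mem_singleton, Finset.image₂_singleton_right, Finset.image_insert,
          Finset.image_singleton, hc]
        tauto
      · right
        have : opts o g (graft a single) = {o, g o o, g (g o o) o, g (g (g o o) o) o} := by
          ext
          simp only [opts, h, Finset.mem_union, Finset.mem_insert,
            Finset.mem_singleton, Finset.image₂_singleton_right, Finset.image_insert,
            Finset.image_singleton]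
          tauto
        rw [this]
        exact Finset.card_le_four

theorem card_choiceSum_pow_le [RightCommutative g] (hp : g o o ≠ o) (n : ℕ) :
    ∀ L : List RTree, 1 + (L.map size).sum = n →
      (choiceSum o g L).card ^ 4 ≤ 5 ^ n ∧
        (8 ≤ n → ((choiceSum o g L).card + 1) ^ 4 ≤ 5 ^ n) := by
  classical
  induction n using Nat.strong_induction_on with
  | _ n ih =>
  intro L hn
  have hbr : ∀ b ∈ L, (opts o g b).card ^ 4 ≤ 5 ^ b.size ∧
      (8 ≤ b.size → ((opts o g b).card + 1) ^ 4 ≤ 5 ^ b.size) := by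
    intro b hb
    have hlt : b.size < n := by
      have := List.single_le_sum (l := L.map size) (by simp) _ (List.mem_map_of_mem hb)
      omega
    obtain ⟨h1, h2⟩ := ih _ hlt b.branches (size_eq_sum_branches b).symm
    have h3 := card_opts_le (o := o) (g := g) b
    exact ⟨(Nat.pow_le_pow_left h3 4).trans h1,
      fun h => (Nat.pow_le_pow_left (Nat.succ_le_succ h3) 4).trans (h2 h)⟩
  have weaken : ((choiceSum o g L).card + 1) ^ 4 ≤ 5 ^ n →
      (choiceSum o g L).card ^ 4 ≤ 5 ^ n ∧
        (8 ≤ n → ((choiceSum o g L).card + 1) ^ 4 ≤ 5 ^ n) := fun h =>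
    ⟨(Nat.pow_le_pow_left (Nat.le_succ _) 4).trans h, fun _ => h⟩
  by_cases hbig : ∃ b ∈ L, 8 ≤ b.size
  · obtain ⟨b, hb, hb8⟩ := hbig
    have hO := (hbr b hb).2 hb8
    obtain ⟨L', hL'⟩ := exists_perm_cons_of_mem hb
    have hsum := (hL'.map size).sum_eq
    rw [List.map_cons, List.sum_cons] at hsum
    apply weaken
    rw [choiceSum_perm hL']
    have hW := (ih (1 + (L'.map size).sum) (by omega) L' rfl).1
    cases L' with
    | nil =>
      have h1 : (choiceSum o g [b]).card ≤ (opts o g b).card + 1 := by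
        simpa [choiceSum] using card_choiceSum_cons_le (o := o) (g := g) b []
      have h2 : 2 ≤ (opts o g b).card := by
        rw [← Finset.card_pair hp]
        refine Finset.card_le_card fun x hx => ?_
        rcases Finset.mem_insert.1 hx with rfl | hx
        · exact edge_mem_opts (by omega)
        · rw [Finset.mem_singleton.1 hx]; exact base_mem_opts b
      have hn' : n = b.size + 1 := by simp at hsum; omega
      rw [hn', pow_succ 5]
      have h3 : 3 * ((choiceSum o g [b]).card + 1) ≤ 4 * ((opts o g b).card + 1) := by omega
      have h4 := Nat.pow_le_pow_left h3 4
      rw [mul_pow, mul_pow] at h4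
      omega
    | cons b' L' =>
      have h1 := card_choiceSum_cons_cons_lt (o := o) (g := g) b b' L'
      refine (Nat.pow_le_pow_left (Nat.succ_le_of_lt h1) 4).trans ?_
      rw [mul_pow]
      refine (Nat.mul_le_mul hO hW).trans (le_of_eq ?_)
      rw [← pow_add]
      congr 1
      omega
  push Not at hbig
  let p : RTree → Prop := fun b => b.size = 4 ∧ opts o g b = spiderOpts o g
  let κ : RTree → ℕ := fun b => if p b then 0 else b.size
  have hκp : ∀ b, p b → κ b = 0 := fun b h => if_pos h
  have hκn : ∀ b, ¬ p b → κ b = b.size := fun b h => if_neg h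
  have hsize : ∀ b, SumState.kindSize (κ b) = b.size := by
    intro b
    by_cases h : p b
    · rw [hκp b h, h.1]; rfl
    · rw [hκn b h]
      obtain ⟨k, hk⟩ := Nat.exists_eq_add_of_le' b.size_pos
      rw [hk]; rfl
  have hkind : ∀ b ∈ L, (κ b = 1 ∧ b = single) ∨ (κ b ≠ 1 ∧ 1 ≤ SumState.kindCoeff (κ b) ∧
      b.size ≠ 1 ∧ (opts o g b).card ≤ SumState.kindCoeff (κ b) + 1) := by
    intro b hb
    by_cases h : p b
    · right
      rw [hκp b h, h.1, h.2]
      exact ⟨by norm_num, by decide, by norm_num, card_spiderOpts_le⟩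
    · rw [hκn b h]
      by_cases h1 : b.size = 1
      · exact Or.inl ⟨h1, eq_single_of_size h1⟩
      right
      have h2 := hbig b hb
      have h3 := b.size_pos
      have h4 := (hbr b hb).1
      have key : ∀ c k, b.size = k → 5 ^ k < (c + 1) ^ 4 → (opts o g b).card ≤ c := by
        intro c k hk hc
        by_contra hcon
        push Not at hcon
        have := Nat.pow_le_pow_left (Nat.succ_le_of_lt hcon) 4
        rw [hk] at h4
        exact absurd (this.trans h4) (by simpa using hc)
      refine ⟨h1, ?_, h1, ?_⟩
      · generalize b.size = k at *
        interval_cases k <;> first | exact absurd rfl h1 | decide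
      · obtain h | h | h | h | h | h : b.size = 2 ∨ b.size = 3 ∨ b.size = 4 ∨ b.size = 5 ∨
          b.size = 6 ∨ b.size = 7 := by omega
        · rw [h]; exact key _ _ h (by norm_num [SumState.kindCoeff])
        · rw [h]; exact key _ _ h (by norm_num [SumState.kindCoeff])
        · rw [h]
          rcases opts_of_size_four (o := o) (g := g) h with h' | h'
          · exact absurd ⟨h, h'⟩ ‹¬ p b›
          · exact h'
        · rw [h]; exact key _ _ h (by norm_num [SumState.kindCoeff])
        · rw [h]; exact key _ _ h (by norm_num [SumState.kindCoeff])
        · rw [h]; exact key _ _ h (by norm_num [SumState.kindCoeff])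
  have finish : ∀ s : SumState, s.m = n → s.good → (choiceSum o g L).card ≤ s.U →
      (choiceSum o g L).card ^ 4 ≤ 5 ^ n ∧
        (8 ≤ n → ((choiceSum o g L).card + 1) ^ 4 ≤ 5 ^ n) := by
    rintro s rfl hs hc
    simp only [SumState.good, SumState.strong, Bool.and_eq_true, Bool.or_eq_true,
      decide_eq_true_eq] at hs
    refine ⟨(Nat.pow_le_pow_left hc 4).trans hs.1, fun h8 => ?_⟩
    rcases hs.2 with h | h
    · omega
    · exact (Nat.pow_le_pow_left (Nat.succ_le_succ hc) 4).trans h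
  have hm : ∀ M : List RTree, ((M.map κ).map SumState.kindSize) = M.map size := by
    intro M
    rw [List.map_map]
    exact List.map_congr_left fun b _ => hsize b
  have hrange : ∀ b ∈ L, ¬ p b → 1 ≤ κ b ∧ κ b ≤ 7 := by
    intro b hb h
    have := hbig b hb
    have := b.size_pos
    rw [hκn b h]
    omega
  by_cases h1 : ∃ b ∈ L, p b
  · obtain ⟨b, hb, hpb⟩ := h1
    obtain ⟨L', hL'⟩ := exists_perm_cons_of_mem hb
    have hsum := (hL'.map size).sum_eq
    rw [List.map_cons, List.sum_cons, hpb.1] at hsum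
    by_cases h2 : ∃ b ∈ L', p b
    · obtain ⟨b', hb', hpb'⟩ := h2
      obtain ⟨L'', hL''⟩ := exists_perm_cons_of_mem hb'
      have hsum' := (hL''.map size).sum_eq
      rw [List.map_cons, List.sum_cons, hpb'.1] at hsum'
      apply weaken
      have hW := (ih (1 + (L''.map size).sum) (by omega) L'' rfl).1
      have hpos : 1 ≤ (choiceSum o g L'').card :=
        Finset.card_pos.2 ⟨0, zero_mem_choiceSum L''⟩
      have h21 : (choiceSum o g L).card ≤ 21 * (choiceSum o g L'').card := by
        rw [choiceSum_perm (hL'.trans (hL''.cons b)), choiceSum_cons, choiceSum_cons, hpb.2, hpb'.2,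
          ← add_assoc]
        refine Finset.card_add_le.trans (Nat.mul_le_mul_right _ ?_)
        refine (card_add_self_le _).trans ?_
        exact Nat.choose_le_choose (b := 7) 2 (Nat.succ_le_succ
          ((card_choices_le _).trans (Nat.succ_le_succ card_spiderOpts_le)))
      have h22 : (choiceSum o g L).card + 1 ≤ 22 * (choiceSum o g L'').card := by omega
      refine (Nat.pow_le_pow_left h22 4).trans ?_
      have hn8 : n = 8 + (1 + (L''.map size).sum) := by omega
      rw [mul_pow, hn8, pow_add]
      exact Nat.mul_le_mul (by norm_num) hW
    · push Not at h2
      refine finish (((b :: L').map κ).foldl SumState.add SumState.initial) ?_ ?_ ?_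
      · rw [SumState.foldl_add_m, hm, List.map_cons, List.sum_cons, hpb.1]
        simp only [SumState.initial]
        omega
      · rw [List.map_cons, List.foldl_cons, hκp b hpb]
        refine SumState.good_foldl _ (Or.inr rfl) _ fun i hi => ?_
        obtain ⟨b', hb', rfl⟩ := List.mem_map.1 hi
        exact hrange b' (hL'.mem_iff.2 (List.mem_cons_of_mem _ hb')) (h2 b' hb')
      · rw [choiceSum_perm hL']
        exact card_choiceSum_le hp κ _ fun c hc => hkind c (hL'.mem_iff.2 hc)
  · push Not at h1
    refine finish ((L.map κ).foldl SumState.add SumState.initial) ?_ ?_ ?_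
    · rw [SumState.foldl_add_m, hm]
      exact hn
    · refine SumState.good_foldl _ (Or.inl rfl) _ fun i hi => ?_
      obtain ⟨b', hb', rfl⟩ := List.mem_map.1 hi
      exact hrange b' hb' (h1 b' hb')
    · exact card_choiceSum_le hp κ _ hkind

/-- There are at most `5 ^ (n / 4)` options for a rooted tree with `n` vertices. -/
theorem card_opts_pow_le [RightCommutative g] (hp : g o o ≠ o) (t : RTree) :
    (opts o g t).card ^ 4 ≤ 5 ^ t.size :=
  (Nat.pow_le_pow_left (card_opts_le t) 4).trans
    (card_choiceSum_pow_le hp _ t.branches (size_eq_sum_branches t).symm).1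

end Options

end RTree

namespace SimpleGraph

variable {V : Type*} {G : SimpleGraph V} {S : Set V}

/-- A set of vertices induces a connected graph if every nontrivial cut is crossed. -/
theorem induce_connected_iff_cut : (G.induce S).Connected ↔
    S.Nonempty ∧ ∀ C ⊆ S, C.Nonempty → C ≠ S → ∃ x ∈ C, ∃ y ∈ S, y ∉ C ∧ G.Adj x y := by
  constructor
  · intro h
    obtain ⟨⟨z, hz⟩⟩ := h.nonempty
    refine ⟨⟨z, hz⟩, fun C hC ⟨x, hx⟩ hne => ?_⟩
    obtain ⟨y, hy, hyC⟩ := Set.exists_of_ssubset (hC.ssubset_of_ne hne)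
    obtain ⟨p⟩ := h.preconnected ⟨x, hC hx⟩ ⟨y, hy⟩
    obtain ⟨d, -, hd1, hd2⟩ := p.exists_boundary_dart {v | v.1 ∈ C} hx hyC
    exact ⟨d.fst.1, hd1, d.snd.1, d.snd.2, hd2, d.adj⟩
  · rintro ⟨⟨z, hz⟩, h⟩
    rw [connected_iff_exists_forall_reachable]
    refine ⟨⟨z, hz⟩, ?_⟩
    by_contra hcon
    push Not at hcon
    obtain ⟨⟨w, hw⟩, hzw⟩ := hcon
    obtain ⟨x, ⟨hxS, hx⟩, y, hyS, hy, hxy⟩ :=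
      h {v | ∃ hv : v ∈ S, (G.induce S).Reachable ⟨z, hz⟩ ⟨v, hv⟩} (fun v hv => hv.1)
        ⟨z, hz, Reachable.refl _⟩ (fun he => hzw (he.symm.subset hw).2)
    refine hy ⟨hyS, hx.trans (Adj.reachable ?_)⟩
    exact hxy

theorem IsAcyclic.eq_of_adj_of_adj (hG : G.IsAcyclic) (hS : (G.induce S).Connected) {v v' w : V}
    (hv : v ∈ S) (hv' : v' ∈ S) (hw : w ∉ S) (h : G.Adj v w) (h' : G.Adj v' w) : v = v' := by
  by_contra hne
  obtain ⟨p, hp⟩ := hS.preconnected.exists_isPath ⟨v, hv⟩ ⟨v', hv'⟩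
  let q : G.Path v v' := Path.mapEmbedding (Embedding.induce S) ⟨p, hp⟩
  let q' : G.Path v v' := ⟨.cons h (.cons h'.symm .nil), by simp [h.ne, h'.ne.symm, hne]⟩
  have hmem : w ∈ q.1.support := by
    rw [(hG.subsingleton_path v v').elim q q']
    simp [q']
  have hmem' : w ∈ (p.map (Embedding.induce S).toHom).support := hmem
  rw [Walk.support_map, List.mem_map] at hmem'
  obtain ⟨x, -, rfl⟩ := hmem'
  exact hw x.2

end SimpleGraph

namespace RTree

/-- Two rooted trees are equivalent if they differ by the order of the branches. -/
inductive Equiv : RTree → RTree → Prop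
  | refl (a) : Equiv a a
  | symm {a b} : Equiv a b → Equiv b a
  | trans {a b c} : Equiv a b → Equiv b c → Equiv a c
  | graft {a a' b b'} : Equiv a a' → Equiv b b' → Equiv (graft a b) (graft a' b')
  | swap (a b c) : Equiv (RTree.graft (RTree.graft a b) c) (RTree.graft (RTree.graft a c) b)

theorem Equiv.size_eq {a b : RTree} (h : Equiv a b) : a.size = b.size := by
  induction h with
  | refl => rfl
  | symm _ ih => exact ih.symm
  | trans _ _ ih ih' => exact ih.trans ih'
  | graft _ _ ih ih' => simp only [size, ih, ih']
  | swap => simp only [size]; omega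

instance setoid : Setoid RTree := ⟨Equiv, Equiv.refl, Equiv.symm, Equiv.trans⟩

/-- The class of the tree with a single vertex. -/
def qsingle : Quotient setoid := ⟦single⟧

/-- Grafting of classes. -/
def qgraft : Quotient setoid → Quotient setoid → Quotient setoid :=
  Quotient.map₂ RTree.graft fun _ _ h _ _ h' => Equiv.graft h h'

instance : RightCommutative qgraft := ⟨by
  rintro ⟨a⟩ ⟨b⟩ ⟨c⟩
  exact Quotient.sound (Equiv.swap a b c)⟩

theorem qgraft_qsingle_ne : qgraft qsingle qsingle ≠ qsingle := fun h =>
  absurd (Equiv.size_eq (Quotient.exact h)) (by decide)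

theorem exists_equiv_graft_of_mem_branches {t b : RTree} (h : b ∈ t.branches) :
    ∃ a, Equiv t (RTree.graft a b) := by
  induction t with
  | single => simp [branches] at h
  | graft c d ih _ =>
    rcases List.mem_cons.1 h with rfl | h
    · exact ⟨c, Equiv.refl _⟩
    · obtain ⟨a, ha⟩ := ih h
      exact ⟨RTree.graft a d, (Equiv.graft ha (Equiv.refl d)).trans (Equiv.swap a b d)⟩

section Shape

variable {V : Type*} (G : SimpleGraph V)

/-- The vertex set `S` with the root `r` induces a subtree of `G` of the shape `t`. -/
def Shape : Set V → V → RTree → Prop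
  | S, r, single => S = {r}
  | S, r, graft a b => ∃ A B s, Shape A r a ∧ Shape B s b ∧ S = A ∪ B ∧ Disjoint A B ∧
      G.Adj r s ∧ ∀ x ∈ A, ∀ y ∈ B, G.Adj x y → x = r ∧ y = s

variable {G} {S : Set V} {r : V} {t : RTree}

theorem Shape.root_mem (h : Shape G S r t) : r ∈ S := by
  induction t generalizing S r with
  | single => rw [h]; rfl
  | graft a b iha _ =>
    obtain ⟨A, B, s, hA, -, rfl, -⟩ := h
    exact Or.inl (iha hA)

theorem Shape.finite (h : Shape G S r t) : S.Finite := by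
  induction t generalizing S r with
  | single => rw [h]; exact Set.finite_singleton r
  | graft a b iha ihb =>
    obtain ⟨A, B, s, hA, hB, rfl, -⟩ := h
    exact (iha hA).union (ihb hB)

theorem Shape.ncard (h : Shape G S r t) : S.ncard = t.size := by
  induction t generalizing S r with
  | single => rw [h]; simp [size]
  | graft a b iha ihb =>
    obtain ⟨A, B, s, hA, hB, rfl, hd, -⟩ := h
    rw [Set.ncard_union_eq hd hA.finite hB.finite, iha hA, ihb hB]
    rfl

theorem Shape.connected (h : Shape G S r t) : (G.induce S).Connected := by
  induction t generalizing S r with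
  | single => rw [h]; exact induce_connected_iff_cut.2 ⟨⟨r, rfl⟩, fun C hC hne hCne =>
      absurd ((Set.subset_singleton_iff_eq.1 hC).resolve_left hne.ne_empty) hCne⟩
  | graft a b iha ihb =>
    obtain ⟨A, B, s, hA, hB, rfl, hd, hrs, -⟩ := h
    have h1 := induce_union_connected (iha hA).preconnected
      (induce_pair_connected_of_adj hrs).preconnected ⟨r, hA.root_mem, Or.inl rfl⟩
    have h2 := induce_union_connected h1.preconnected (ihb hB).preconnected
      ⟨s, Or.inr (Or.inr rfl), hB.root_mem⟩
    have h3 : A ∪ {r, s} ∪ B = A ∪ B := by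
      ext x
      simp only [Set.mem_union, Set.mem_insert_iff, Set.mem_singleton_iff]
      constructor
      · rintro ((h | rfl | rfl) | h)
        exacts [Or.inl h, Or.inl hA.root_mem, Or.inr hB.root_mem, Or.inr h]
      · rintro (h | h)
        exacts [Or.inl (Or.inl h), Or.inr h]
    rwa [h3] at h2

theorem Shape.swap {a b c : RTree} (h : Shape G S r (graft (graft a b) c)) :
    Shape G S r (graft (graft a c) b) := by
  obtain ⟨_, C, u, ⟨A, B, s, hA, hB, rfl, hAB, hrs, hABadj⟩, hC, rfl, hd, hru, hadj⟩ := h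
  rw [Set.disjoint_union_left] at hd
  refine ⟨A ∪ C, B, s, ⟨A, C, u, hA, hC, rfl, hd.1, hru, fun x hx => hadj x (Or.inl hx)⟩, hB,
    Set.union_right_comm _ _ _, Set.disjoint_union_left.2 ⟨hAB, hd.2.symm⟩, hrs, ?_⟩
  rintro x (hx | hx) y hy hxy
  · exact hABadj x hx y hy hxy
  · have := (hadj y (Or.inr hy) x hx hxy.symm).1
    exact absurd (this ▸ hy) (Set.disjoint_left.1 hAB hA.root_mem)

theorem shape_iff_of_equiv {a b : RTree} (h : Equiv a b) (S : Set V) (r : V) :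
    Shape G S r a ↔ Shape G S r b := by
  induction h generalizing S r with
  | refl => rfl
  | symm _ ih => exact (ih S r).symm
  | trans _ _ ih ih' => exact (ih S r).trans (ih' S r)
  | graft _ _ ih ih' => simp only [Shape, ih, ih']
  | swap => exact ⟨Shape.swap, Shape.swap⟩

theorem Shape.reroot {a b : RTree} (h : Shape G S r (graft a b)) :
    ∃ s, Shape G S s (graft b a) := by
  obtain ⟨A, B, s, hA, hB, rfl, hd, hrs, hadj⟩ := h
  exact ⟨s, B, A, r, hB, hA, Set.union_comm _ _, hd.symm, hrs.symm,
    fun x hx y hy hxy => (hadj y hy x hx hxy.symm).symm⟩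

theorem Shape.exists_bijOn {S' : Set V} {r' : V} (h : Shape G S r t) (h' : Shape G S' r' t) :
    ∃ f : V → V, Set.BijOn f S S' ∧ f r = r' ∧
      ∀ x ∈ S, ∀ y ∈ S, G.Adj (f x) (f y) ↔ G.Adj x y := by
  classical
  induction t generalizing S S' r r' with
  | single =>
    obtain rfl : S = {r} := h
    obtain rfl : S' = {r'} := h'
    exact ⟨fun _ => r', by simp, rfl, by simp⟩
  | graft a b iha ihb =>
    obtain ⟨A, B, s, hA, hB, rfl, hd, hrs, hadj⟩ := h
    obtain ⟨A', B', s', hA', hB', rfl, hd', hrs', hadj'⟩ := h'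
    obtain ⟨f, hf, hfr, hf2⟩ := iha hA hA'
    obtain ⟨g, hg, hgs, hg2⟩ := ihb hB hB'
    have hB_A : ∀ x ∈ B, x ∉ A := fun x hx hx' => Set.disjoint_left.1 hd hx' hx
    have hFA : Set.EqOn f (A.piecewise f g) A := (Set.piecewise_eqOn A f g).symm
    have hFB : Set.EqOn g (A.piecewise f g) B := fun x hx =>
      (Set.piecewise_eq_of_notMem A f g (hB_A x hx)).symm
    have cross : ∀ x ∈ A, ∀ y ∈ B, G.Adj (f x) (g y) ↔ G.Adj x y := by
      intro x hx y hy
      constructor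
      · intro h
        obtain ⟨h1, h2⟩ := hadj' _ (hf.mapsTo hx) _ (hg.mapsTo hy) h
        rw [hf.injOn hx hA.root_mem (h1.trans hfr.symm),
          hg.injOn hy hB.root_mem (h2.trans hgs.symm)]
        exact hrs
      · intro h
        obtain ⟨rfl, rfl⟩ := hadj x hx y hy h
        rw [hfr, hgs]
        exact hrs'
    refine ⟨A.piecewise f g, (hf.congr hFA).union (hg.congr hFB) ?_,
      (hFA hA.root_mem).symm.trans hfr, ?_⟩
    · refine (Set.injOn_union hd).2 ⟨(hf.congr hFA).injOn, (hg.congr hFB).injOn, ?_⟩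
      intro x hx y hy
      rw [← hFA hx, ← hFB hy]
      exact fun he => Set.disjoint_left.1 hd' (hf.mapsTo hx) (he ▸ hg.mapsTo hy)
    · rintro x (hx | hx) y (hy | hy)
      · rw [← hFA hx, ← hFA hy]; exact hf2 x hx y hy
      · rw [← hFA hx, ← hFB hy]; exact cross x hx y hy
      · rw [← hFB hx, ← hFA hy, G.adj_comm, cross y hy x hx, G.adj_comm]
      · rw [← hFB hx, ← hFB hy]; exact hg2 x hx y hy

theorem Shape.nonempty_iso {S' : Set V} {r' : V} (h : Shape G S r t) (h' : Shape G S' r' t) :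
    Nonempty (G.induce S ≃g G.induce S') := by
  obtain ⟨f, hf, -, hadj⟩ := h.exists_bijOn h'
  exact ⟨⟨hf.equiv f, fun {x y} => hadj x x.2 y y.2⟩⟩

theorem Shape.attach (h : Shape G S r t) {v w : V} (hv : v ∈ S) (hw : w ∉ S) (hvw : G.Adj v w)
    (huniq : ∀ x ∈ S, G.Adj x w → x = v) : ∃ t', Shape G (insert w S) r t' := by
  induction t generalizing S r with
  | single =>
    obtain rfl : S = {r} := h
    obtain rfl : v = r := hv
    exact ⟨graft single single, {v}, {w}, w, rfl, rfl, Set.insert_eq w {v} ▸ Set.union_comm _ _,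
      by simpa using hvw.ne, hvw, by simp⟩
  | graft a b iha ihb =>
    obtain ⟨A, B, s, hA, hB, rfl, hd, hrs, hadj⟩ := h
    have hwA : w ∉ A := fun h => hw (Or.inl h)
    have hwB : w ∉ B := fun h => hw (Or.inr h)
    rcases hv with hv | hv
    · obtain ⟨a', ha'⟩ := iha hA hv hwA fun x hx => huniq x (Or.inl hx)
      refine ⟨graft a' b, insert w A, B, s, ha', hB, Set.insert_union.symm,
        Set.disjoint_insert_left.2 ⟨hwB, hd⟩, hrs, ?_⟩
      rintro x (rfl | hx) y hy hxy
      · exact absurd (huniq y (Or.inr hy) hxy.symm ▸ hy) (Set.disjoint_left.1 hd hv)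
      · exact hadj x hx y hy hxy
    · obtain ⟨b', hb'⟩ := ihb hB hv hwB fun x hx => huniq x (Or.inr hx)
      refine ⟨graft a b', A, insert w B, s, hA, hb', Set.union_insert.symm,
        Set.disjoint_insert_right.2 ⟨hwA, hd⟩, hrs, ?_⟩
      rintro x hx y (rfl | hy) hxy
      · exact absurd hv (Set.disjoint_left.1 hd (huniq x (Or.inl hx) hxy ▸ hx))
      · exact hadj x hx y hy hxy

theorem exists_shape (hG : G.IsAcyclic) (hS : (G.induce S).Connected) (hfin : S.Finite)
    (hr : r ∈ S) : ∃ t, Shape G S r t := by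
  have key : ∀ k, k + 1 ≤ S.ncard → ∃ T ⊆ S, T.ncard = k + 1 ∧ ∃ t, Shape G T r t := by
    intro k
    induction k with
    | zero => intro _; exact ⟨{r}, by simpa using hr, by simp, single, rfl⟩
    | succ k ih =>
      intro hk
      obtain ⟨T, hTS, hT, t, ht⟩ := ih (by omega)
      obtain ⟨v, hv, w, hw, hwT, hvw⟩ := (induce_connected_iff_cut.1 hS).2 T hTS ⟨r, ht.root_mem⟩
        (by rintro rfl; omega)
      obtain ⟨t', ht'⟩ := ht.attach hv hwT hvw fun x hx hxw =>
        hG.eq_of_adj_of_adj ht.connected hx hv hwT hxw hvw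
      exact ⟨insert w T, Set.insert_subset hw hTS,
        by rw [Set.ncard_insert_of_notMem hwT ht.finite, hT], t', ht'⟩
  have hpos : 0 < S.ncard := (Set.ncard_pos hfin).2 ⟨r, hr⟩
  obtain ⟨T, hTS, hT, h⟩ := key (S.ncard - 1) (by omega)
  rwa [Set.eq_of_subset_of_ncard_le hTS (by omega) hfin] at h

/-- The part of a connected set on one side of a single edge is connected. -/
theorem connected_inter {A B : Set V} {r s : V} {T : Set V} (hT : (G.induce T).Connected)
    (hTAB : T ⊆ A ∪ B) (hadj : ∀ x ∈ A, ∀ y ∈ B, G.Adj x y → x = r ∧ y = s) (hne : (T ∩ A).Nonempty)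
    (hd : Disjoint A B) : (G.induce (T ∩ A)).Connected := by
  obtain ⟨-, hcut⟩ := induce_connected_iff_cut.1 hT
  refine induce_connected_iff_cut.2 ⟨hne, fun C hC hCne hCeq => ?_⟩
  by_cases hr : r ∈ C
  · obtain ⟨x, hx, y, hy, hyC, hxy⟩ := hcut (C ∪ (T ∩ B))
      (Set.union_subset (hC.trans Set.inter_subset_left) Set.inter_subset_left) (hCne.mono (by simp))
      (fun he => hCeq (hC.antisymm fun z hz => by
        rcases he.symm.subset hz.1 with h | h
        · exact h
        · exact absurd h.2 (Set.disjoint_left.1 hd hz.2)))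
    have hyA : y ∈ A := (hTAB hy).resolve_right fun h => hyC (Or.inr ⟨hy, h⟩)
    rcases hx with hx | hx
    · exact ⟨x, hx, y, ⟨hy, hyA⟩, fun h => hyC (Or.inl h), hxy⟩
    · exact absurd (Or.inl ((hadj y hyA x hx.2 hxy.symm).1 ▸ hr)) hyC
  · obtain ⟨x, hx, y, hy, hyC, hxy⟩ := hcut C (hC.trans Set.inter_subset_left) hCne (by
      rintro rfl
      exact hCeq (hC.antisymm Set.inter_subset_left))
    refine ⟨x, hx, y, ⟨hy, (hTAB hy).resolve_right fun h => ?_⟩, hyC, hxy⟩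
    exact hr ((hadj x (hC hx).2 y h hxy).1 ▸ hx)

/-- A connected set meeting both sides of a single edge contains its ends. -/
theorem mem_of_connected {A B : Set V} {r s : V} {T : Set V} (hT : (G.induce T).Connected)
    (hTAB : T ⊆ A ∪ B) (hadj : ∀ x ∈ A, ∀ y ∈ B, G.Adj x y → x = r ∧ y = s)
    (hA : (T ∩ A).Nonempty) (hB : (T ∩ B).Nonempty) (hd : Disjoint A B) : r ∈ T ∧ s ∈ T := by
  obtain ⟨x, hx, y, hy, hyA, hxy⟩ := (induce_connected_iff_cut.1 hT).2 (T ∩ A)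
    Set.inter_subset_left hA (fun he => by
      obtain ⟨z, hz, hzB⟩ := hB
      exact Set.disjoint_left.1 hd (he.symm.subset hz).2 hzB)
  have hyB := (hTAB hy).resolve_left fun h => hyA ⟨hy, h⟩
  obtain ⟨rfl, rfl⟩ := hadj x hx.2 y hyB hxy
  exact ⟨hx.1, hy⟩

variable [DecidableEq (Quotient setoid)]

theorem Shape.exists_mem_opts (h : Shape G S r t) {T : Set V} (hTS : T ⊆ S) (hr : r ∈ T)
    (hT : (G.induce T).Connected) :
    ∃ t', Shape G T r t' ∧ ⟦t'⟧ ∈ opts qsingle qgraft t := by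
  induction t generalizing S T r with
  | single =>
    obtain rfl : S = {r} := h
    refine ⟨single, hTS.antisymm (by simpa using hr), ?_⟩
    simp [opts, qsingle]
  | graft a b iha ihb =>
    obtain ⟨A, B, s, hA, hB, rfl, hd, hrs, hadj⟩ := h
    have hrA : r ∈ T ∩ A := ⟨hr, hA.root_mem⟩
    obtain ⟨a', ha', hao⟩ := iha hA Set.inter_subset_right hrA
      (connected_inter hT hTS hadj ⟨r, hrA⟩ hd)
    rcases Set.eq_empty_or_nonempty (T ∩ B) with he | hne
    · have : T ∩ A = T := Set.inter_eq_left.2 fun x hx => (hTS hx).resolve_right fun h =>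
        (he.subset ⟨hx, h⟩ : x ∈ (∅ : Set V))
      rw [this] at ha'
      exact ⟨a', ha', Finset.mem_union_left _ hao⟩
    · have hs := (mem_of_connected hT hTS hadj ⟨r, hrA⟩ hne hd).2
      obtain ⟨b', hb', hbo⟩ := ihb hB Set.inter_subset_right ⟨hs, hB.root_mem⟩
        (connected_inter hT (Set.union_comm A B ▸ hTS)
          (fun x hx y hy hxy => (hadj y hy x hx hxy.symm).symm) hne hd.symm)
      exact ⟨graft a' b', ⟨T ∩ A, T ∩ B, s, ha', hb',
        by rw [← Set.inter_union_distrib_left, Set.inter_eq_left.2 hTS],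
        hd.mono Set.inter_subset_right Set.inter_subset_right, hrs,
        fun x hx y hy => hadj x hx.2 y hy.2⟩,
        Finset.mem_union_right _ (Finset.mem_image₂_of_mem hao hbo)⟩

end Shape

section Shape

variable {V : Type*} {G : SimpleGraph V} {S : Set V} {r : V} {t : RTree}

/-- A connected set avoiding the root of a tree lies in a branch, so there are few of them. -/
theorem Shape.ncard_avoiding_le (h : Shape G S r t) :
    {T : Set V | T ⊆ S ∧ r ∉ T ∧ (G.induce T).Connected}.Finite ∧
    {T : Set V | T ⊆ S ∧ r ∉ T ∧ (G.induce T).Connected}.ncard ≤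
      (t.branches.map fun b => 2 ^ b.size - 1).sum := by
  refine ⟨h.finite.finite_subsets.subset fun T hT => hT.1, ?_⟩
  induction t generalizing S r with
  | single =>
    obtain rfl : S = {r} := h
    have : {T : Set V | T ⊆ {r} ∧ r ∉ T ∧ (G.induce T).Connected} = ∅ := by
      refine Set.eq_empty_of_forall_notMem fun T hT => ?_
      obtain ⟨x, hx⟩ := (induce_connected_iff_cut.1 hT.2.2).1
      exact hT.2.1 (hT.1 hx ▸ hx)
    rw [this, Set.ncard_empty]
    exact Nat.zero_le _
  | graft a b iha _ =>
    obtain ⟨A, B, s, hA, hB, rfl, hd, hrs, hadj⟩ := h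
    have hsub : {T : Set V | T ⊆ A ∪ B ∧ r ∉ T ∧ (G.induce T).Connected} ⊆
        (𝒫 B \ {∅}) ∪ {T : Set V | T ⊆ A ∧ r ∉ T ∧ (G.induce T).Connected} := by
      rintro T ⟨hT, hrT, hc⟩
      rcases Set.eq_empty_or_nonempty (T ∩ A) with he | hne
      · left
        refine ⟨fun x hx => (hT hx).resolve_left fun h => (he.subset ⟨hx, h⟩ : x ∈ (∅ : Set V)), ?_⟩
        exact (induce_connected_iff_cut.1 hc).1.ne_empty
      · right
        refine ⟨fun x hx => (hT hx).resolve_right fun h => ?_, hrT, hc⟩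
        exact hrT (mem_of_connected hc hT hadj hne ⟨x, hx, h⟩ hd).1
    have hfin : (𝒫 B \ {∅} ∪
        {T : Set V | T ⊆ A ∧ r ∉ T ∧ (G.induce T).Connected}).Finite :=
      (hB.finite.finite_subsets.sdiff).union
        (hA.finite.finite_subsets.subset fun T hT => hT.1)
    refine (Set.ncard_le_ncard hsub hfin).trans ((Set.ncard_union_le _ _).trans ?_)
    rw [branches, List.map_cons, List.sum_cons, Set.ncard_sdiff_singleton_of_mem (by simp),
      Set.ncard_powerset _ hB.finite, hB.ncard]
    exact Nat.add_le_add_left (iha hA) _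

theorem size_lt_of_mem_branches {b : RTree} (h : b ∈ t.branches) : b.size < t.size := by
  have h1 := List.single_le_sum (l := t.branches.map size) (by simp) _ (List.mem_map_of_mem h)
  rw [size_eq_sum_branches t]
  omega

/-- Every tree has a vertex all of whose branches have at most half of the vertices. -/
theorem Shape.exists_centroid (h : Shape G S r t) :
    ∃ r' t', Shape G S r' t' ∧ ∀ b ∈ t'.branches, 2 * b.size ≤ t'.size := by
  have key : ∀ k r t, Shape G S r t → (∀ b ∈ t.branches, b.size ≤ k) →
      ∃ r' t', Shape G S r' t' ∧ ∀ b ∈ t'.branches, 2 * b.size ≤ t'.size := by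
    intro k
    induction k with
    | zero =>
      intro r t h hb
      exact ⟨r, t, h, fun b hbt => by have := hb b hbt; omega⟩
    | succ k ih =>
      intro r t h hb
      by_cases hsmall : ∀ b ∈ t.branches, 2 * b.size ≤ t.size
      · exact ⟨r, t, h, hsmall⟩
      push Not at hsmall
      obtain ⟨b, hbt, hlt⟩ := hsmall
      obtain ⟨a, ha⟩ := exists_equiv_graft_of_mem_branches hbt
      obtain ⟨s, hs⟩ := ((shape_iff_of_equiv ha S r).1 h).reroot
      have hsz := ha.size_eq
      simp only [size] at hsz
      have hbk := hb b hbt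
      refine ih s _ hs fun c hc => ?_
      rcases List.mem_cons.1 hc with rfl | hc
      · omega
      · have := size_lt_of_mem_branches hc
        omega
  exact key t.size r t h fun b hb => (size_lt_of_mem_branches hb).le

end Shape

theorem pow_two_add_le {x s h : ℕ} (hx : x ≤ h) (hs : s ≤ h) (hxs : h ≤ x + s) :
    2 ^ x + 2 ^ s ≤ 2 ^ h + 2 ^ (x + s - h) := by
  obtain ⟨a, rfl⟩ := Nat.exists_eq_add_of_le hx
  obtain ⟨c, rfl⟩ : ∃ c, s = a + c := Nat.exists_eq_add_of_le (by omega)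
  obtain ⟨d, rfl⟩ : ∃ d, x = c + d := Nat.exists_eq_add_of_le (by omega)
  have : c + d + (a + c) - (c + d + a) = c := by omega
  rw [this]
  have h1 := Nat.one_le_two_pow (n := a)
  have h2 := Nat.one_le_two_pow (n := d)
  simp only [pow_add]
  obtain ⟨u, hu⟩ := Nat.exists_eq_add_of_le h1
  obtain ⟨v, hv⟩ := Nat.exists_eq_add_of_le h2
  rw [hu, hv]
  nlinarith [Nat.zero_le (2 ^ c * (u * v))]

theorem sum_two_pow_sub_one_le {h : ℕ} (L : List ℕ) (hL : ∀ x ∈ L, x ≤ h) (hs : L.sum ≤ 2 * h) :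
    (L.sum ≤ h → (L.map fun x => 2 ^ x - 1).sum + 1 ≤ 2 ^ L.sum) ∧
      (h ≤ L.sum → (L.map fun x => 2 ^ x - 1).sum + 2 ≤ 2 ^ h + 2 ^ (L.sum - h)) := by
  induction L with
  | nil =>
    refine ⟨by simp, fun h0 => ?_⟩
    obtain rfl : h = 0 := by simpa using h0
    simp
  | cons x L ih =>
    simp only [List.map_cons, List.sum_cons] at hs ⊢
    replace ih := ih (fun y hy => hL y (by simp [hy])) (by omega)
    have hx := hL x (by simp)
    obtain ⟨ih1, ih2⟩ := ih
    generalize (L.map fun x => 2 ^ x - 1).sum = d at *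
    generalize L.sum = s at *
    have h1 := Nat.one_le_two_pow (n := x)
    constructor
    · intro hxs
      have h2 := pow_two_add_le (x := x) (s := s) (h := x + s) (by omega) (by omega) le_rfl
      have h3 := ih1 (by omega)
      rw [Nat.sub_self] at h2
      omega
    · intro hxs
      rcases le_total s h with hsh | hsh
      · have h2 := pow_two_add_le hx hsh hxs
        have h3 := ih1 hsh
        omega
      · have h2 := pow_two_add_le (x := x) (s := s - h) (h := x + (s - h)) (by omega) (by omega)
          le_rfl
        have h3 := ih2 hsh
        rw [Nat.sub_self] at h2
        rw [Nat.add_sub_assoc hsh]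
        omega

end RTree

theorem ns_le_of_shape {V : Type} {G : SimpleGraph V} {r : V} {t : RTree}
    (h : RTree.Shape G Set.univ r t) :
    ∃ c : ℕ, c ^ 4 ≤ 5 ^ t.size ∧
      ns G ≤ c + (t.branches.map fun b => 2 ^ b.size - 1).sum := by
  classical
  refine ⟨(RTree.opts RTree.qsingle RTree.qgraft t).card,
    RTree.card_opts_pow_le RTree.qgraft_qsingle_ne t, ?_⟩
  obtain ⟨hfin, hcard⟩ := h.ncard_avoiding_le
  set N := {T : Set V | T ⊆ Set.univ ∧ r ∉ T ∧ (G.induce T).Connected} with hN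
  set O := RTree.opts RTree.qsingle RTree.qgraft t
  have hex : ∀ T : GraphSubtree G, ∃ c : O ⊕ N,
      (∀ q, c = Sum.inl q → ∃ t', RTree.Shape G T.1 r t' ∧ ⟦t'⟧ = q.1) ∧
      (∀ x, c = Sum.inr x → x.1 = T.1) := by
    rintro ⟨T, hT⟩
    by_cases hr : r ∈ T
    · obtain ⟨t', ht', hq⟩ := h.exists_mem_opts (Set.subset_univ T) hr hT
      refine ⟨Sum.inl ⟨_, hq⟩, ?_, by simp⟩
      rintro q ⟨⟩
      exact ⟨t', ht', rfl⟩
    · refine ⟨Sum.inr ⟨T, Set.subset_univ T, hr, hT⟩, by simp, ?_⟩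
      rintro x ⟨⟩
      rfl
  choose c hc using hex
  have hinj : Function.Injective fun q : Quot (SubtreeIso G) => c q.out := by
    intro q q' hqq
    rw [← q.out_eq, ← q'.out_eq]
    apply Quot.sound
    rcases hcq : c q.out with x | x
    · obtain ⟨t₁, h₁, e₁⟩ := (hc q.out).1 x hcq
      obtain ⟨t₂, h₂, e₂⟩ := (hc q'.out).1 x (hqq.symm.trans hcq)
      have heq : RTree.Equiv t₁ t₂ := Quotient.exact (e₁.trans e₂.symm)
      exact ((RTree.shape_iff_of_equiv heq _ _).1 h₁).nonempty_iso h₂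
    · have e₁ := (hc q.out).2 x hcq
      have e₂ := (hc q'.out).2 x (hqq.symm.trans hcq)
      have hiso : ∀ A B : Set V, A = B → Nonempty (G.induce A ≃g G.induce B) := by
        rintro A _ rfl
        exact ⟨Iso.refl⟩
      exact hiso _ _ (e₁.symm.trans e₂)
  have : Finite N := hfin
  calc ns G ≤ Nat.card (O ⊕ N) := Nat.card_le_card_of_injective _ hinj
    _ = O.card + N.ncard := by
      rw [Nat.card_sum, Nat.card_eq_fintype_card, Fintype.card_coe]; rfl
    _ ≤ _ := Nat.add_le_add_left hcard _

theorem ns_le_of_isTree {n : ℕ} (hn : 1 ≤ n) {G : SimpleGraph (Fin n)} (hG : G.IsTree) :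
    ∃ c d : ℕ, c ^ 4 ≤ 5 ^ n ∧ d ^ 2 * 4 ≤ 9 * 2 ^ n ∧ ns G ≤ c + d := by
  let r₀ : Fin n := ⟨0, hn⟩
  obtain ⟨t₀, ht₀⟩ := RTree.exists_shape (S := Set.univ) hG.isAcyclic
    (((induceUnivIso G).connected_iff).2 hG.connected) Set.finite_univ (Set.mem_univ r₀)
  obtain ⟨r, t, ht, hb⟩ := ht₀.exists_centroid
  have hsize : t.size = n := by rw [← ht.ncard]; simp
  obtain ⟨c, hc, hns⟩ := ns_le_of_shape ht
  rw [hsize] at hc hb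
  refine ⟨c, _, hc, ?_, hns⟩
  have hsum := RTree.size_eq_sum_branches t
  have hnum := RTree.sum_two_pow_sub_one_le (h := n / 2) (t.branches.map RTree.size)
    (fun x hx => by
      obtain ⟨b, hb', rfl⟩ := List.mem_map.1 hx
      have := hb b hb'
      omega) (by omega)
  rw [List.map_map] at hnum
  have hs : (t.branches.map RTree.size).sum = n - 1 := by omega
  rw [hs] at hnum
  simp only [Function.comp_def] at hnum
  generalize (t.branches.map fun b => 2 ^ b.size - 1).sum = d at *
  obtain ⟨h, rfl | rfl⟩ : ∃ h, n = 2 * h ∨ n = 2 * h + 1 := ⟨n / 2, by omega⟩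
  · have hd : 2 * d ≤ 3 * 2 ^ h := by
      obtain ⟨k, rfl⟩ : ∃ k, h = k + 1 := ⟨h - 1, by omega⟩
      have e1 : 2 * (k + 1) / 2 = k + 1 := by omega
      have e2 : 2 * (k + 1) - 1 - (k + 1) = k := by omega
      rw [e1, e2] at hnum
      rw [pow_succ] at *
      have := hnum.2 (by omega)
      omega
    have := Nat.pow_le_pow_left hd 2
    rw [pow_mul, ← pow_mul, mul_comm 2 h, pow_mul]
    nlinarith
  · have hd : d ≤ 2 * 2 ^ h := by
      have e1 : (2 * h + 1) / 2 = h := by omega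
      have e2 : 2 * h + 1 - 1 - h = h := by omega
      rw [e1, e2] at hnum
      have := hnum.2 (by omega)
      omega
    have := Nat.pow_le_pow_left hd 2
    rw [pow_succ 2 (2 * h), mul_comm 2 h, pow_mul]
    nlinarith

section ParentGraph

variable {W : Type*} {par : W → W} {root : W} {depth : W → ℕ}

/-- The graph in which every vertex is joined to its parent. -/
def parentGraph (par : W → W) : SimpleGraph W := fromRel fun x y => par x = y

theorem parentGraph_adj {x y : W} :
    (parentGraph par).Adj x y ↔ x ≠ y ∧ (par x = y ∨ par y = x) := Iff.rfl

theorem parentGraph_adj_par (hd : ∀ x, x ≠ root → depth (par x) + 1 = depth x) {x : W}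
    (hx : x ≠ root) : (parentGraph par).Adj x (par x) :=
  ⟨fun h => by have := hd x hx; rw [← h] at this; omega, Or.inl rfl⟩

theorem induce_parentGraph_connected (hd : ∀ x, x ≠ root → depth (par x) + 1 = depth x)
    {S : Set W} (hr : root ∈ S) (hS : ∀ x ∈ S, x ≠ root → par x ∈ S) :
    ((parentGraph par).induce S).Connected := by
  rw [connected_iff_exists_forall_reachable]
  refine ⟨⟨root, hr⟩, ?_⟩
  have key : ∀ k x (hx : x ∈ S), depth x = k →
      ((parentGraph par).induce S).Reachable ⟨root, hr⟩ ⟨x, hx⟩ := by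
    intro k
    induction k with
    | zero =>
      intro x hx hk
      obtain rfl : x = root := by
        by_contra hne
        have := hd x hne
        omega
      exact Reachable.refl _
    | succ k ih =>
      intro x hx hk
      by_cases hne : x = root
      · subst hne
        exact Reachable.refl _
      · have h1 := hd x hne
        refine (ih (par x) (hS x hx hne) (by omega)).trans (Adj.reachable ?_)
        exact (parentGraph_adj_par hd hne).symm
  exact fun x => key _ x.1 x.2 rfl

theorem induce_parentGraph_isTree (hd : ∀ x, x ≠ root → depth (par x) + 1 = depth x)
    (hpr : par root = root) {X : Finset W} (hr : root ∈ X) (hX : ∀ x ∈ X, x ≠ root → par x ∈ X) :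
    ((parentGraph par).induce (X : Set W)).IsTree := by
  classical
  have hc := induce_parentGraph_connected (S := (X : Set W)) hd hr hX
  rw [isTree_iff_connected_and_card]
  refine ⟨hc, le_antisymm ?_ hc.card_vert_le_card_edgeSet_add_one⟩
  let f : {x : (X : Set W) // x ≠ ⟨root, hr⟩} → ((parentGraph par).induce (X : Set W)).edgeSet :=
    fun x => ⟨s(x.1, ⟨par x.1.1, hX _ x.1.2 fun h => x.2 (Subtype.ext h)⟩),
      parentGraph_adj_par hd fun h => x.2 (Subtype.ext h)⟩
  have hf : Function.Surjective f := by
    have key : ∀ x y : (X : Set W), par x.1 = y.1 → ((parentGraph par).induce (X : Set W)).Adj x y →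
        ∃ z, (f z).1 = s(x, y) := by
      intro x y h hxy
      refine ⟨⟨x, fun hx => hxy.ne ?_⟩, ?_⟩
      · apply Subtype.ext
        rw [← h, hx, hpr]
      · show s(x, _) = s(x, y)
        congr 2
    rintro ⟨e, he⟩
    induction e with
    | _ x y =>
      rcases he.2 with h | h
      · obtain ⟨z, hz⟩ := key x y h he
        exact ⟨z, Subtype.ext hz⟩
      · obtain ⟨z, hz⟩ := key y x h (Adj.symm he)
        exact ⟨z, Subtype.ext (hz.trans Sym2.eq_swap)⟩
  have h1 := Nat.card_le_card_of_surjective f hf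
  have h2 : Nat.card {x : (X : Set W) // x ≠ ⟨root, hr⟩} = Nat.card (X : Set W) - 1 := by
    rw [Nat.card_eq_fintype_card, Nat.card_eq_fintype_card, Fintype.card_subtype_compl,
      Fintype.card_subtype_eq]
  have h3 : 0 < Nat.card (X : Set W) := Nat.card_pos_iff.2 ⟨⟨⟨root, hr⟩⟩, inferInstance⟩
  omega

theorem depth_le_of_adj (hd : ∀ x, x ≠ root → depth (par x) + 1 = depth x)
    (hpr : par root = root) {x y : W} (h : (parentGraph par).Adj x y) : depth y ≤ depth x + 1 := by
  obtain ⟨hne, h | h⟩ := h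
  · have hx : x ≠ root := by
      rintro rfl
      exact hne (hpr.symm.trans h)
    have := hd x hx
    rw [h] at this
    omega
  · have hy : y ≠ root := by
      rintro rfl
      exact hne (h.symm.trans hpr)
    have := hd y hy
    rw [h] at this
    omega

/-- Homomorphisms of subtrees fixing the root do not increase the depth. -/
theorem depth_map_le (hd : ∀ x, x ≠ root → depth (par x) + 1 = depth x) (hpr : par root = root)
    {S S' : Set W} (hr : root ∈ S) (hS : ∀ x ∈ S, x ≠ root → par x ∈ S)
    (f : (parentGraph par).induce S →g (parentGraph par).induce S')
    (hf : (f ⟨root, hr⟩ : W) = root) (x : S) : depth (f x) ≤ depth (x : W) := by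
  have key : ∀ k, ∀ x : S, depth (x : W) = k → depth (f x : W) ≤ k := by
    intro k
    induction k with
    | zero =>
      rintro ⟨x, hx⟩ hk
      obtain rfl : x = root := by
        by_contra hne
        have := hd x hne
        simp only at hk
        omega
      rw [hf]
      exact hk.le
    | succ k ih =>
      rintro ⟨x, hx⟩ hk
      by_cases hne : x = root
      · subst hne
        rw [hf]
        exact hk.le
      · have h1 := hd x hne
        simp only at hk
        have h2 := ih ⟨par x, hS x hx hne⟩ (by simp only; omega)
        have h3 : ((parentGraph par).induce S').Adj (f ⟨par x, hS x hx hne⟩) (f ⟨x, hx⟩) :=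
          f.map_adj (parentGraph_adj_par hd hne).symm
        have h4 : depth (f ⟨x, hx⟩ : W) ≤ depth (f ⟨par x, hS x hx hne⟩ : W) + 1 :=
          depth_le_of_adj hd hpr h3
        omega
  exact key _ x rfl

end ParentGraph

theorem subtreeIso_equivalence {V : Type*} (G : SimpleGraph V) : Equivalence (SubtreeIso G) :=
  ⟨fun _ => ⟨Iso.refl⟩, fun ⟨f⟩ => ⟨f.symm⟩, fun ⟨f⟩ ⟨g⟩ => ⟨f.trans g⟩⟩

theorem nonempty_induce_preimage_iso {V W : Type*} {H : SimpleGraph V} {G : SimpleGraph W}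
    (k : H ↪g G) {S : Set W} (hS : S ⊆ Set.range k) :
    Nonempty (H.induce (k ⁻¹' S) ≃g G.induce S) := by
  refine ⟨⟨Equiv.ofBijective (fun x => ⟨k x.1, x.2⟩) ⟨fun x y h => ?_, ?_⟩, ?_⟩⟩
  · exact Subtype.ext (k.injective (congrArg Subtype.val h))
  · rintro ⟨y, hy⟩
    obtain ⟨x, rfl⟩ := hS hy
    exact ⟨⟨x, hy⟩, rfl⟩
  · intro x y
    exact k.map_rel_iff

theorem bddAbove_ns (n : ℕ) : BddAbove {k | ∃ G : SimpleGraph (Fin n), G.IsTree ∧ ns G = k} :=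
  ((Set.finite_range fun G : SimpleGraph (Fin n) => ns G).subset
    (by rintro _ ⟨G, -, rfl⟩; exact ⟨G, rfl⟩)).bddAbove

/-- A family of pairwise nonisomorphic subtrees bounds `maxNS` from below. -/
theorem card_le_maxNS {W ι : Type*} [Fintype ι] {G : SimpleGraph W} {X : Finset W}
    (hX : (G.induce (X : Set W)).IsTree) (S : ι → Set W) (hSX : ∀ i, S i ⊆ X)
    (hS : ∀ i, (G.induce (S i)).Connected)
    (hinj : ∀ i j, Nonempty (G.induce (S i) ≃g G.induce (S j)) → i = j) :
    Fintype.card ι ≤ maxNS X.card := by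
  have hc : Fintype.card (X : Set W) = X.card := by simp
  let H := (G.induce (X : Set W)).overFin hc
  let e : G.induce (X : Set W) ≃g H := (G.induce (X : Set W)).overFinIso hc
  let k : H ↪g G := e.symm.toEmbedding.trans (Embedding.induce (X : Set W))
  have hk : ∀ i, S i ⊆ Set.range k := fun i x hx => ⟨e ⟨x, hSX i hx⟩, by simp [k]⟩
  have hH : H.IsTree := e.isTree_iff.1 hX
  have hiso := fun i => nonempty_induce_preimage_iso k (hk i)
  have hconn : ∀ i, (H.induce (k ⁻¹' S i)).Connected := fun i =>
    (hiso i).some.connected_iff.2 (hS i)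
  let F : ι → Quot (SubtreeIso H) := fun i => Quot.mk _ ⟨k ⁻¹' S i, hconn i⟩
  have hF : Function.Injective F := by
    intro i j hij
    obtain ⟨f⟩ := ((subtreeIso_equivalence H).quot_mk_eq_iff _ _).1 hij
    exact hinj i j ⟨((hiso i).some.symm.trans f).trans (hiso j).some⟩
  have : Finite (GraphSubtree H) :=
    inferInstanceAs (Finite {S : Set (Fin X.card) // (H.induce S).Connected})
  rw [← Nat.card_eq_fintype_card]
  exact (Nat.card_le_card_of_injective F hF).trans (le_csSup (bddAbove_ns _) ⟨H, hH, rfl⟩)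

theorem one_le_maxNS {n : ℕ} (hn : 1 ≤ n) : 1 ≤ maxNS n := by
  have hd : ∀ x : ℕ, x ≠ 0 → (x - 1) + 1 = x := by intro x hx; omega
  have hX : ∀ x ∈ Finset.range n, x ≠ 0 → x - 1 ∈ Finset.range n := by
    intro x hx _
    rw [Finset.mem_range] at *
    omega
  have h0 : 0 ∈ Finset.range n := Finset.mem_range.2 hn
  have := card_le_maxNS (ι := Unit)
    (induce_parentGraph_isTree (par := fun x => x - 1) (depth := fun x => x) hd rfl h0 hX)
    (fun _ => (Finset.range n : Set ℕ)) (fun _ => subset_rfl)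
    (fun _ => induce_parentGraph_connected (par := fun x => x - 1) (depth := fun x => x) hd h0 hX)
    (fun _ _ _ => rfl)
  simpa using this

/-- The possible vertices of a caterpillar-like tree: a spine `s`, pendant vertices `d`, pendant
paths with vertices `b`, `c`, and leaves `p`, `q` at the two ends of the spine. -/
inductive SpineVertex : Type
  | s (i : ℕ)
  | d (i : ℕ)
  | b (i : ℕ)
  | c (i : ℕ)
  | p (i : ℕ)
  | q (i : ℕ)

namespace SpineVertex

/-- The parent of a vertex, for a spine `s 0, …, s (m + 1)`. -/
def par (m : ℕ) : SpineVertex → SpineVertex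
  | s i => s (i - 1)
  | d i => s (i + 1)
  | b i => s (i + 1)
  | c i => b i
  | p _ => s 0
  | q _ => s (m + 1)

/-- The distance of a vertex from `s 0`. -/
def depth (m : ℕ) : SpineVertex → ℕ
  | s i => i
  | d i => i + 2
  | b i => i + 2
  | c i => i + 3
  | p _ => 1
  | q _ => m + 2

/-- The subtree with full spine and all `a` leaves at `s 0`, having `j` leaves at the other end,
and the `F i`-th choice of branches at `s (i + 1)`. -/
def Selected (m a : ℕ) (F : ℕ → ℕ) (j : ℕ) : SpineVertex → Prop
  | s i => i ≤ m + 1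
  | d i => i < m ∧ F i ≠ 0 ∧ F i ≠ 3
  | b i => i < m ∧ 2 ≤ F i
  | c i => i < m ∧ 3 ≤ F i
  | p k => k < a
  | q k => k < j

/-- The set of selected vertices. -/
def sel (m a : ℕ) (F : ℕ → ℕ) (j : ℕ) : Set SpineVertex := {x | Selected m a F j x}

theorem depth_par (m : ℕ) (x : SpineVertex) (hx : x ≠ s 0) :
    depth m (par m x) + 1 = depth m x := by
  cases x <;> simp_all [par, depth]
  omega

theorem par_mem_sel {m a j : ℕ} {F : ℕ → ℕ} (x : SpineVertex) (hx : x ∈ sel m a F j) :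
    par m x ∈ sel m a F j := by
  cases x <;> simp_all [par, sel, Selected] <;> omega

theorem root_mem_sel {m a j : ℕ} {F : ℕ → ℕ} : s 0 ∈ sel m a F j := by
  simp [sel, Selected]

/-- The tree on the vertices selected by `F` and `j`. -/
abbrev selGraph (m a : ℕ) (F : ℕ → ℕ) (j : ℕ) : SimpleGraph (sel m a F j) :=
  (parentGraph (par m)).induce (sel m a F j)

variable {m a j j' : ℕ} {F F' : ℕ → ℕ}

theorem not_subsingleton_s (ha : 0 < a) (hj : 0 < j) {i : ℕ} (hi : s i ∈ sel m a F j) :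
    ¬ ((selGraph m a F j).neighborSet ⟨s i, hi⟩).Subsingleton := by
  have hi' : i ≤ m + 1 := hi
  intro h
  rcases Nat.eq_zero_or_pos i with rfl | h0
  · have := congrArg Subtype.val (@h ⟨p 0, ha⟩ (by simp [parentGraph_adj, par]) ⟨s 1, show 1 ≤ m + 1 by omega⟩
      (by simp [parentGraph_adj, par]))
    simp at this
  · have h1 : (⟨s (i - 1), show i - 1 ≤ m + 1 by omega⟩ : sel m a F j) ∈
        (selGraph m a F j).neighborSet ⟨s i, hi⟩ := by
      simp [parentGraph_adj, par]; omega
    rcases hi'.eq_or_lt with rfl | h2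
    · have := congrArg Subtype.val (@h _ h1 ⟨q 0, hj⟩ (by simp [parentGraph_adj, par]))
      simp at this
    · have := congrArg Subtype.val (@h _ h1 ⟨s (i + 1), show i + 1 ≤ m + 1 by omega⟩ (by simp [parentGraph_adj, par]))
      simp at this

theorem not_subsingleton_b {i : ℕ} (hb : b i ∈ sel m a F j) (hc : c i ∈ sel m a F j) :
    ¬ ((selGraph m a F j).neighborSet ⟨b i, hb⟩).Subsingleton := by
  have hi : i < m := hb.1
  intro h
  have := congrArg Subtype.val (@h ⟨c i, hc⟩ (by simp [parentGraph_adj, par]) ⟨s (i + 1), show i + 1 ≤ m + 1 by omega⟩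
    (by simp [parentGraph_adj, par]))
  simp at this

/-- The vertices of the spine are the only inner vertices, apart from the `b i` adjacent to
a selected `c i`. -/
theorem subsingleton_neighborSet {x : SpineVertex} (hx : x ∈ sel m a F j) (hs : ∀ i, x ≠ s i)
    (hb : ∀ i, x = b i → c i ∉ sel m a F j) :
    ((selGraph m a F j).neighborSet ⟨x, hx⟩).Subsingleton := by
  have key : ∀ y : sel m a F j, (selGraph m a F j).Adj ⟨x, hx⟩ y → y.1 = par m x := by
    rintro ⟨y, hy⟩ ⟨hne, h | h⟩
    · exact h.symm
    · exfalso
      subst h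
      cases y with
      | c i => exact hb i rfl hy
      | _ => exact hs _ rfl
  intro y hy z hz
  exact Subtype.ext ((key y hy).trans (key z hz).symm)

theorem subsingleton_neighborSet_iff (ha : 0 < a) (hj : 0 < j) {x : SpineVertex}
    (hx : x ∈ sel m a F j) :
    ((selGraph m a F j).neighborSet ⟨x, hx⟩).Subsingleton ↔
      (∀ i, x ≠ s i) ∧ ∀ i, x = b i → c i ∉ sel m a F j := by
  refine ⟨fun h => ⟨?_, ?_⟩, fun h => subsingleton_neighborSet hx h.1 h.2⟩
  · rintro i rfl
    exact not_subsingleton_s ha hj hx h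
  · rintro i rfl hc
    exact not_subsingleton_b hx hc h

/-- A vertex other than `s 0` has few leaf neighbours. -/
theorem exists_finset_leaves (ha : 3 ≤ a) (hj : 0 < j) (hja : j < a) {v : SpineVertex}
    (hv : v ≠ s 0) : ∃ E : Finset SpineVertex, E.card < a ∧ ∀ x (hx : x ∈ sel m a F j),
      ((selGraph m a F j).neighborSet ⟨x, hx⟩).Subsingleton →
      (parentGraph (par m)).Adj v x → x ∈ E := by
  classical
  have hpair : ∀ x y : SpineVertex, Finset.card {x, y} < a :=
    fun x y => Finset.card_le_two.trans_lt (by omega)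
  simp only [subsingleton_neighborSet_iff (by omega : 0 < a) hj]
  cases v with
  | s i =>
    by_cases hi : i = m + 1
    · refine ⟨(Finset.range j).image q, Finset.card_image_le.trans_lt (by simpa using hja), ?_⟩
      rintro x hx ⟨h, -⟩ ⟨hne, h' | h'⟩
      · exact absurd h'.symm (h _)
      · cases x <;> simp_all [par, sel, Selected]
    · refine ⟨{d (i - 1), b (i - 1)}, hpair _ _, ?_⟩
      rintro x hx ⟨h, -⟩ ⟨hne, h' | h'⟩
      · exact absurd h'.symm (h _)
      · cases x <;> simp_all [par] <;> omega
  | b i =>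
    refine ⟨{s (i + 1), c i}, hpair _ _, ?_⟩
    rintro x hx - ⟨hne, h' | h'⟩
    · simp [← h', par]
    · cases x <;> simp_all [par]
  | d i =>
    refine ⟨{par m (d i), par m (d i)}, hpair _ _, ?_⟩
    rintro x hx - ⟨hne, h' | h'⟩
    · simp [← h']
    · cases x <;> simp_all [par]
  | c i =>
    refine ⟨{par m (c i), par m (c i)}, hpair _ _, ?_⟩
    rintro x hx - ⟨hne, h' | h'⟩
    · simp [← h']
    · cases x <;> simp_all [par]
  | p i =>
    refine ⟨{par m (p i), par m (p i)}, hpair _ _, ?_⟩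
    rintro x hx - ⟨hne, h' | h'⟩
    · simp [← h']
    · cases x <;> simp_all [par]
  | q i =>
    refine ⟨{par m (q i), par m (q i)}, hpair _ _, ?_⟩
    rintro x hx - ⟨hne, h' | h'⟩
    · simp [← h']
    · cases x <;> simp_all [par]

end SpineVertex

theorem SimpleGraph.Iso.subsingleton_neighborSet_iff {V W : Type*} {G : SimpleGraph V}
    {H : SimpleGraph W} (e : G ≃g H) (x : V) :
    (H.neighborSet (e x)).Subsingleton ↔ (G.neighborSet x).Subsingleton := by
  constructor
  · intro h y hy z hz
    exact e.injective (h (e.map_adj_iff.2 hy) (e.map_adj_iff.2 hz))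
  · intro h y hy z hz
    have hy' := e.symm.map_adj_iff.2 hy
    have hz' := e.symm.map_adj_iff.2 hz
    rw [e.symm_apply_apply] at hy' hz'
    exact e.symm.injective (h hy' hz')

namespace SpineVertex

variable {m a j j' : ℕ} {F F' : ℕ → ℕ}

theorem iso_root (ha : 3 ≤ a) (hj : 0 < j) (hj' : 0 < j') (hja : j' < a)
    (e : selGraph m a F j ≃g selGraph m a F' j') : (e ⟨s 0, root_mem_sel⟩ : SpineVertex) = s 0 := by
  by_contra hv
  obtain ⟨E, hE, h⟩ := exists_finset_leaves (m := m) (F := F') ha hj' hja hv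
  let g : ℕ → SpineVertex := fun k => if hk : k < a then (e ⟨p k, hk⟩ : SpineVertex) else s 0
  have hg : ∀ k (hk : k < a), g k = e ⟨p k, hk⟩ := fun k hk => by simp [g, hk]
  refine absurd (Finset.card_le_card_of_injOn g (s := Finset.range a) (t := E) ?_ ?_) (by simpa)
  · intro k hk
    have hk : k < a := by simpa using hk
    rw [hg k hk]
    refine h _ (e ⟨p k, hk⟩).2 ?_ ?_
    · refine (e.subsingleton_neighborSet_iff _).2 ((subsingleton_neighborSet_iff (by omega) hj _).2 ?_)
      simp
    · exact e.map_adj_iff.2 (by simp [parentGraph_adj, par])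
  · intro k hk l hl hkl
    have hk : k < a := by simpa using hk
    have hl : l < a := by simpa using hl
    rw [hg k hk, hg l hl] at hkl
    simpa using congrArg Subtype.val (e.injective (Subtype.ext hkl))

theorem iso_depth (ha : 3 ≤ a) (hj : 0 < j) (hj' : 0 < j') (hja : j < a) (hja' : j' < a)
    (e : selGraph m a F j ≃g selGraph m a F' j') (x : sel m a F j) :
    depth m (e x : SpineVertex) = depth m x := by
  refine le_antisymm ?_ ?_
  · exact depth_map_le (depth_par m) rfl root_mem_sel (fun x hx _ => par_mem_sel x hx) e.toHom
      (iso_root ha hj hj' hja' e) x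
  · have := depth_map_le (depth_par m) rfl root_mem_sel (fun x hx _ => par_mem_sel x hx)
      e.symm.toHom (iso_root ha hj' hj hja e.symm) (e x)
    have h : e.symm.toHom (e x) = x := e.symm_apply_apply x
    rwa [h] at this

theorem iso_c_mem (ha : 3 ≤ a) (hj : 0 < j) (hj' : 0 < j') (hja : j < a) (hja' : j' < a)
    (e : selGraph m a F j ≃g selGraph m a F' j') {i : ℕ} (hc : c i ∈ sel m a F j) :
    c i ∈ sel m a F' j' := by
  have hi : i < m := hc.1
  have hb : b i ∈ sel m a F j := par_mem_sel _ hc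
  have hs : s (i + 2) ∈ sel m a F j := show i + 2 ≤ m + 1 by omega
  by_contra hc'
  have key : ∀ x : sel m a F j, depth m x = i + 2 →
      ¬ ((selGraph m a F j).neighborSet x).Subsingleton → (e x : SpineVertex) = s (i + 2) := by
    intro x hx hn
    have h1 := iso_depth ha hj hj' hja hja' e x
    rw [← e.subsingleton_neighborSet_iff] at hn
    generalize e x = y at h1 hn
    obtain ⟨y, hy⟩ := y
    rw [subsingleton_neighborSet_iff (by omega) hj'] at hn
    rw [hx] at h1
    cases y <;> simp_all [depth]
  have h1 := key ⟨_, hs⟩ rfl (not_subsingleton_s (by omega) hj hs)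
  have h2 := key ⟨_, hb⟩ rfl (not_subsingleton_b hb hc)
  have := congrArg Subtype.val (e.injective (Subtype.ext (h1.trans h2.symm)))
  simp at this

/-- The leaves of a given depth. -/
def leaves (m a : ℕ) (F : ℕ → ℕ) (j k : ℕ) : Set SpineVertex :=
  (↑) '' {x : sel m a F j | depth m x = k ∧ ((selGraph m a F j).neighborSet x).Subsingleton}

theorem mem_leaves (ha : 0 < a) (hj : 0 < j) {k : ℕ} {x : SpineVertex} :
    x ∈ leaves m a F j k ↔ x ∈ sel m a F j ∧ depth m x = k ∧
      (∀ i, x ≠ s i) ∧ ∀ i, x = b i → c i ∉ sel m a F j := by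
  constructor
  · rintro ⟨⟨x, hx⟩, ⟨h1, h2⟩, rfl⟩
    exact ⟨hx, h1, (subsingleton_neighborSet_iff ha hj hx).1 h2⟩
  · rintro ⟨hx, h1, h2⟩
    exact ⟨⟨x, hx⟩, ⟨h1, (subsingleton_neighborSet_iff ha hj hx).2 h2⟩, rfl⟩

theorem iso_ncard_leaves (ha : 3 ≤ a) (hj : 0 < j) (hj' : 0 < j') (hja : j < a) (hja' : j' < a)
    (e : selGraph m a F j ≃g selGraph m a F' j') (k : ℕ) :
    (leaves m a F j k).ncard = (leaves m a F' j' k).ncard := by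
  rw [leaves, leaves, Set.ncard_image_of_injective _ Subtype.val_injective,
    Set.ncard_image_of_injective _ Subtype.val_injective]
  refine Set.ncard_congr (fun x _ => e x) ?_ (fun x y _ _ h => e.injective h) ?_
  · rintro x ⟨h1, h2⟩
    exact ⟨(iso_depth ha hj hj' hja hja' e x).trans h1, (e.subsingleton_neighborSet_iff x).2 h2⟩
  · rintro y ⟨h1, h2⟩
    refine ⟨e.symm y, ⟨(iso_depth ha hj' hj hja' hja e.symm y).trans h1,
      (e.symm.subsingleton_neighborSet_iff y).2 h2⟩, e.apply_symm_apply y⟩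

/-- The selected vertices `c i` of depth `k`. -/
def cLeaves (m : ℕ) (F : ℕ → ℕ) (k : ℕ) : Set SpineVertex :=
  {x | ∃ i, x = c i ∧ i + 3 = k ∧ i < m ∧ 3 ≤ F i}

theorem finite_cLeaves (k : ℕ) : (cLeaves m F k).Finite :=
  (Set.finite_singleton (c (k - 3))).subset (by
    rintro x ⟨i, rfl, rfl, -⟩
    simp)

theorem ncard_leaves (ha : 0 < a) (hj : 0 < j) {i : ℕ} (hi : i < m) (hF : F i < 5) :
    (leaves m a F j (i + 2)).ncard = F i % 3 + (cLeaves m F (i + 2)).ncard := by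
  classical
  let E : Finset SpineVertex :=
    if F i = 1 ∨ F i = 4 then {d i} else if F i = 2 then {d i, b i} else ∅
  have hE : E.card = F i % 3 := by
    simp only [E]
    generalize F i = t at hF
    interval_cases t <;> simp
  have h : leaves m a F j (i + 2) = (E : Set SpineVertex) ∪ cLeaves m F (i + 2) := by
    ext x
    rw [mem_leaves ha hj]
    simp only [E]
    generalize hu : F i = t at hF
    cases x <;> simp [sel, Selected, depth, cLeaves] <;> interval_cases t <;> simp <;> grind
  rw [h, Set.ncard_union_eq ?_ E.finite_toSet (finite_cLeaves _), Set.ncard_coe_finset, hE]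
  rw [Set.disjoint_left]
  rintro _ hx ⟨l, rfl, -⟩
  simp only [E] at hx
  split_ifs at hx <;> simp at hx

theorem ncard_leaves_end (ha : 0 < a) (hj : 0 < j) :
    (leaves m a F j (m + 2)).ncard = j + (cLeaves m F (m + 2)).ncard := by
  classical
  have h : leaves m a F j (m + 2) =
      (((Finset.range j).image q : Finset SpineVertex) : Set SpineVertex) ∪ cLeaves m F (m + 2) := by
    ext x
    rw [mem_leaves ha hj]
    cases x <;> simp [sel, Selected, depth, cLeaves] <;> grind
  rw [h, Set.ncard_union_eq ?_ (Finset.finite_toSet _) (finite_cLeaves _), Set.ncard_coe_finset,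
    Finset.card_image_of_injective _ (fun x y h => by simpa using h), Finset.card_range]
  rw [Set.disjoint_left]
  rintro _ hx ⟨l, rfl, -⟩
  simp at hx

theorem eq_of_iso (ha : 3 ≤ a) (hj : 0 < j) (hj' : 0 < j') (hja : j < a) (hja' : j' < a)
    (hF : ∀ i < m, F i < 5) (hF' : ∀ i < m, F' i < 5)
    (e : selGraph m a F j ≃g selGraph m a F' j') : (∀ i < m, F i = F' i) ∧ j = j' := by
  have hc : ∀ i < m, 3 ≤ F i ↔ 3 ≤ F' i := fun i hi =>
    ⟨fun h => (iso_c_mem ha hj hj' hja hja' e ⟨hi, h⟩).2,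
      fun h => (iso_c_mem ha hj' hj hja' hja e.symm ⟨hi, h⟩).2⟩
  have hC : ∀ k, cLeaves m F k = cLeaves m F' k := by
    intro k
    ext x
    simp only [cLeaves, Set.mem_ofPred_eq]
    grind
  constructor
  · intro i hi
    have h := iso_ncard_leaves ha hj hj' hja hja' e (i + 2)
    rw [ncard_leaves (by omega) hj hi (hF i hi), ncard_leaves (by omega) hj' hi (hF' i hi), hC] at h
    have h1 := hF i hi
    have h2 := hF' i hi
    have h3 := hc i hi
    omega
  · have h := iso_ncard_leaves ha hj hj' hja hja' e (m + 2)
    rw [ncard_leaves_end (by omega) hj, ncard_leaves_end (by omega) hj', hC] at h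
    omega

end SpineVertex

open SpineVertex in
theorem five_pow_mul_le_maxNS (m : ℕ) {a b : ℕ} (ha : 3 ≤ a) (hb : b < a) :
    5 ^ m * b ≤ maxNS (4 * m + 2 + a + b) := by
  classical
  rcases Nat.eq_zero_or_pos b with rfl | hb0
  · simp
  let X : Finset SpineVertex := (Finset.range (m + 2)).image s ∪ (Finset.range m).image d ∪
    (Finset.range m).image SpineVertex.b ∪ (Finset.range m).image c ∪ (Finset.range a).image p ∪
    (Finset.range b).image q
  have hmem : ∀ x, x ∈ X ↔ x ∈ sel m a (fun _ => 4) b := by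
    intro x
    cases x <;> simp [X, sel, Selected]
    omega
  have hcard : X.card = 4 * m + 2 + a + b := by
    simp only [X]
    repeat rw [Finset.card_union_of_disjoint]
    · repeat rw [Finset.card_image_of_injective _ (fun x y h => by simpa using h)]
      simp only [Finset.card_range]
      ring
    all_goals
      rw [Finset.disjoint_left]
      intro x hx hx'
      cases x <;> simp at hx hx'
  let F : (Fin m → Fin 5) → ℕ → ℕ := fun v i => if h : i < m then (v ⟨i, h⟩ : ℕ) else 0
  have hF : ∀ v, ∀ i < m, F v i < 5 := by
    intro v i hi
    simp only [F, hi, dif_pos]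
    exact (v _).2
  let S : (Fin m → Fin 5) × Fin b → Set SpineVertex := fun v => sel m a (F v.1) (v.2 + 1)
  have hX : ((parentGraph (par m)).induce (X : Set SpineVertex)).IsTree := by
    refine induce_parentGraph_isTree (depth_par m) rfl ((hmem _).2 root_mem_sel) ?_
    exact fun x hx _ => (hmem _).2 (par_mem_sel x ((hmem _).1 hx))
  have := card_le_maxNS hX S ?_ ?_ ?_
  · simpa [hcard] using this
  · rintro ⟨v, k⟩ x hx
    refine (hmem x).2 ?_
    have hk := k.2
    cases x <;> simp_all [S, sel, Selected] <;> omega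
  · rintro ⟨v, k⟩
    exact induce_parentGraph_connected (depth_par m) root_mem_sel fun x hx _ => par_mem_sel x hx
  · rintro ⟨v, k⟩ ⟨v', k'⟩ ⟨e⟩
    have hk : (k : ℕ) < b := k.2
    have hk' : (k' : ℕ) < b := k'.2
    obtain ⟨h1, h2⟩ := eq_of_iso ha (Nat.succ_pos _) (Nat.succ_pos _) (by simp only; omega)
      (by simp only; omega) (hF v) (hF v') e
    have hv : v = v' := by
      funext i
      have := h1 i i.2
      simp only [F, i.2, dif_pos] at this
      exact Fin.ext this
    have hkk : k = k' := Fin.ext (Nat.succ_injective h2)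
    rw [hv, hkk]

theorem exists_isTree_ns_eq_maxNS {n : ℕ} (h : maxNS n ≠ 0) :
    ∃ G : SimpleGraph (Fin n), G.IsTree ∧ ns G = maxNS n := by
  refine Nat.sSup_mem (s := {k | ∃ G : SimpleGraph (Fin n), G.IsTree ∧ ns G = k}) ?_ (bddAbove_ns n)
  rw [Set.nonempty_iff_ne_empty]
  intro h0
  apply h
  rw [maxNS, h0]
  simp

theorem le_five_rpow {c n : ℕ} (h : c ^ 4 ≤ 5 ^ n) : (c : ℝ) ≤ (5 : ℝ) ^ ((n : ℝ) / 4) := by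
  refine le_of_pow_le_pow_left₀ (n := 4) (by norm_num) (by positivity) ?_
  rw [← Real.rpow_natCast (_ ^ _), ← Real.rpow_mul (by norm_num)]
  norm_num
  exact_mod_cast h

theorem le_two_rpow {d n : ℕ} (h : d ^ 2 * 4 ≤ 9 * 2 ^ n) :
    (d : ℝ) ≤ 3 * (2 : ℝ) ^ ((n : ℝ) / 2 - 1) := by
  refine le_of_pow_le_pow_left₀ (n := 2) (by norm_num) (by positivity) ?_
  rw [mul_pow, ← Real.rpow_natCast (_ ^ _), ← Real.rpow_mul (by norm_num)]
  have h1 : ((n : ℝ) / 2 - 1) * (2 : ℕ) = n - 2 := by push_cast; ring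
  rw [h1, Real.rpow_sub (by norm_num)]
  have h2 : (d : ℝ) ^ 2 * 4 ≤ 9 * 2 ^ n := by exact_mod_cast h
  norm_num
  linarith

theorem maxNS_le {n : ℕ} (hn : 1 ≤ n) :
    (maxNS n : ℝ) ≤ (5 : ℝ) ^ ((n : ℝ) / 4) + 3 * (2 : ℝ) ^ ((n : ℝ) / 2 - 1) := by
  obtain ⟨G, hG, h⟩ := exists_isTree_ns_eq_maxNS (n := n) (by have := one_le_maxNS hn; omega)
  obtain ⟨c, d, hc, hd, hcd⟩ := ns_le_of_isTree hn hG
  have h1 : (maxNS n : ℝ) ≤ c + d := by exact_mod_cast h ▸ hcd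
  linarith [le_five_rpow hc, le_two_rpow hd]

theorem two_mul_five_rpow_le {n m b : ℕ} (h : 16 * 5 ^ n ≤ 5 ^ 8 * (5 ^ m * b) ^ 4) :
    2 * (5 : ℝ) ^ ((n : ℝ) / 4 - 2) ≤ (5 ^ m * b : ℕ) := by
  refine le_of_pow_le_pow_left₀ (n := 4) (by norm_num) (by positivity) ?_
  rw [mul_pow, ← Real.rpow_natCast (_ ^ _), ← Real.rpow_mul (by norm_num)]
  have h1 : ((n : ℝ) / 4 - 2) * (4 : ℕ) = n - (8 : ℕ) := by push_cast; ring
  rw [h1, Real.rpow_sub (by norm_num), Real.rpow_natCast, Real.rpow_natCast]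
  have h2 : (16 : ℝ) * 5 ^ n ≤ 5 ^ 8 * ((5 ^ m * b : ℕ) : ℝ) ^ 4 := by exact_mod_cast h
  generalize ((5 ^ m * b : ℕ) : ℝ) = t at h2 ⊢
  rw [mul_div_assoc', div_le_iff₀ (by positivity)]
  linarith

theorem le_maxNS {n : ℕ} (hn : 1 ≤ n) : 2 * (5 : ℝ) ^ ((n : ℝ) / 4 - 2) ≤ maxNS n := by
  have key : ∀ m b : ℕ, 16 * 5 ^ n ≤ 5 ^ 8 * (5 ^ m * b) ^ 4 → 5 ^ m * b ≤ maxNS n →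
      2 * (5 : ℝ) ^ ((n : ℝ) / 4 - 2) ≤ maxNS n := fun m b h h' =>
    (two_mul_five_rpow_le h).trans (by exact_mod_cast h')
  rcases le_or_gt n 5 with h5 | h5
  · refine key 0 1 ?_ (by simpa using one_le_maxNS hn)
    interval_cases n <;> norm_num
  · obtain ⟨m, e, he, rfl⟩ : ∃ m e, e < 4 ∧ n = 4 * m + 6 + e :=
      ⟨(n - 6) / 4, (n - 6) % 4, by omega, by omega⟩
    have hpow : ∀ e b : ℕ, 16 * 5 ^ e ≤ 25 * b ^ 4 →
        16 * 5 ^ (4 * m + 6 + e) ≤ 5 ^ 8 * (5 ^ m * b) ^ 4 := by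
      intro e b h
      calc 16 * 5 ^ (4 * m + 6 + e) = 5 ^ (4 * m + 6) * (16 * 5 ^ e) := by ring
        _ ≤ 5 ^ (4 * m + 6) * (25 * b ^ 4) := by gcongr
        _ = 5 ^ 8 * (5 ^ m * b) ^ 4 := by ring
    interval_cases e
    · exact key m 1 (hpow 0 1 (by norm_num)) (five_pow_mul_le_maxNS m (a := 3) le_rfl (by norm_num))
    · exact key m 2 (hpow 1 2 (by norm_num)) (five_pow_mul_le_maxNS m (a := 3) le_rfl (by norm_num))
    · exact key m 2 (hpow 2 2 (by norm_num))
        (five_pow_mul_le_maxNS m (a := 4) (by norm_num) (by norm_num))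
    · exact key m 3 (hpow 3 3 (by norm_num))
        (five_pow_mul_le_maxNS m (a := 4) (by norm_num) (by norm_num))

theorem two_rpow_le_five_rpow (n : ℕ) : (2 : ℝ) ^ ((n : ℝ) / 2) ≤ (5 : ℝ) ^ ((n : ℝ) / 4) := by
  have h : (n : ℝ) / 2 = 2 * ((n : ℝ) / 4) := by ring
  rw [h, Real.rpow_mul (by norm_num)]
  exact Real.rpow_le_rpow (by norm_num) (by norm_num) (by positivity)

/-- For every `n ≥ 1`, `2·5^(n/4-2) ≤ S_n ≤ 5^(n/4) + 3·2^(n/2-1)`;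
in particular `S_n = Θ(5^(n/4))`. -/
theorem maxNS_theta :
    (∀ n : ℕ, 1 ≤ n →
      2 * (5 : ℝ) ^ ((n : ℝ) / 4 - 2) ≤ (maxNS n : ℝ) ∧
      (maxNS n : ℝ) ≤ (5 : ℝ) ^ ((n : ℝ) / 4) + 3 * (2 : ℝ) ^ ((n : ℝ) / 2 - 1)) ∧
    ∃ c₁ c₂ : ℝ, 0 < c₁ ∧ 0 < c₂ ∧ ∀ n : ℕ, 1 ≤ n →
      c₁ * (5 : ℝ) ^ ((n : ℝ) / 4) ≤ (maxNS n : ℝ) ∧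
      (maxNS n : ℝ) ≤ c₂ * (5 : ℝ) ^ ((n : ℝ) / 4) := by
  refine ⟨fun n hn => ⟨le_maxNS hn, maxNS_le hn⟩, 2 / 25, 5 / 2, by norm_num, by norm_num,
    fun n hn => ⟨?_, ?_⟩⟩
  · have h := le_maxNS hn
    rw [Real.rpow_sub (by norm_num)] at h
    norm_num at h
    linarith
  · have h := maxNS_le hn
    have h2 := two_rpow_le_five_rpow n
    rw [Real.rpow_sub (by norm_num), Real.rpow_one] at h
    linarith
end

section
/- For every n ≥ 1, R_n ≤ 5^{n/4} and R_n ≥ 2·5^{n/4 − 2} − 3·2^{n/2 − 1}; in particular R_n = Θ(5^{n/4}), i.e., there exist constants c₁, c₂ > 0 such that c₁·5^{n/4} ≤ R_n ≤ c₂·5^{n/4} for all n ≥ 1. -/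
open SimpleGraph

open scoped Pointwise

/-- Merge `a :: l` with a sorted list, where `g` merges `l` with a sorted list. -/
def insertMerge (a : ℕ) (g : List ℕ → List ℕ) (l : List ℕ) : List ℕ → List ℕ
  | [] => a :: l
  | b :: m => bif Nat.blt a b then a :: g (b :: m) else
      bif Nat.beq a b then a :: g m else b :: insertMerge a g l m

/-- The union of two increasing lists, as an increasing list. -/
def sortedUnion : List ℕ → List ℕ → List ℕ
  | [] => id
  | a :: l => insertMerge a (sortedUnion l) l

/-- The pointwise product of two increasing lists of positive numbers. -/
def mulList (X E : List ℕ) : List ℕ :=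
  E.foldr (fun e acc => sortedUnion (X.map fun x => x * e) acc) []

/-- The exceptional branches: the Matula numbers of their rooted subtrees, mapped to prime numbers
and completed by `1`, and the number of vertices of the branch. -/
def heavyTable : List (List ℕ × ℕ) :=
  [([1, 2], 1), ([1, 2, 3], 2), ([1, 2, 3, 5], 3), ([1, 2, 3, 7], 3),
   ([1, 2, 3, 5, 7, 13], 4), ([1, 2, 3, 5, 7, 11, 13, 29], 5),
   ([1, 2, 3, 5, 7, 13, 17, 43], 5), ([1, 2, 3, 5, 7, 13, 19, 37], 5),
   ([1, 2, 3, 5, 7, 11, 13, 17, 29, 41, 43, 101], 6),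
   ([1, 2, 3, 5, 7, 11, 13, 17, 19, 29, 37, 41, 43, 71, 101, 107, 239], 7)]

/-- The `i`-th entry of `heavyTable`. -/
def lookup (i : ℕ) : List ℕ × ℕ := heavyTable.getD i ([1], 0)

/-- The option list of a tree whose branches are the exceptional branches with indices in `l`. -/
def optionList (l : List ℕ) : List ℕ := l.foldr (fun i X => mulList X (lookup i).1) [1]

/-- The total size of the exceptional branches with indices in `l`. -/
def sizeSum (l : List ℕ) : ℕ := (l.map fun i => (lookup i).2).sum

/-- Lists of exceptional branches which can be deleted when bounding a product of option sets. -/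
def removable : List (List ℕ) :=
  [[3, 3], [2, 2], [4, 4], [7, 4], [6, 4], [5, 4], [7, 7], [7, 6], [6, 6], [7, 5], [6, 5],
   [5, 5], [8, 7], [8, 6], [8, 5], [8, 8], [9, 7], [9, 6], [9, 5], [9, 8], [9, 9], [1, 1, 1],
   [3, 1, 1], [2, 1, 1], [3, 2, 1], [4, 3, 1], [4, 2, 1], [4, 3, 2], [7, 3, 1], [6, 3, 1],
   [5, 3, 1], [7, 2, 1], [6, 2, 1], [5, 2, 1], [7, 3, 2], [6, 3, 2], [5, 3, 2], [8, 3, 2],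
   [8, 4, 3], [8, 4, 2], [9, 4, 3], [9, 4, 2], [0, 0, 0, 0], [8, 4, 1, 1], [9, 4, 1, 1],
   [1, 1, 0, 0, 0], [3, 1, 0, 0, 0], [2, 1, 0, 0, 0], [3, 2, 0, 0, 0], [4, 1, 1, 0, 0],
   [4, 3, 0, 0, 0], [4, 2, 0, 0, 0], [7, 1, 1, 0, 0], [6, 1, 1, 0, 0], [5, 1, 1, 0, 0],
   [7, 3, 0, 0, 0], [6, 3, 0, 0, 0], [5, 3, 0, 0, 0], [7, 2, 0, 0, 0], [6, 2, 0, 0, 0],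
   [5, 2, 0, 0, 0], [9, 1, 1, 0, 0], [9, 3, 2, 0, 0], [8, 4, 1, 0, 0, 0], [9, 4, 1, 0, 0, 0]]

/-- The exceptional branches in terms of their own branches, in the order of `heavyTable`. -/
def branchTable : List (List ℕ) :=
  [[], [0], [1], [0, 0], [1, 0], [2, 0], [3, 0], [1, 0, 0], [4, 0], [4, 0, 0]]

/-- The bound that makes a tree with these branches a non-exceptional branch. -/
def isLight (l : List ℕ) : Bool := Nat.ble (((optionList l).length + 1) ^ 4) (5 ^ (1 + sizeSum l))

/-- Check, with `k` steps of recursion, that every extension of `l` by indices at least `d` has a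
removable sublist, is in `branchTable`, or is light. -/
def search : ℕ → ℕ → List ℕ → Bool
  | 0, _, _ => false
  | k + 1, d, l => removable.any (fun r => r.isSublist l) ||
     ((branchTable.contains l || isLight l) &&
       (List.range 10).all fun i => Nat.blt i d || search k i (i :: l))

lemma mem_insertMerge {a : ℕ} {g : List ℕ → List ℕ} {l : List ℕ}
    (hg : ∀ m x, x ∈ g m ↔ x ∈ l ∨ x ∈ m) (m : List ℕ) (x : ℕ) :
    x ∈ insertMerge a g l m ↔ x ∈ a :: l ∨ x ∈ m := by
  induction m with
  | nil => simp [insertMerge]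
  | cons b m ih =>
    rw [insertMerge]
    cases h₁ : Nat.blt a b
    · cases h₂ : Nat.beq a b
      · simp only [cond_false, List.mem_cons, ih]
        tauto
      · have := Nat.eq_of_beq_eq_true h₂
        simp only [cond_false, cond_true, List.mem_cons, hg, this]
        tauto
    · simp only [cond_true, List.mem_cons, hg]
      tauto

lemma mem_sortedUnion (l m : List ℕ) (x : ℕ) : x ∈ sortedUnion l m ↔ x ∈ l ∨ x ∈ m := by
  induction l generalizing m x with
  | nil => simp [sortedUnion]
  | cons a l ih => exact mem_insertMerge ih m x

lemma toFinset_mulList (X E : List ℕ) :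
    (mulList X E).toFinset = X.toFinset * E.toFinset := by
  ext y
  simp only [mulList, List.mem_toFinset, Finset.mem_mul]
  induction E with
  | nil => simp
  | cons e E ih =>
    simp only [List.foldr_cons, mem_sortedUnion, ih, List.mem_map, List.mem_cons]
    constructor
    · rintro (⟨x, hx, rfl⟩ | ⟨x, hx, z, hz, rfl⟩)
      · exact ⟨x, hx, e, Or.inl rfl, rfl⟩
      · exact ⟨x, hx, z, Or.inr hz, rfl⟩
    · rintro ⟨x, hx, z, rfl | hz, rfl⟩
      · exact Or.inl ⟨x, hx, rfl⟩
      · exact Or.inr ⟨x, hx, z, hz, rfl⟩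

/-- The product of the option sets of a multiset of branches. -/
def optionProd (W : Multiset (Finset ℕ × ℕ)) : Finset ℕ := (W.map Prod.fst).prod

/-- The total size of a multiset of branches. -/
def totalSize (W : Multiset (Finset ℕ × ℕ)) : ℕ := (W.map Prod.snd).sum

/-- The `i`-th exceptional branch. -/
def heavy (i : ℕ) : Finset ℕ × ℕ := ((lookup i).1.toFinset, (lookup i).2)

lemma optionProd_add (V W : Multiset (Finset ℕ × ℕ)) :
    optionProd (V + W) = optionProd V * optionProd W := by
  simp [optionProd]

lemma totalSize_add (V W : Multiset (Finset ℕ × ℕ)) :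
    totalSize (V + W) = totalSize V + totalSize W := by
  simp [totalSize]

lemma optionProd_heavy (l : List ℕ) :
    optionProd ((l : Multiset ℕ).map heavy) = (optionList l).toFinset := by
  induction l with
  | nil => rfl
  | cons i l ih =>
    have h : optionProd (((i :: l : List ℕ) : Multiset ℕ).map heavy) =
        (heavy i).1 * optionProd ((l : Multiset ℕ).map heavy) := by simp [optionProd]
    rw [h, ih, mul_comm]
    exact (toFinset_mulList _ _).symm

lemma totalSize_heavy (l : List ℕ) :
    totalSize ((l : Multiset ℕ).map heavy) = sizeSum l := by
  simp [totalSize, sizeSum, heavy, Function.comp_def]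

lemma card_optionProd_heavy_le (l : List ℕ) :
    (optionProd ((l : Multiset ℕ).map heavy)).card ≤ (optionList l).length := by
  rw [optionProd_heavy]
  exact List.toFinset_card_le _

set_option maxRecDepth 100000 in
lemma length_optionList_pow_le_of_mem_removable :
    ∀ r ∈ removable, r ≠ [] ∧ (optionList r).length ^ 4 ≤ 5 ^ sizeSum r := by
  decide +kernel

set_option maxRecDepth 100000 in
lemma search_eq_true : search 20 0 [] = true := by decide +kernel

lemma length_optionList_pow_le_of_mem_branchTable :
    ∀ l ∈ branchTable, (optionList l).length ^ 4 ≤ 5 ^ (1 + sizeSum l) := by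
  decide +kernel

lemma search_sound (k d : ℕ) (l m : List ℕ) (h : search k d l = true)
    (hp : (m ++ l).Pairwise (· ≥ ·)) (hm : ∀ i ∈ m, i < 10) (hd : ∀ i ∈ m, d ≤ i) :
    (∃ r ∈ removable, r.Sublist (m ++ l)) ∨ m ++ l ∈ branchTable ∨ isLight (m ++ l) = true := by
  induction k generalizing d l m with
  | zero => simp [search] at h
  | succ k ih =>
    rw [search, Bool.or_eq_true, Bool.and_eq_true, Bool.or_eq_true] at h
    rcases h with h | ⟨h, h'⟩
    · obtain ⟨r, hr, hrl⟩ := List.any_eq_true.1 h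
      exact Or.inl ⟨r, hr, (List.isSublist_iff_sublist.1 hrl).trans (List.sublist_append_right m l)⟩
    · rcases List.eq_nil_or_concat m with rfl | ⟨m', i, rfl⟩
      · right
        simpa using h
      · have h₁ := List.all_eq_true.1 h' i (List.mem_range.2 (hm i (by simp)))
        have h₂ : ¬ Nat.blt i d = true := by
          have := hd i (by simp)
          simp [Nat.blt_eq]
          omega
        have h₃ : search k i (i :: l) = true := by simpa [h₂] using h₁
        have hp' : (m' ++ (i :: l)).Pairwise (· ≥ ·) := by simpa using hp
        have := ih i (i :: l) m' h₃ hp' (fun j hj => hm j (by simp [hj]))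
          (fun j hj => (List.pairwise_append.1 hp').2.2 j hj i (by simp))
        simpa using this

/-- The properties of the pair formed by the option set and the size of a branch used in the
upper bound. -/
def IsBranch (p : Finset ℕ × ℕ) : Prop :=
  1 ∈ p.1 ∧ 2 ∈ p.1 ∧ 0 < p.2 ∧ (p.1.card ^ 4 ≤ 5 ^ p.2 ∨ ∃ i < 10, p = heavy i)

lemma card_mul_add_one_le {X Y : Finset ℕ} (hX : 1 ∈ X) (hX' : 2 ∈ X) (hY : 1 ∈ Y)
    (hY' : 2 ∈ Y) : (X * Y).card + 1 ≤ X.card * Y.card := by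
  have h : X * Y ⊆ ((X ×ˢ Y).erase (1, 2)).image (fun p => p.1 * p.2) := by
    intro z hz
    obtain ⟨x, hx, y, hy, rfl⟩ := Finset.mem_mul.1 hz
    by_cases hxy : (x, y) = (1, 2)
    · obtain ⟨rfl, rfl⟩ := Prod.mk.inj hxy
      exact Finset.mem_image.2 ⟨(2, 1), by simp [hX', hY], rfl⟩
    · exact Finset.mem_image.2 ⟨(x, y), by simp [hx, hy, hxy], rfl⟩
  have hmem : ((1, 2) : ℕ × ℕ) ∈ X ×ˢ Y := by simp [hX, hY']
  have h₁ := (Finset.card_le_card h).trans Finset.card_image_le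
  rw [Finset.card_erase_of_mem hmem, Finset.card_product] at h₁
  have h₂ : 0 < X.card * Y.card :=
    Nat.mul_pos (Finset.card_pos.2 ⟨1, hX⟩) (Finset.card_pos.2 ⟨1, hY⟩)
  omega

lemma succ_pow_four_le {x m : ℕ} (h : x ^ 4 ≤ 5 ^ m) (hm : 1 ≤ m) :
    (x + 1) ^ 4 ≤ 5 ^ (m + 1) := by
  obtain hx | rfl | hx : x ≤ 1 ∨ x = 2 ∨ 3 ≤ x := by omega
  · calc (x + 1) ^ 4 ≤ 2 ^ 4 := by gcongr; omega
      _ ≤ 5 ^ 2 := by norm_num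
      _ ≤ 5 ^ (m + 1) := Nat.pow_le_pow_right (by norm_num) (by omega)
  · have : 2 ≤ m := by
      by_contra hlt
      obtain rfl : m = 1 := by omega
      norm_num at h
    calc (2 + 1) ^ 4 ≤ 5 ^ 3 := by norm_num
      _ ≤ 5 ^ (m + 1) := Nat.pow_le_pow_right (by norm_num) (by omega)
  · calc (x + 1) ^ 4 ≤ x ^ 4 * 5 := by
          obtain ⟨y, rfl⟩ := Nat.exists_eq_add_of_le hx
          ring_nf
          nlinarith [sq_nonneg y]
      _ ≤ 5 ^ m * 5 := Nat.mul_le_mul_right _ h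
      _ = 5 ^ (m + 1) := by ring

lemma one_mem_optionProd {W : Multiset (Finset ℕ × ℕ)} (hW : ∀ p ∈ W, 1 ∈ p.1) :
    1 ∈ optionProd W := by
  induction W using Multiset.induction_on with
  | empty => simp [optionProd]
  | cons p W ih =>
    have : optionProd (p ::ₘ W) = p.1 * optionProd W := by simp [optionProd]
    rw [this]
    exact Finset.mem_mul.2 ⟨1, hW p (by simp), 1, ih fun q hq => hW q (by simp [hq]), rfl⟩

lemma two_mem_optionProd {W : Multiset (Finset ℕ × ℕ)} (hW : ∀ p ∈ W, 1 ∈ p.1)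
    {p : Finset ℕ × ℕ} (hp : p ∈ W) (hp' : 2 ∈ p.1) : 2 ∈ optionProd W := by
  obtain ⟨V, rfl⟩ := Multiset.exists_cons_of_mem hp
  have : optionProd (p ::ₘ V) = p.1 * optionProd V := by simp [optionProd]
  rw [this]
  exact Finset.mem_mul.2
    ⟨2, hp', 1, one_mem_optionProd fun q hq => hW q (by simp [hq]), rfl⟩

lemma card_optionProd_of_branchTable {l : List ℕ} (hl : l ∈ branchTable) :
    (optionProd ((l : Multiset ℕ).map heavy)).card ^ 4 ≤
      5 ^ (1 + totalSize ((l : Multiset ℕ).map heavy)) := by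
  rw [totalSize_heavy]
  exact (Nat.pow_le_pow_left (card_optionProd_heavy_le l) 4).trans
    (length_optionList_pow_le_of_mem_branchTable l hl)

lemma light_or_heavy (W : Multiset (Finset ℕ × ℕ)) (hW : ∀ p ∈ W, IsBranch p) :
    ((optionProd W).card + 1) ^ 4 ≤ 5 ^ (1 + totalSize W) ∨
      ∃ l ∈ branchTable, W = (l : Multiset ℕ).map heavy := by
  induction hn : W.card using Nat.strong_induction_on generalizing W with
  | _ n ih =>
  subst hn
  by_cases hrem : ∃ V ≤ W, V ≠ 0 ∧ (optionProd V).card ^ 4 ≤ 5 ^ totalSize V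
  · left
    obtain ⟨V, hVW, hV0, hV⟩ := hrem
    obtain ⟨U, rfl⟩ := Multiset.le_iff_exists_add.1 hVW
    have hVb : ∀ p ∈ V, IsBranch p := fun p hp => hW p (by simp [hp])
    have hUb : ∀ p ∈ U, IsBranch p := fun p hp => hW p (by simp [hp])
    obtain ⟨p, hp⟩ := Multiset.exists_mem_of_ne_zero hV0
    rcases eq_or_ne U 0 with rfl | hU0
    · rw [add_zero, add_comm 1]
      apply succ_pow_four_le hV
      have : p.2 ≤ totalSize V := Multiset.le_sum_of_mem (Multiset.mem_map_of_mem _ hp)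
      have := (hVb p hp).2.2.1
      omega
    · obtain ⟨q, hq⟩ := Multiset.exists_mem_of_ne_zero hU0
      have hU : (optionProd U).card ^ 4 ≤ 5 ^ (1 + totalSize U) := by
        rcases ih U.card (by simpa using Multiset.card_pos.2 hV0) U hUb rfl with h | ⟨l, hl, rfl⟩
        · exact (Nat.pow_le_pow_left (Nat.le_succ _) 4).trans h
        · exact card_optionProd_of_branchTable hl
      have hcard := card_mul_add_one_le
        (one_mem_optionProd fun p hp => (hVb p hp).1)
        (two_mem_optionProd (fun p hp => (hVb p hp).1) hp (hVb p hp).2.1)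
        (one_mem_optionProd fun p hp => (hUb p hp).1)
        (two_mem_optionProd (fun p hp => (hUb p hp).1) hq (hUb q hq).2.1)
      rw [optionProd_add, totalSize_add]
      calc _ ≤ ((optionProd V).card * (optionProd U).card) ^ 4 := Nat.pow_le_pow_left hcard 4
        _ = (optionProd V).card ^ 4 * (optionProd U).card ^ 4 := mul_pow _ _ _
        _ ≤ 5 ^ totalSize V * 5 ^ (1 + totalSize U) := Nat.mul_le_mul hV hU
        _ = 5 ^ (1 + (totalSize V + totalSize U)) := by ring
  · push Not at hrem
    have hheavy : ∀ p ∈ W, ∃ i < 10, p = heavy i := by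
      intro p hp
      rcases (hW p hp).2.2.2 with h | h
      · have := hrem {p} (Multiset.singleton_le.2 hp) (by simp)
        simp [optionProd, totalSize] at this
        omega
      · exact h
    obtain ⟨I, hI, rfl⟩ : ∃ I : Multiset ℕ, (∀ i ∈ I, i < 10) ∧ I.map heavy = W := by
      clear ih hrem hW
      induction W using Multiset.induction_on with
      | empty => exact ⟨0, by simp⟩
      | cons p W ihW =>
        obtain ⟨I, hI, rfl⟩ := ihW fun q hq => hheavy q (by simp [hq])
        obtain ⟨i, hi, rfl⟩ := hheavy p (by simp)
        exact ⟨i ::ₘ I, by simpa [hi] using hI, by simp⟩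
    have hs := search_sound 20 0 [] (I.sort (· ≥ ·)) search_eq_true
      (by simp) (by simpa using hI) (by simp)
    have hsort : ((I.sort (· ≥ ·) : List ℕ) : Multiset ℕ) = I := I.sort_eq (· ≥ ·)
    simp only [List.append_nil] at hs
    rcases hs with ⟨r, hr, hrl⟩ | hs | hs
    · have hspec := length_optionList_pow_le_of_mem_removable r hr
      have hle : (r : Multiset ℕ) ≤ I := by
        rw [← hsort]
        exact Multiset.coe_le.2 hrl.subperm
      have := hrem ((r : Multiset ℕ).map heavy) (Multiset.map_le_map hle) (by simpa using hspec.1)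
      rw [totalSize_heavy] at this
      have := Nat.pow_le_pow_left (card_optionProd_heavy_le r) 4
      omega
    · exact Or.inr ⟨_, hs, by rw [hsort]⟩
    · left
      have h := Nat.le_of_ble_eq_true hs
      rw [← totalSize_heavy, hsort] at h
      have hc := card_optionProd_heavy_le (I.sort (· ≥ ·))
      rw [hsort] at hc
      exact (Nat.pow_le_pow_left (Nat.succ_le_succ hc) 4).trans h

/-- The `k`-th prime number, counting from `1`. -/
noncomputable def kthPrime (k : ℕ) : ℕ := Nat.nth Nat.Prime (k - 1)

lemma kthPrime_prime (k : ℕ) : (kthPrime k).Prime := Nat.prime_nth_prime _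

lemma lt_kthPrime {k : ℕ} : k < kthPrime k := by
  have := Nat.add_two_le_nth_prime (k - 1)
  unfold kthPrime
  omega

lemma kthPrime_inj {j k : ℕ} (hj : 0 < j) (hk : 0 < k) (h : kthPrime j = kthPrime k) : j = k := by
  have := Nat.nth_injective Nat.infinite_setOfPred_prime h
  omega

lemma kthPrime_count_add_one {p : ℕ} (hp : p.Prime) :
    kthPrime (Nat.count Nat.Prime p + 1) = p := by
  rw [kthPrime, Nat.add_sub_cancel, Nat.nth_count hp]

/-- Plane rooted trees, built by attaching a new branch to the root. -/
inductive BranchTree : Type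
  | single : BranchTree
  | graft : BranchTree → BranchTree → BranchTree

namespace BranchTree

/-- The number of vertices. -/
def size : BranchTree → ℕ
  | single => 1
  | graft s t => s.size + t.size

/-- The Matula number, a complete isomorphism invariant of rooted trees. -/
noncomputable def code : BranchTree → ℕ
  | single => 1
  | graft s t => s.code * kthPrime t.code

/-- The set of Matula numbers of the subtrees containing the root. -/
noncomputable def subCodes : BranchTree → Finset ℕ
  | single => {1}
  | graft s t => s.subCodes * insert 1 (t.subCodes.image kthPrime)

/-- The option set and the size of a tree seen as a branch: a subtree of the larger tree either
misses the branch (code `1`) or meets it in a subtree containing its root. -/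
noncomputable def toBranch (t : BranchTree) : Finset ℕ × ℕ :=
  (insert 1 (t.subCodes.image kthPrime), t.size)

/-- The branches at the root. -/
noncomputable def branches : BranchTree → Multiset (Finset ℕ × ℕ)
  | single => 0
  | graft s t => t.toBranch ::ₘ s.branches

lemma size_pos (t : BranchTree) : 0 < t.size := by
  induction t with
  | single => simp [size]
  | graft s t _ _ => simp only [size]; omega

lemma code_pos (t : BranchTree) : 0 < t.code := by
  induction t with
  | single => simp [code]
  | graft s t hs _ => exact Nat.mul_pos hs (kthPrime_prime _).pos

lemma subCodes_eq (t : BranchTree) : t.subCodes = optionProd t.branches := by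
  induction t with
  | single => rfl
  | graft s t hs _ => simp [subCodes, branches, optionProd, toBranch, hs, mul_comm]

lemma size_eq (t : BranchTree) : t.size = 1 + totalSize t.branches := by
  induction t with
  | single => simp [size, branches, totalSize]
  | graft s t hs _ =>
    simp only [size, branches, totalSize, toBranch, hs, Multiset.map_cons, Multiset.sum_cons]
    omega

lemma one_mem_subCodes (t : BranchTree) : 1 ∈ t.subCodes := by
  induction t with
  | single => simp [subCodes]
  | graft s t hs _ => exact Finset.mem_mul.2 ⟨1, hs, 1, by simp, rfl⟩

end BranchTree

lemma kthPrime_table : kthPrime 1 = 2 ∧ kthPrime 2 = 3 ∧ kthPrime 3 = 5 ∧ kthPrime 4 = 7 ∧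
    kthPrime 5 = 11 ∧ kthPrime 6 = 13 ∧ kthPrime 7 = 17 ∧ kthPrime 8 = 19 ∧ kthPrime 10 = 29 ∧
    kthPrime 12 = 37 ∧ kthPrime 13 = 41 ∧ kthPrime 14 = 43 ∧ kthPrime 20 = 71 ∧
    kthPrime 26 = 101 ∧ kthPrime 28 = 107 ∧ kthPrime 52 = 239 := by
  have h {k p : ℕ} (hp : p.Prime) (hk : Nat.count Nat.Prime p + 1 = k) : kthPrime k = p :=
    hk ▸ kthPrime_count_add_one hp
  refine ⟨?_, ?_, ?_, ?_, ?_, ?_, ?_, ?_, ?_, ?_, ?_, ?_, ?_, ?_, ?_, ?_⟩ <;>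
    exact h (by norm_num) (by decide +kernel)

lemma optionList_branchTable : branchTable.map optionList =
    [[1], [1, 2], [1, 2, 3], [1, 2, 4], [1, 2, 3, 4, 6], [1, 2, 3, 4, 5, 6, 10],
      [1, 2, 3, 4, 6, 7, 14], [1, 2, 3, 4, 6, 8, 12],
      [1, 2, 3, 4, 5, 6, 7, 10, 13, 14, 26],
      [1, 2, 3, 4, 5, 6, 7, 8, 10, 12, 13, 14, 20, 26, 28, 52]] := by
  decide +kernel

lemma branchTable_heavy {l : List ℕ} (hl : l ∈ branchTable) : ∃ i < 10,
    (insert 1 ((optionList l).toFinset.image kthPrime), 1 + sizeSum l) = heavy i := by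
  obtain ⟨e1, e2, e3, e4, e5, e6, e7, e8, e10, e12, e13, e14, e20, e26, e28, e52⟩ :=
    kthPrime_table
  have h := optionList_branchTable
  simp only [branchTable, List.map_cons, List.map_nil, List.cons.injEq, and_true] at h
  obtain ⟨h0, h1, h2, h3, h4, h5, h6, h7, h8, h9⟩ := h
  simp only [branchTable, List.mem_cons, List.not_mem_nil, or_false] at hl
  rcases hl with rfl | rfl | rfl | rfl | rfl | rfl | rfl | rfl | rfl | rfl
  · exact ⟨0, by simp [heavy, lookup, heavyTable, sizeSum, *]⟩
  · exact ⟨1, by simp [heavy, lookup, heavyTable, sizeSum, *]⟩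
  · exact ⟨2, by simp [heavy, lookup, heavyTable, sizeSum, *]⟩
  · exact ⟨3, by simp [heavy, lookup, heavyTable, sizeSum, *]⟩
  · exact ⟨4, by simp [heavy, lookup, heavyTable, sizeSum, *]⟩
  · exact ⟨5, by simp [heavy, lookup, heavyTable, sizeSum, *]⟩
  · exact ⟨6, by simp [heavy, lookup, heavyTable, sizeSum, *]⟩
  · exact ⟨7, by simp [heavy, lookup, heavyTable, sizeSum, *]⟩
  · exact ⟨8, by simp [heavy, lookup, heavyTable, sizeSum, *]⟩
  · exact ⟨9, by simp [heavy, lookup, heavyTable, sizeSum, *]⟩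

namespace BranchTree

lemma isBranch_of_branches (t : BranchTree) (ht : ∀ p ∈ t.branches, IsBranch p) :
    IsBranch t.toBranch := by
  refine ⟨by simp [toBranch], ?_, t.size_pos, ?_⟩
  · refine Finset.mem_insert_of_mem (Finset.mem_image.2 ⟨1, t.one_mem_subCodes, ?_⟩)
    exact kthPrime_table.1
  · rcases light_or_heavy t.branches ht with h | ⟨l, hl, h⟩
    · left
      rw [← subCodes_eq, ← size_eq] at h
      refine (Nat.pow_le_pow_left ?_ 4).trans h
      exact (Finset.card_insert_le _ _).trans (Nat.succ_le_succ Finset.card_image_le)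
    · right
      obtain ⟨i, hi, hi'⟩ := branchTable_heavy hl
      refine ⟨i, hi, ?_⟩
      rw [← hi', toBranch, subCodes_eq, size_eq, h, optionProd_heavy, totalSize_heavy]

lemma isBranch_of_mem_branches (t : BranchTree) : ∀ p ∈ t.branches, IsBranch p := by
  induction t with
  | single => simp [branches]
  | graft s t hs ht =>
    intro p hp
    rcases Multiset.mem_cons.1 hp with rfl | hp
    · exact t.isBranch_of_branches ht
    · exact hs p hp

theorem card_subCodes_pow_le (t : BranchTree) : t.subCodes.card ^ 4 ≤ 5 ^ t.size := by
  rw [subCodes_eq, size_eq]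
  rcases light_or_heavy t.branches t.isBranch_of_mem_branches with h | ⟨l, hl, h⟩
  · exact (Nat.pow_le_pow_left (Nat.le_succ _) 4).trans h
  · rw [h]
    exact card_optionProd_of_branchTable hl

end BranchTree

namespace BranchTree

/-- The path with `m + 1` vertices, rooted at an end. -/
def path : ℕ → BranchTree
  | 0 => single
  | m + 1 => graft single (path m)

/-- A spine of `k` vertices, each carrying a leaf and a path with two vertices, followed by a path
with `m + 1` vertices. -/
def spine (m : ℕ) : ℕ → BranchTree
  | 0 => path m
  | k + 1 => graft (graft (graft single single) (path 1)) (spine m k)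

lemma size_path (m : ℕ) : (path m).size = m + 1 := by
  induction m with
  | zero => rfl
  | succ m ih => simp only [path, size, ih]; omega

lemma size_spine (m k : ℕ) : (spine m k).size = 4 * k + m + 1 := by
  induction k with
  | zero => simp [spine, size_path]
  | succ k ih => simp only [spine, size, size_path, ih]; omega

lemma exists_mem_subCodes_path (m : ℕ) : ∃ x ∈ (path m).subCodes, m + 1 ≤ x := by
  induction m with
  | zero => exact ⟨1, by simp [path, subCodes], le_rfl⟩
  | succ m ih =>
    obtain ⟨x, hx, hmx⟩ := ih
    refine ⟨kthPrime x, Finset.mem_mul.2 ⟨1, by simp [subCodes], kthPrime x, ?_, one_mul _⟩, ?_⟩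
    · exact Finset.mem_insert_of_mem (Finset.mem_image_of_mem _ hx)
    · have := lt_kthPrime (k := x)
      omega

lemma mem_subCodes_cherryPath {a : ℕ} (ha : a ∈ ({1, 2, 3, 4, 6} : Finset ℕ)) :
    a ∈ (graft (graft single single) (path 1)).subCodes := by
  have h₀ : (graft single single).subCodes = {1, 2} := by
    rw [subCodes, subCodes, Finset.image_singleton, kthPrime_table.1]
    decide
  have h₁ : ∀ x ∈ ({1, 2} : Finset ℕ), x ∈ (graft single single).subCodes := by
    simp [h₀]
  have h₂ : ∀ y ∈ ({1, 2, 3} : Finset ℕ), y ∈ insert 1 ((path 1).subCodes.image kthPrime) := by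
    rw [path, path, h₀]
    simp [kthPrime_table.1, kthPrime_table.2.1]
  have h₃ : ({1, 2, 3, 4, 6} : Finset ℕ) ⊆ {1, 2} * {1, 2, 3} := by decide
  obtain ⟨x, hx, y, hy, rfl⟩ := Finset.mem_mul.1 (h₃ ha)
  exact Finset.mem_mul.2 ⟨x, h₁ x hx, y, h₂ y hy, rfl⟩

lemma eq_and_eq_of_mul_prime_eq {a b p q : ℕ}
    (hb : b ∈ ({1, 2, 3, 4, 6} : Finset ℕ)) (hp : p.Prime) (hq : q.Prime) (hp3 : 3 < p)
    (h : a * p = b * q) : a = b ∧ p = q := by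
  have hpq : p = q := by
    rcases hp.dvd_mul.1 (Dvd.intro_left a h) with hd | hd
    · exfalso
      have hb0 : 0 < b := by simp at hb; omega
      have := Nat.le_of_dvd hb0 hd
      have hb6 : b ≤ 6 := by simp at hb; omega
      have hp6 : p ≤ 6 := by omega
      interval_cases p
      · exact absurd hp (by norm_num)
      · simp at hb
        omega
      · exact absurd hp (by norm_num)
    · exact (Nat.prime_dvd_prime_iff_eq hp hq).1 hd
  subst hpq
  exact ⟨Nat.eq_of_mul_eq_mul_right hp.pos h, rfl⟩

lemma exists_subset_subCodes_spine {m : ℕ} (hm : 2 ≤ m) (k : ℕ) :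
    ∃ X ⊆ (spine m k).subCodes, (∀ x ∈ X, 3 ≤ x) ∧ X.card = 5 ^ k := by
  induction k with
  | zero =>
    obtain ⟨x, hx, hmx⟩ := exists_mem_subCodes_path m
    exact ⟨{x}, by simpa [spine] using hx, by simp; omega, by simp⟩
  | succ k ih =>
    obtain ⟨X, hX, hX3, hcard⟩ := ih
    refine ⟨(({1, 2, 3, 4, 6} : Finset ℕ) ×ˢ X).image fun p => p.1 * kthPrime p.2, ?_, ?_, ?_⟩
    · intro z hz
      obtain ⟨⟨a, x⟩, hax, rfl⟩ := Finset.mem_image.1 hz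
      obtain ⟨ha, hx⟩ := Finset.mem_product.1 hax
      exact Finset.mem_mul.2 ⟨a, mem_subCodes_cherryPath ha, kthPrime x,
        Finset.mem_insert_of_mem (Finset.mem_image_of_mem _ (hX hx)), rfl⟩
    · intro z hz
      obtain ⟨⟨a, x⟩, hax, rfl⟩ := Finset.mem_image.1 hz
      obtain ⟨ha, hx⟩ := Finset.mem_product.1 hax
      have h₁ := hX3 x hx
      have h₂ := lt_kthPrime (k := x)
      have h₃ : 0 < a := by simp at ha; omega
      dsimp only
      nlinarith
    · rw [Finset.card_image_of_injOn, Finset.card_product, hcard, pow_succ, mul_comm]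
      · rfl
      · rintro ⟨a, x⟩ hax ⟨b, y⟩ hby h
        obtain ⟨ha, hx⟩ := Finset.mem_product.1 (Finset.mem_coe.1 hax)
        obtain ⟨hb, hy⟩ := Finset.mem_product.1 (Finset.mem_coe.1 hby)
        have h₁ := hX3 x hx
        have h₂ := hX3 y hy
        obtain ⟨hab, hxy⟩ := eq_and_eq_of_mul_prime_eq hb (kthPrime_prime x)
          (kthPrime_prime y) (h₁.trans_lt lt_kthPrime) h
        dsimp only at hab hx hy h₁ h₂
        rw [hab, kthPrime_inj (by omega) (by omega) hxy]

lemma exists_pow_le_card_subCodes {n : ℕ} (hn : 1 ≤ n) :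
    ∃ t : BranchTree, t.size = n ∧ 5 ^ ((n - 3) / 4) ≤ t.subCodes.card := by
  rcases lt_or_ge n 3 with h | h
  · refine ⟨path (n - 1), by rw [size_path]; omega, ?_⟩
    rw [show (n - 3) / 4 = 0 by omega, pow_zero]
    exact Finset.card_pos.2 ⟨1, one_mem_subCodes _⟩
  · obtain ⟨X, hX, -, hcard⟩ :=
      exists_subset_subCodes_spine (m := (n - 3) % 4 + 2) (by omega) ((n - 3) / 4)
    refine ⟨spine ((n - 3) % 4 + 2) ((n - 3) / 4), by rw [size_spine]; omega, ?_⟩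
    rw [← hcard]
    exact Finset.card_le_card hX

end BranchTree

lemma SimpleGraph.Reachable.map_of_adj_or_eq {V W : Type*} {G : SimpleGraph V}
    {H : SimpleGraph W} (f : V → W) (hf : ∀ a b, G.Adj a b → f a = f b ∨ H.Adj (f a) (f b))
    {a b : V} (h : G.Reachable a b) : H.Reachable (f a) (f b) := by
  obtain ⟨p⟩ := h
  induction p with
  | nil => rfl
  | cons hab _ ih =>
    rcases hf _ _ hab with he | he
    · rwa [he]
    · exact he.reachable.trans ih

lemma SimpleGraph.IsAcyclic.sum {V W : Type*} {G : SimpleGraph V} {H : SimpleGraph W}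
    (hG : G.IsAcyclic) (hH : H.IsAcyclic) : (G ⊕g H).IsAcyclic := by
  rw [isAcyclic_iff_forall_adj_isBridge] at *
  rintro (a | a) (b | b) hab
  · intro hr
    refine hG (sum_adj_inl.1 hab) (hr.map_of_adj_or_eq (Sum.elim id fun _ => a) ?_)
    rintro (x | x) (y | y) hxy <;> simp_all
  · simp at hab
  · simp at hab
  · intro hr
    refine hH (sum_adj_inr.1 hab) (hr.map_of_adj_or_eq (Sum.elim (fun _ => a) id) ?_)
    rintro (x | x) (y | y) hxy <;> simp_all

section Connected

variable {V : Type*} {G : SimpleGraph V} {S T A B : Set V} {r u : V}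

lemma connected_induce_of_retract (hS : (G.induce S).Connected) (f : V → V)
    (hf : ∀ x ∈ S, f x ∈ T) (hT : ∀ x ∈ T, x ∈ S ∧ f x = x) (hne : T.Nonempty)
    (hadj : ∀ a ∈ S, ∀ b ∈ S, G.Adj a b → f a = f b ∨ G.Adj (f a) (f b)) :
    (G.induce T).Connected := by
  have : Nonempty T := hne.to_subtype
  refine ⟨fun x y => ?_⟩
  have h := (hS.preconnected ⟨x, (hT x x.2).1⟩ ⟨y, (hT y y.2).1⟩).map_of_adj_or_eq
    (H := G.induce T) (fun z : S => ⟨f z, hf z z.2⟩) fun a b hab => by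
      simpa [Subtype.ext_iff] using hadj a a.2 b b.2 hab
  simpa [(hT x x.2).2, (hT y y.2).2] using h

lemma exists_adj_of_connected_induce (hS : (G.induce S).Connected) {x y : V} (hx : x ∈ S)
    (hy : y ∈ S) (hxA : x ∈ A) (hyA : y ∉ A) :
    ∃ a ∈ S ∩ A, ∃ b ∈ S \ A, G.Adj a b := by
  obtain ⟨p⟩ := hS.preconnected ⟨x, hx⟩ ⟨y, hy⟩
  obtain ⟨d, -, h₁, h₂⟩ := p.exists_boundary_dart (Subtype.val ⁻¹' A) hxA hyA
  exact ⟨d.fst, ⟨d.fst.2, h₁⟩, d.snd, ⟨d.snd.2, h₂⟩, d.adj⟩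

/-- `A` and `B` are disjoint, `r ∈ A`, `u ∈ B`, and `r u` is the only edge between them. -/
structure IsSplit (G : SimpleGraph V) (A B : Set V) (r u : V) : Prop where
  left_mem : r ∈ A
  right_mem : u ∈ B
  disjoint : ∀ x ∈ A, x ∉ B
  adj : G.Adj r u
  eq_and_eq : ∀ a ∈ A, ∀ b ∈ B, G.Adj a b → a = r ∧ b = u

namespace IsSplit

lemma mono {A' B' : Set V} (h : IsSplit G A B r u) (hA : A' ⊆ A) (hB : B' ⊆ B) (hr : r ∈ A')
    (hu : u ∈ B') : IsSplit G A' B' r u :=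
  ⟨hr, hu, fun x hx hx' => h.disjoint x (hA hx) (hB hx'), h.adj,
    fun a ha b hb => h.eq_and_eq a (hA ha) b (hB hb)⟩

lemma right_mem_of_connected (h : IsSplit G A B r u) (hS : (G.induce S).Connected)
    (hSAB : S ⊆ A ∪ B) (hr : r ∈ S) {x : V} (hx : x ∈ S) (hxA : x ∉ A) : u ∈ S := by
  obtain ⟨a, ha, b, hb, hab⟩ := exists_adj_of_connected_induce hS hr hx h.left_mem hxA
  exact (h.eq_and_eq a ha.2 b ((hSAB hb.1).resolve_left hb.2) hab).2 ▸ hb.1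

open Classical in
lemma connected_inter_left (h : IsSplit G A B r u) (hS : (G.induce S).Connected)
    (hSAB : S ⊆ A ∪ B) (hr : r ∈ S) : (G.induce (S ∩ A)).Connected := by
  have hcross : ∀ a ∈ S, ∀ b ∈ S, a ∈ A → b ∉ A → G.Adj a b → a = r := fun a _ b hb haA hbA hab =>
    (h.eq_and_eq a haA b ((hSAB hb).resolve_left hbA) hab).1
  refine connected_induce_of_retract hS (fun x => if x ∈ A then x else r) ?_ ?_
    ⟨r, hr, h.left_mem⟩ ?_
  · intro x hx
    split_ifs with hxA
    exacts [⟨hx, hxA⟩, ⟨hr, h.left_mem⟩]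
  · exact fun x hx => ⟨hx.1, if_pos hx.2⟩
  · intro a ha b hb hab
    by_cases haA : a ∈ A <;> by_cases hbA : b ∈ A <;> simp only [haA, hbA, if_true, if_false]
    · exact Or.inr hab
    · exact Or.inl (hcross a ha b hb haA hbA hab)
    · exact Or.inl (hcross b hb a ha hbA haA hab.symm).symm
    · exact Or.inl trivial

lemma symm (h : IsSplit G A B r u) : IsSplit G B A u r :=
  ⟨h.right_mem, h.left_mem, fun x hx hx' => h.disjoint x hx' hx, h.adj.symm,
    fun a ha b hb hab => (h.eq_and_eq b hb a ha hab.symm).symm⟩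

lemma connected_inter_right (h : IsSplit G A B r u) (hS : (G.induce S).Connected)
    (hSAB : S ⊆ A ∪ B) (hu : u ∈ S) : (G.induce (S ∩ B)).Connected :=
  h.symm.connected_inter_left hS (Set.union_comm A B ▸ hSAB) hu

lemma connected_union (h : IsSplit G A B r u) (hA : (G.induce A).Connected)
    (hB : (G.induce B).Connected) : (G.induce (A ∪ B)).Connected :=
  connected_induce_union hA.preconnected hB.preconnected h.left_mem h.right_mem h.adj

/-- A branch of the left part can be split off before the right part. -/
lemma exchange {A₁ A₂ : Set V} {v : V} (h : IsSplit G (A₁ ∪ A₂) B r u)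
    (hA : IsSplit G A₁ A₂ r v) : IsSplit G A₁ B r u ∧ IsSplit G (A₁ ∪ B) A₂ r v := by
  refine ⟨h.mono Set.subset_union_left subset_rfl hA.left_mem h.right_mem,
    Or.inl hA.left_mem, hA.right_mem, ?_, hA.adj, ?_⟩
  · rintro x (hx | hx) hx'
    exacts [hA.disjoint x hx hx', h.disjoint x (Or.inr hx') hx]
  · rintro a (ha | ha) b hb hab
    · exact hA.eq_and_eq a ha b hb hab
    · exact absurd ((h.eq_and_eq b (Or.inr hb) a ha hab.symm).1 ▸ hb)
        (hA.disjoint r hA.left_mem)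

end IsSplit

end Connected

/-- The vertex set `S` of `G`, rooted at `r`, induces a tree of the shape `t`. -/
inductive IsBuilt {V : Type*} (G : SimpleGraph V) : Set V → V → BranchTree → Prop
  | single (r : V) : IsBuilt G {r} r .single
  | graft {A B : Set V} {r u : V} {s t : BranchTree} (hA : IsBuilt G A r s)
      (hB : IsBuilt G B u t) (h : IsSplit G A B r u) : IsBuilt G (A ∪ B) r (.graft s t)

namespace IsBuilt

variable {V W : Type*} {G : SimpleGraph V} {S T A B : Set V} {r u : V} {s t : BranchTree}

lemma root_mem (h : IsBuilt G S r t) : r ∈ S := by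
  induction h with
  | single => rfl
  | graft _ _ h => exact Or.inl h.left_mem

lemma connected (h : IsBuilt G S r t) : (G.induce S).Connected := by
  induction h with
  | single => exact ⟨Preconnected.of_subsingleton⟩
  | graft _ _ h hA hB => exact h.connected_union hA hB

lemma finite (h : IsBuilt G S r t) : S.Finite := by
  induction h with
  | single => exact Set.finite_singleton _
  | graft _ _ _ hA hB => exact hA.union hB

lemma ncard_eq (h : IsBuilt G S r t) : S.ncard = t.size := by
  induction h with
  | single => simp [BranchTree.size]
  | graft hA hB h ihA ihB =>
    rw [Set.ncard_union_eq (Set.disjoint_left.2 h.disjoint) hA.finite hB.finite, ihA, ihB]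
    rfl

lemma exists_of_connected (hG : G.IsAcyclic) (hfin : S.Finite) (hr : r ∈ S)
    (hS : (G.induce S).Connected) : ∃ t, IsBuilt G S r t := by
  induction hn : S.ncard using Nat.strong_induction_on generalizing S r with
  | _ n ih =>
    by_cases hsing : ∃ y ∈ S, y ≠ r
    · obtain ⟨y, hy, hyr⟩ := hsing
      obtain ⟨_, ⟨-, rfl⟩, u, ⟨hu, hur⟩, hadj⟩ :=
        exists_adj_of_connected_induce (A := {r}) hS hr hy rfl hyr
      rename_i r
      set H := G.deleteEdges {s(r, u)}
      set A := {x ∈ S | H.Reachable r x}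
      set B := S \ A
      have hbridge : ¬ H.Reachable r u := isAcyclic_iff_forall_adj_isBridge.1 hG hadj
      have hAB : A ∪ B = S := Set.union_sdiff_cancel fun x hx => hx.1
      have hrA : r ∈ A := ⟨hr, Reachable.refl _⟩
      have huB : u ∈ B := ⟨hu, fun h => hbridge h.2⟩
      have hsplit : IsSplit G A B r u := by
        refine ⟨hrA, huB, fun x hx hx' => hx'.2 hx, hadj, fun a ha b hb hab => ?_⟩
        by_cases he : s(a, b) = s(r, u)
        · rcases Sym2.eq_iff.1 he with h | h
          · exact h
          · exact absurd (h.2 ▸ hrA) hb.2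
        · exact absurd ⟨hb.1, ha.2.trans (Adj.reachable (by simpa [H, hab] using he))⟩ hb.2
      have hAS : S ∩ A = A := Set.inter_eq_right.2 fun x hx => hx.1
      have hBS : S ∩ B = B := Set.inter_eq_right.2 fun x hx => hx.1
      have hAc := hsplit.connected_inter_left hS hAB.ge hr
      have hBc := hsplit.connected_inter_right hS hAB.ge hu
      rw [hAS] at hAc
      rw [hBS] at hBc
      have hAn : A.ncard < n := hn ▸ Set.ncard_lt_ncard
        ⟨fun x hx => hx.1, fun h => huB.2 (h hu)⟩ hfin
      have hBn : B.ncard < n := hn ▸ Set.ncard_lt_ncard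
        ⟨fun x hx => hx.1, fun h => (h hr).2 hrA⟩ hfin
      obtain ⟨s, hs⟩ := ih _ hAn (hfin.subset fun x hx => hx.1) hrA hAc rfl
      obtain ⟨t, ht⟩ := ih _ hBn (hfin.subset fun x hx => hx.1) huB hBc rfl
      exact ⟨.graft s t, hAB ▸ graft hs ht hsplit⟩
    · push Not at hsing
      obtain rfl : S = {r} := Set.eq_singleton_iff_unique_mem.2 ⟨hr, hsing⟩
      exact ⟨.single, single r⟩

lemma exists_code_mem_subCodes (h : IsBuilt G T r t) (hST : S ⊆ T) (hr : r ∈ S)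
    (hS : (G.induce S).Connected) : ∃ s, IsBuilt G S r s ∧ s.code ∈ t.subCodes := by
  induction h generalizing S with
  | single r =>
    obtain rfl : S = {r} := Set.Subset.antisymm hST (Set.singleton_subset_iff.2 hr)
    exact ⟨.single, single r, by simp [BranchTree.code, BranchTree.subCodes]⟩
  | @graft A B r u s t hA hB h ihA ihB =>
    obtain ⟨s', hs', hcode⟩ := ihA Set.inter_subset_right ⟨hr, h.left_mem⟩
      (h.connected_inter_left hS hST hr)
    by_cases hSA : S ⊆ A
    · rw [Set.inter_eq_left.2 hSA] at hs'
      exact ⟨s', hs', Finset.mem_mul.2 ⟨_, hcode, 1, by simp, mul_one _⟩⟩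
    · obtain ⟨x, hx, hxA⟩ := Set.not_subset.1 hSA
      have hu := h.right_mem_of_connected hS hST hr hx hxA
      obtain ⟨t', ht', hcode'⟩ := ihB Set.inter_subset_right ⟨hu, h.right_mem⟩
        (h.connected_inter_right hS hST hu)
      refine ⟨.graft s' t', ?_, Finset.mem_mul.2 ⟨_, hcode, _,
        Finset.mem_insert_of_mem (Finset.mem_image_of_mem _ hcode'), rfl⟩⟩
      have := graft hs' ht' (h.mono Set.inter_subset_right Set.inter_subset_right
        ⟨hr, h.left_mem⟩ ⟨hu, h.right_mem⟩)
      rwa [← Set.inter_union_distrib_left, Set.inter_eq_left.2 hST] at this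

lemma exists_subset_of_mem_subCodes (h : IsBuilt G T r t) {k : ℕ} (hk : k ∈ t.subCodes) :
    ∃ S ⊆ T, ∃ s, IsBuilt G S r s ∧ s.code = k := by
  induction h generalizing k with
  | single r =>
    rw [BranchTree.subCodes, Finset.mem_singleton] at hk
    exact ⟨{r}, subset_rfl, .single, single r, hk.symm⟩
  | graft hA hB h ihA ihB =>
    obtain ⟨x, hx, y, hy, rfl⟩ := Finset.mem_mul.1 hk
    obtain ⟨A', hA', s', hs', rfl⟩ := ihA hx
    rcases Finset.mem_insert.1 hy with rfl | hy
    · exact ⟨A', hA'.trans Set.subset_union_left, s', hs', (mul_one _).symm⟩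
    · obtain ⟨z, hz, rfl⟩ := Finset.mem_image.1 hy
      obtain ⟨B', hB', t', ht', rfl⟩ := ihB hz
      exact ⟨A' ∪ B', Set.union_subset_union hA' hB', .graft s' t',
        graft hs' ht' (h.mono hA' hB' hs'.root_mem ht'.root_mem), rfl⟩

/-- Any neighbour of the root determines the last branch in some construction of the tree. -/
lemma exists_split_of_adj (h : IsBuilt G S r s) (hu : u ∈ S) (hadj : G.Adj r u) :
    ∃ A B s₁ s₂, IsBuilt G A r s₁ ∧ IsBuilt G B u s₂ ∧ IsSplit G A B r u ∧ A ∪ B = S ∧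
      s₁.code * kthPrime s₂.code = s.code := by
  induction h with
  | single r => exact absurd hu.symm hadj.ne
  | @graft A B r v s t hA hB h ihA ihB =>
    by_cases huA : u ∈ A
    · obtain ⟨A₁, A₂, s₁, s₂, h₁, h₂, hsplit, rfl, hcode⟩ := ihA huA hadj
      obtain ⟨h₃, h₄⟩ := h.exchange hsplit
      refine ⟨_, A₂, _, s₂, graft h₁ hB h₃, h₂, h₄, Set.union_right_comm .., ?_⟩
      simp only [BranchTree.code, ← hcode]
      ring
    · obtain rfl := (h.eq_and_eq r h.left_mem u (hu.resolve_left huA) hadj).2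
      exact ⟨A, B, s, t, hA, hB, h, rfl, rfl⟩

/-- Every prime factor of the code comes from a branch. -/
lemma exists_split_of_dvd (h : IsBuilt G S r s) {c : ℕ} (hc : 0 < c)
    (hdvd : kthPrime c ∣ s.code) :
    ∃ A B u s₁ s₂, IsBuilt G A r s₁ ∧ IsBuilt G B u s₂ ∧ IsSplit G A B r u ∧ A ∪ B = S ∧
      s₁.code * kthPrime s₂.code = s.code ∧ s₂.code = c := by
  induction h with
  | single r => exact absurd (Nat.dvd_one.1 hdvd) (kthPrime_prime c).ne_one
  | @graft A B r v s t hA hB h ihA ihB =>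
    rcases (kthPrime_prime c).dvd_mul.1 hdvd with hd | hd
    · obtain ⟨A₁, A₂, u, s₁, s₂, h₁, h₂, hsplit, rfl, hcode, hcode'⟩ := ihA hd
      obtain ⟨h₃, h₄⟩ := h.exchange hsplit
      refine ⟨_, A₂, u, _, s₂, graft h₁ hB h₃, h₂, h₄, Set.union_right_comm .., ?_, hcode'⟩
      simp only [BranchTree.code, ← hcode]
      ring
    · exact ⟨A, B, v, s, t, hA, hB, h, rfl, rfl, (kthPrime_inj hc t.code_pos
        ((Nat.prime_dvd_prime_iff_eq (kthPrime_prime c) (kthPrime_prime _)).1 hd)).symm⟩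

lemma code_unique (h : IsBuilt G S r s) (h' : IsBuilt G S r t) : s.code = t.code := by
  induction h generalizing t with
  | single r =>
    generalize hS : ({r} : Set V) = S at h'
    cases h' with
    | single => rfl
    | graft _ _ h =>
      exact absurd (hS.ge (Or.inr h.right_mem)).symm h.adj.ne
  | @graft A B r u s s' hA hB h ihA ihB =>
    obtain ⟨A', B', t₁, t₂, h₁, h₂, hsplit, hS, hcode⟩ :=
      h'.exists_split_of_adj (Or.inr h.right_mem) h.adj
    have hAA' : A ⊆ A' := fun x hx => by
      by_contra hxA'
      exact h.disjoint u (hsplit.right_mem_of_connected hA.connected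
        (hS.ge.trans' Set.subset_union_left) h.left_mem hx hxA') h.right_mem
    have hA'A : A' ⊆ A := fun x hx => by
      by_contra hxA
      exact hsplit.disjoint u (h.right_mem_of_connected h₁.connected
        (hS.le.trans' Set.subset_union_left) hsplit.left_mem hx hxA) hsplit.right_mem
    obtain rfl := hAA'.antisymm hA'A
    obtain rfl : B = B' := by
      ext x
      have := Set.ext_iff.1 hS x
      have h₃ := h.disjoint x
      have h₄ := hsplit.disjoint x
      simp only [Set.mem_union] at this
      tauto
    rw [BranchTree.code, ihA h₁, ihB h₂, hcode]

lemma transport {H : SimpleGraph W} (h : IsBuilt G S r t) {f : V → W} (hf : Set.InjOn f S)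
    (hadj : ∀ a ∈ S, ∀ b ∈ S, G.Adj a b ↔ H.Adj (f a) (f b)) : IsBuilt H (f '' S) (f r) t := by
  induction h with
  | single r => rw [Set.image_singleton]; exact single _
  | @graft A B r u s t hA hB h ihA ihB =>
    rw [Set.image_union]
    refine graft (ihA (hf.mono Set.subset_union_left) fun a ha b hb =>
      hadj a (Or.inl ha) b (Or.inl hb)) (ihB (hf.mono Set.subset_union_right) fun a ha b hb =>
      hadj a (Or.inr ha) b (Or.inr hb)) ⟨Set.mem_image_of_mem f h.left_mem,
        Set.mem_image_of_mem f h.right_mem, ?_,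
        (hadj r (Or.inl h.left_mem) u (Or.inr h.right_mem)).1 h.adj, ?_⟩
    · rintro _ ⟨x, hx, rfl⟩ ⟨y, hy, hxy⟩
      exact h.disjoint x hx (hf (Or.inr hy) (Or.inl hx) hxy ▸ hy)
    · rintro _ ⟨a, ha, rfl⟩ _ ⟨b, hb, rfl⟩ hab
      obtain ⟨rfl, rfl⟩ := h.eq_and_eq a ha b hb ((hadj a (Or.inl ha) b (Or.inr hb)).2 hab)
      exact ⟨rfl, rfl⟩

open Classical in
lemma exists_bijOn_of_code_eq {H : SimpleGraph W} {S' : Set W} {r' : W} (h : IsBuilt G S r s)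
    (h' : IsBuilt H S' r' t) (hcode : s.code = t.code) : ∃ f : V → W, Set.BijOn f S S' ∧
      f r = r' ∧ ∀ a ∈ S, ∀ b ∈ S, G.Adj a b ↔ H.Adj (f a) (f b) := by
  induction h generalizing S' r' t with
  | single r =>
    cases h' with
    | single => exact ⟨fun _ => r', by simp, rfl, by simp⟩
    | @graft _ _ _ _ _ t₂ =>
      exact absurd (Nat.eq_one_of_mul_eq_one_left hcode.symm) (kthPrime_prime t₂.code).ne_one
  | @graft A B r u s₁ s₂ hA hB h ihA ihB =>
    obtain ⟨A', B', u', t₁, t₂, h₁, h₂, hsplit, rfl, hcode', hcode₂⟩ :=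
      h'.exists_split_of_dvd s₂.code_pos (hcode ▸ Dvd.intro_left _ rfl)
    have hcode₁ : s₁.code = t₁.code := by
      rw [hcode₂, ← hcode] at hcode'
      exact (Nat.eq_of_mul_eq_mul_right (kthPrime_prime s₂.code).pos hcode').symm
    obtain ⟨f, hf, hfr, hfadj⟩ := ihA h₁ hcode₁
    obtain ⟨g, hg, hgu, hgadj⟩ := ihB h₂ hcode₂.symm
    have hl : Set.EqOn (A.piecewise f g) f A := fun x hx => Set.piecewise_eq_of_mem _ _ _ hx
    have hr : Set.EqOn (A.piecewise f g) g B := fun x hx =>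
      Set.piecewise_eq_of_notMem _ _ _ fun hxA => h.disjoint x hxA hx
    have hcross : ∀ a ∈ A, ∀ b ∈ B, G.Adj a b ↔ H.Adj (f a) (g b) := fun a ha b hb => by
      constructor
      · intro hab
        obtain ⟨rfl, rfl⟩ := h.eq_and_eq a ha b hb hab
        rw [hfr, hgu]
        exact hsplit.adj
      · intro hab
        obtain ⟨h₃, h₄⟩ := hsplit.eq_and_eq _ (hf.mapsTo ha) _ (hg.mapsTo hb) hab
        rw [hf.injOn ha h.left_mem (h₃.trans hfr.symm), hg.injOn hb h.right_mem (h₄.trans hgu.symm)]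
        exact h.adj
    refine ⟨A.piecewise f g, (hl.bijOn_iff.2 hf).union (hr.bijOn_iff.2 hg) ?_,
      (hl h.left_mem).trans hfr, ?_⟩
    · rw [Set.injOn_union (Set.disjoint_left.2 h.disjoint)]
      refine ⟨(hl.bijOn_iff.2 hf).injOn, (hr.bijOn_iff.2 hg).injOn, fun a ha b hb hab => ?_⟩
      rw [hl ha, hr hb] at hab
      exact hsplit.disjoint _ (hf.mapsTo ha) (hab ▸ hg.mapsTo hb)
    · rintro a (ha | ha) b (hb | hb)
      · rw [hl ha, hl hb, hfadj a ha b hb]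
      · rw [hl ha, hr hb, hcross a ha b hb]
      · rw [hr ha, hl hb, G.adj_comm, H.adj_comm, hcross b hb a ha]
      · rw [hr ha, hr hb, hgadj a ha b hb]

end IsBuilt

open Classical in
lemma RootedSubtreeIso.code_eq {V : Type*} {G : SimpleGraph V} {r : V} {S T : RootedSubtree G r}
    (h : RootedSubtreeIso G r S T) {s t : BranchTree} (hs : IsBuilt G S.1 r s)
    (ht : IsBuilt G T.1 r t) : s.code = t.code := by
  obtain ⟨F, hF⟩ := h
  let f : V → V := fun x => if hx : x ∈ S.1 then F ⟨x, hx⟩ else x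
  have hf : ∀ x (hx : x ∈ S.1), f x = F ⟨x, hx⟩ := fun x hx => dif_pos hx
  have h₁ : IsBuilt G (f '' S.1) (f r) s := by
    refine hs.transport (fun x hx y hy hxy => ?_) fun a ha b hb => ?_
    · rw [hf x hx, hf y hy] at hxy
      exact congrArg Subtype.val (F.injective (Subtype.ext hxy))
    · rw [hf a ha, hf b hb]
      exact (F.map_rel_iff (a := ⟨a, ha⟩) (b := ⟨b, hb⟩)).symm
  have h₂ : f '' S.1 = T.1 := by
    ext y
    constructor
    · rintro ⟨x, hx, rfl⟩
      rw [hf x hx]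
      exact (F ⟨x, hx⟩).2
    · intro hy
      obtain ⟨⟨x, hx⟩, hxy⟩ := F.surjective ⟨y, hy⟩
      exact ⟨x, hx, by rw [hf x hx, hxy]⟩
  have h₃ : f r = r := by rw [hf r S.2.1, hF]
  rw [h₂, h₃] at h₁
  exact h₁.code_unique ht

namespace IsBuilt

lemma rootedSubtreeIso_of_code_eq {V : Type*} {G : SimpleGraph V} {r : V}
    {S T : RootedSubtree G r} {s t : BranchTree} (hs : IsBuilt G S.1 r s)
    (ht : IsBuilt G T.1 r t) (h : s.code = t.code) : RootedSubtreeIso G r S T := by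
  obtain ⟨f, hf, hfr, hadj⟩ := hs.exists_bijOn_of_code_eq ht h
  exact ⟨⟨hf.equiv f, fun {a b} => (hadj a a.2 b b.2).symm⟩, Subtype.ext hfr⟩

lemma nr_eq {V : Type*} {G : SimpleGraph V} {r : V} {t : BranchTree}
    (h : IsBuilt G Set.univ r t) : nr G r = t.subCodes.card := by
  choose s hs hcode using fun S : RootedSubtree G r =>
    h.exists_code_mem_subCodes (Set.subset_univ S.1) S.2.1 S.2.2
  let ψ : Quot (RootedSubtreeIso G r) → t.subCodes :=
    Quot.lift (fun S => ⟨(s S).code, hcode S⟩) fun S T hST =>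
      Subtype.ext (hST.code_eq (hs S) (hs T))
  have hψ : Function.Bijective ψ := by
    constructor
    · rintro ⟨S⟩ ⟨T⟩ hST
      exact Quot.sound ((hs S).rootedSubtreeIso_of_code_eq (hs T) (congrArg Subtype.val hST))
    · rintro ⟨k, hk⟩
      obtain ⟨S, -, s', hs', rfl⟩ := h.exists_subset_of_mem_subCodes hk
      exact ⟨Quot.mk _ ⟨S, hs'.root_mem, hs'.connected⟩, Subtype.ext ((hs _).code_unique hs')⟩
  rw [nr, Nat.card_congr (Equiv.ofBijective ψ hψ), Nat.card_eq_fintype_card, Fintype.card_coe]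

end IsBuilt

namespace BranchTree

lemma exists_isBuilt (t : BranchTree) : ∃ (V : Type) (G : SimpleGraph V) (r : V),
    G.IsAcyclic ∧ IsBuilt G Set.univ r t := by
  induction t with
  | single =>
    exact ⟨Unit, ⊥, (), isAcyclic_bot, Set.univ_unique (α := Unit) ▸ .single ()⟩
  | graft s t ihs iht =>
    obtain ⟨V, G, r, hG, hs⟩ := ihs
    obtain ⟨W, H, u, hH, ht⟩ := iht
    refine ⟨V ⊕ W, (G ⊕g H) ⊔ edge (.inl r) (.inr u), .inl r,
      (hG.sum hH).sup_edge_of_not_reachable (not_reachable_sum_inl_inr _ _), ?_⟩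
    have hs' := hs.transport (H := (G ⊕g H) ⊔ edge (.inl r) (.inr u)) Sum.inl_injective.injOn
      (by simp [edge_adj])
    have ht' := ht.transport (H := (G ⊕g H) ⊔ edge (.inl r) (.inr u)) Sum.inr_injective.injOn
      (by simp [edge_adj])
    have := hs'.graft ht' ⟨by simp, by simp, by simp, by simp [edge_adj], by simp [edge_adj]⟩
    rwa [Set.image_univ, Set.image_univ, Set.range_inl_union_range_inr] at this

lemma exists_nr_eq (t : BranchTree) : ∃ (G : SimpleGraph (Fin t.size)) (r : Fin t.size),
    G.IsTree ∧ nr G r = t.subCodes.card := by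
  obtain ⟨V, G, r, hG, h⟩ := t.exists_isBuilt
  have : Finite V := Set.finite_univ_iff.1 h.finite
  let e : V ≃ Fin t.size :=
    Finite.equivFinOfCardEq (by rw [← Set.ncard_univ, h.ncard_eq])
  have h' := h.transport (H := G.comap e.symm) e.injective.injOn (by simp)
  rw [Set.image_univ, e.surjective.range_eq] at h'
  exact ⟨G.comap e.symm, e r, ⟨(induceUnivIso _).connected_iff.1 h'.connected,
    (Iso.comap e.symm G).isAcyclic_iff.2 hG⟩, h'.nr_eq⟩

end BranchTree

lemma SimpleGraph.IsTree.nr_pow_le {n : ℕ} {G : SimpleGraph (Fin n)} (hG : G.IsTree)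
    (r : Fin n) : nr G r ^ 4 ≤ 5 ^ n := by
  obtain ⟨t, ht⟩ := IsBuilt.exists_of_connected hG.isAcyclic Set.finite_univ (Set.mem_univ r)
    ((induceUnivIso G).connected_iff.2 hG.connected)
  have hn : t.size = n := by rw [← ht.ncard_eq, Set.ncard_univ, Nat.card_fin]
  rw [ht.nr_eq, ← hn]
  exact t.card_subCodes_pow_le

lemma nr_mem_upperBounds (n : ℕ) : 5 ^ n ∈ upperBounds
    {k | ∃ (G : SimpleGraph (Fin n)) (r : Fin n), G.IsTree ∧ nr G r = k} := by
  rintro _ ⟨G, r, hG, rfl⟩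
  exact (Nat.le_self_pow (by norm_num) _).trans (hG.nr_pow_le r)

lemma pow_le_maxNR {n : ℕ} (hn : 1 ≤ n) : 5 ^ ((n - 3) / 4) ≤ maxNR n := by
  obtain ⟨t, rfl, ht⟩ := BranchTree.exists_pow_le_card_subCodes hn
  obtain ⟨G, r, hG, hnr⟩ := t.exists_nr_eq
  exact ht.trans (le_csSup ⟨_, nr_mem_upperBounds _⟩ ⟨G, r, hG, hnr⟩)

lemma maxNR_pow_le {n : ℕ} (hn : 1 ≤ n) : maxNR n ^ 4 ≤ 5 ^ n := by
  obtain ⟨t, rfl, -⟩ := BranchTree.exists_pow_le_card_subCodes hn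
  obtain ⟨G, r, hG, hnr⟩ := t.exists_nr_eq
  obtain ⟨G', r', hG', hnr'⟩ : maxNR t.size ∈
      {k | ∃ (G : SimpleGraph (Fin t.size)) (r : Fin t.size), G.IsTree ∧ nr G r = k} :=
    Nat.sSup_mem ⟨_, G, r, hG, hnr⟩ ⟨_, nr_mem_upperBounds _⟩
  rw [← hnr']
  exact hG'.nr_pow_le r'

lemma maxNR_le_rpow {n : ℕ} (hn : 1 ≤ n) : (maxNR n : ℝ) ≤ (5 : ℝ) ^ ((n : ℝ) / 4) := by
  refine le_of_pow_le_pow_left₀ (n := 4) (by norm_num) (by positivity) ?_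
  rw [← Real.rpow_mul_natCast (by norm_num), Nat.cast_ofNat, div_mul_cancel₀ _ (by norm_num),
    Real.rpow_natCast]
  exact_mod_cast maxNR_pow_le hn

lemma two_mul_rpow_le_maxNR {n : ℕ} (hn : 1 ≤ n) :
    2 * (5 : ℝ) ^ ((n : ℝ) / 4 - 2) ≤ maxNR n := by
  have h₁ : (n : ℝ) / 4 - 2 ≤ ((n - 3) / 4 : ℕ) - 1 / 2 := by
    have : (n : ℝ) ≤ 4 * ((n - 3) / 4 : ℕ) + 6 := by
      exact_mod_cast (by omega : n ≤ 4 * ((n - 3) / 4) + 6)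
    linarith
  have h₂ : 2 * (5 : ℝ) ^ (-(1 / 2) : ℝ) ≤ 1 := by
    rw [Real.rpow_neg (by norm_num), ← Real.sqrt_eq_rpow, ← div_eq_mul_inv,
      div_le_one (by positivity)]
    exact Real.le_sqrt_of_sq_le (by norm_num)
  calc 2 * (5 : ℝ) ^ ((n : ℝ) / 4 - 2)
      ≤ 2 * (5 : ℝ) ^ ((((n - 3) / 4 : ℕ) : ℝ) - 1 / 2) := by
        gcongr
        norm_num
    _ = (2 * (5 : ℝ) ^ (-(1 / 2) : ℝ)) * 5 ^ ((n - 3) / 4) := by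
        rw [sub_eq_add_neg, Real.rpow_add (by norm_num), Real.rpow_natCast]
        ring
    _ ≤ 1 * 5 ^ ((n - 3) / 4) := by gcongr
    _ ≤ maxNR n := by
        rw [one_mul]
        exact_mod_cast pow_le_maxNR hn

/-- For every `n ≥ 1`, `R_n ≤ 5^(n/4)` and `R_n ≥ 2·5^(n/4-2) - 3·2^(n/2-1)`;
in particular `R_n = Θ(5^(n/4))`. -/
theorem maxNR_theta :
    (∀ n : ℕ, 1 ≤ n →
      (maxNR n : ℝ) ≤ (5 : ℝ) ^ ((n : ℝ) / 4) ∧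
      2 * (5 : ℝ) ^ ((n : ℝ) / 4 - 2) - 3 * (2 : ℝ) ^ ((n : ℝ) / 2 - 1) ≤ (maxNR n : ℝ)) ∧
    ∃ c₁ c₂ : ℝ, 0 < c₁ ∧ 0 < c₂ ∧ ∀ n : ℕ, 1 ≤ n →
      c₁ * (5 : ℝ) ^ ((n : ℝ) / 4) ≤ (maxNR n : ℝ) ∧
      (maxNR n : ℝ) ≤ c₂ * (5 : ℝ) ^ ((n : ℝ) / 4) := by
  refine ⟨fun n hn => ⟨maxNR_le_rpow hn, ?_⟩, 2 / 25, 1, by norm_num, by norm_num,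
    fun n hn => ⟨?_, by simpa using maxNR_le_rpow hn⟩⟩
  · have : (0 : ℝ) ≤ 3 * (2 : ℝ) ^ ((n : ℝ) / 2 - 1) := by positivity
    linarith [two_mul_rpow_le_maxNR hn]
  · refine le_trans (le_of_eq ?_) (two_mul_rpow_le_maxNR hn)
    rw [Real.rpow_sub (by norm_num), Real.rpow_ofNat]
    ring
end

section
/- For every tree T with n vertices there exists a vertex v of T such that the number of subtrees of T (counted as distinct subgraphs, not up to isomorphism) that do not contain v is at most 3·2^{n/2 − 1}. -/
open SimpleGraph

/-- Bound for the number of nonempty subsets lying inside a single block, when the blocks have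
size at most `h` and total size at most `h + r`. -/
theorem sum_two_pow_sub_one_le {ι : Type*} (m : ι → ℕ) (s : Finset ι) (h r : ℕ)
    (hm : ∀ i ∈ s, m i ≤ h) (hs : ∑ i ∈ s, m i ≤ h + r) :
    ∑ i ∈ s, (2 ^ m i - 1) + 2 ≤ 2 ^ h + 2 ^ r := by
  classical
  induction s using Finset.induction_on generalizing h r with
  | empty =>
    have := Nat.one_le_two_pow (n := h)
    have := Nat.one_le_two_pow (n := r)
    simp only [Finset.sum_empty]
    lia
  | insert a s ha ih =>
    rw [Finset.sum_insert ha] at hs ⊢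
    have hah := hm a (Finset.mem_insert_self a s)
    have ha1 := Nat.one_le_two_pow (n := m a)
    rcases le_total (m a) r with har | har
    · obtain ⟨x, rfl⟩ := Nat.exists_eq_add_of_le har
      have := ih h x (fun i hi ↦ hm i (Finset.mem_insert_of_mem hi)) (by lia)
      have hx := Nat.one_le_two_pow (n := x)
      have : 2 ^ x + 2 ^ m a ≤ 2 ^ (m a + x) + 1 := by
        rw [pow_add]
        nlinarith [Nat.mul_le_mul (Nat.sub_add_cancel ha1).ge (Nat.sub_add_cancel hx).ge]
      lia
    · obtain ⟨x, hx⟩ := Nat.exists_eq_add_of_le har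
      obtain ⟨t, rfl⟩ := Nat.exists_eq_add_of_le hah
      have := ih (r + t) 0
        (fun i hi ↦ (Finset.single_le_sum (fun _ _ ↦ Nat.zero_le _) hi).trans (by lia)) (by lia)
      have h1 : 2 ^ (r + t) + 2 ^ m a ≤ 2 ^ (m a + t) + 2 ^ r := by
        have ht := Nat.one_le_two_pow (n := t)
        have hx1 := Nat.one_le_two_pow (n := x)
        obtain ⟨p, hp⟩ := Nat.exists_eq_add_of_le ht
        obtain ⟨q, hq⟩ := Nat.exists_eq_add_of_le hx1
        rw [hx, pow_add, pow_add, pow_add, pow_add, hp, hq]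
        nlinarith [Nat.zero_le (2 ^ r * p * q)]
      simp only [pow_zero] at this
      lia

namespace SimpleGraph

variable {V : Type*} {G : SimpleGraph V}

theorem Walk.notMem_support_of_deleteIncidenceSet {v u w : V}
    (p : (G.deleteIncidenceSet v).Walk u w) (hu : u ≠ v) : v ∉ p.support := by
  induction p with
  | nil => simpa using hu.symm
  | cons h p ih =>
    rw [deleteIncidenceSet_adj] at h
    simpa using ⟨hu.symm, ih h.2.2⟩

theorem Walk.reachable_deleteIncidenceSet {v u w : V} (p : G.Walk u w) (hp : v ∉ p.support) :
    (G.deleteIncidenceSet v).Reachable u w := by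
  induction p with
  | nil => rfl
  | cons h p ih =>
    rw [support_cons, List.mem_cons, not_or] at hp
    refine (Adj.reachable (deleteIncidenceSet_adj.2 ⟨h, Ne.symm hp.1, ?_⟩)).trans (ih hp.2)
    rintro rfl
    exact hp.2 p.start_mem_support

theorem Connected.exists_adj_reachable_deleteIncidenceSet (hG : G.Connected) {v w : V}
    (hw : w ≠ v) : ∃ u, G.Adj v u ∧ (G.deleteIncidenceSet v).Reachable u w := by
  obtain ⟨p, hp⟩ := hG.exists_isPath v w
  cases p with
  | nil => exact absurd rfl hw
  | cons h p =>
    rw [Walk.cons_isPath_iff] at hp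
    exact ⟨_, h, p.reachable_deleteIncidenceSet hp.2⟩

theorem IsTree.length_eq_dist (hG : G.IsTree) {u v : V} {p : G.Walk u v} (hp : p.IsPath) :
    p.length = G.dist u v := by
  obtain ⟨q, hq, h⟩ := (hG.connected u v).exists_path_of_dist
  rw [← h, (hG.existsUnique_path u v).unique hp hq]

theorem IsTree.dist_eq_dist_add_one (hG : G.IsTree) {v u w : V} (huv : G.Adj v u)
    (h : (G.deleteIncidenceSet v).Reachable u w) : G.dist v w = G.dist u w + 1 := by
  obtain ⟨p, hp⟩ := h.exists_isPath
  have hv := p.notMem_support_of_deleteIncidenceSet huv.ne'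
  have hp' : (p.mapLe (G.deleteIncidenceSet_le v)).IsPath := hp.mapLe _
  have hq : (Walk.cons huv (p.mapLe (G.deleteIncidenceSet_le v))).IsPath := by
    rw [Walk.cons_isPath_iff]
    exact ⟨hp', by simpa using hv⟩
  rw [← hG.length_eq_dist hq, ← hG.length_eq_dist hp', Walk.length_cons]

/-- A vertex minimizing the sum of distances to all vertices is a centroid. -/
theorem IsTree.exists_centroid [Fintype V] (hG : G.IsTree) :
    ∃ v : V, ∀ (C : Finset V), (∀ x ∈ C, ∀ y ∈ C, (G.deleteIncidenceSet v).Reachable x y) →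
      v ∉ C → 2 * C.card ≤ Fintype.card V := by
  classical
  have := hG.connected.nonempty
  obtain ⟨v, hv⟩ := Finite.exists_min fun v ↦ ∑ w, G.dist v w
  refine ⟨v, fun C hC hvC ↦ ?_⟩
  obtain rfl | ⟨x, hx⟩ := C.eq_empty_or_nonempty
  · simp
  obtain ⟨u, huv, hux⟩ := hG.connected.exists_adj_reachable_deleteIncidenceSet
    (ne_of_mem_of_not_mem hx hvC)
  have h1 : ∑ w ∈ C, G.dist v w = ∑ w ∈ C, G.dist u w + C.card := by
    rw [Finset.card_eq_sum_ones, ← Finset.sum_add_distrib]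
    exact Finset.sum_congr rfl fun w hw ↦
      hG.dist_eq_dist_add_one huv (hux.trans (hC x hx w hw))
  have h2 : ∑ w ∈ Cᶜ, G.dist u w ≤ ∑ w ∈ Cᶜ, G.dist v w + Cᶜ.card := by
    rw [Finset.card_eq_sum_ones, ← Finset.sum_add_distrib]
    refine Finset.sum_le_sum fun w _ ↦ ?_
    have := hG.connected.dist_triangle (u := u) (v := v) (w := w)
    rw [dist_eq_one_iff_adj.2 huv.symm] at this
    lia
  have h3 := hv u
  simp only [← Finset.sum_add_sum_compl C] at h3
  have := C.card_add_card_compl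
  lia

theorem reachable_deleteIncidenceSet_of_induce_connected {v : V} {S : Set V}
    (hS : (G.induce S).Connected) (hv : v ∉ S) {x y : V} (hx : x ∈ S) (hy : y ∈ S) :
    (G.deleteIncidenceSet v).Reachable x y := by
  let f : G.induce S →g G.deleteIncidenceSet v :=
    ⟨Subtype.val, fun {a b} h ↦ deleteIncidenceSet_adj.2
      ⟨h, ne_of_mem_of_not_mem a.2 hv, ne_of_mem_of_not_mem b.2 hv⟩⟩
  exact (hS ⟨x, hx⟩ ⟨y, hy⟩).map f

/-- The number of connected vertex sets avoiding `v` is bounded by the number of nonempty vertex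
sets contained in a single component after deleting `v`. -/
theorem card_connected_avoiding_le [Fintype V] [DecidableEq V] (v : V)
    [Fintype (G.deleteIncidenceSet v).ConnectedComponent]
    [DecidableEq (G.deleteIncidenceSet v).ConnectedComponent] :
    Nat.card {S : Set V // (G.induce S).Connected ∧ v ∉ S} ≤
      ∑ c, (2 ^ ((Finset.univ.erase v).filter
        fun w ↦ (G.deleteIncidenceSet v).connectedComponentMk w = c).card - 1) := by
  classical
  let B (c) := (Finset.univ.erase v).filter
    fun w ↦ (G.deleteIncidenceSet v).connectedComponentMk w = c
  let F : Finset (Finset V) := Finset.univ.biUnion fun c ↦ (B c).powerset.erase ∅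
  have hmem (S : {S : Set V // (G.induce S).Connected ∧ v ∉ S}) : S.1.toFinset ∈ F := by
    obtain ⟨S, hS, hv⟩ := S
    obtain ⟨⟨x, hx⟩⟩ := hS.nonempty
    simp only [F, Finset.mem_biUnion, Finset.mem_univ, true_and, Finset.mem_erase,
      Finset.mem_powerset]
    refine ⟨(G.deleteIncidenceSet v).connectedComponentMk x, ?_, fun y hy ↦ ?_⟩
    · exact Finset.ne_empty_of_mem (Set.mem_toFinset.2 hx)
    · rw [Set.mem_toFinset] at hy
      simp only [B, Finset.mem_filter, Finset.mem_erase, Finset.mem_univ, and_true]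
      exact ⟨ne_of_mem_of_not_mem hy hv, ConnectedComponent.eq.2
        (reachable_deleteIncidenceSet_of_induce_connected hS hv hy hx)⟩
  have hinj : Function.Injective
      fun S : {S : Set V // (G.induce S).Connected ∧ v ∉ S} ↦ (⟨S.1.toFinset, hmem S⟩ : F) :=
    fun S T h ↦ Subtype.ext (Set.toFinset_inj.1 (Subtype.ext_iff.1 h))
  calc _ ≤ Nat.card F := Nat.card_le_card_of_injective _ hinj
    _ = F.card := by simp
    _ ≤ ∑ c, ((B c).powerset.erase ∅).card := Finset.card_biUnion_le
    _ = _ := by simp [B, Finset.card_erase_of_mem]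

theorem IsTree.exists_card_connected_avoiding_le [Fintype V] (hG : G.IsTree) :
    ∃ v : V, Nat.card {S : Set V // (G.induce S).Connected ∧ v ∉ S} + 2 ≤
      2 ^ (Fintype.card V / 2) + 2 ^ (Fintype.card V - 1 - Fintype.card V / 2) := by
  classical
  obtain ⟨v, hv⟩ := hG.exists_centroid
  refine ⟨v, (Nat.add_le_add_right (card_connected_avoiding_le v) 2).trans ?_⟩
  refine sum_two_pow_sub_one_le _ _ _ _ (fun c _ ↦ ?_) ?_
  · rw [Nat.le_div_iff_mul_le two_pos, mul_comm]
    refine hv _ (fun x hx y hy ↦ ?_) (by simp)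
    exact ConnectedComponent.eq.1
      ((Finset.mem_filter.1 hx).2.trans (Finset.mem_filter.1 hy).2.symm)
  · rw [← Finset.card_eq_sum_card_fiberwise
      (f := (G.deleteIncidenceSet v).connectedComponentMk) (fun _ _ ↦ Finset.mem_coe.2 (Finset.mem_univ _)),
      Finset.card_erase_of_mem (Finset.mem_univ v), Finset.card_univ]
    lia

end SimpleGraph

theorem two_pow_half_add_le (n : ℕ) (hn : 0 < n) :
    (2 : ℝ) ^ (n / 2) + 2 ^ (n - 1 - n / 2) ≤ 3 * (2 : ℝ) ^ ((n : ℝ) / 2 - 1) + 2 := by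
  obtain ⟨k, rfl | rfl⟩ := n.even_or_odd'
  · obtain ⟨j, rfl⟩ := Nat.exists_eq_add_of_lt (show 0 < k by lia)
    rw [show 2 * (0 + j + 1) / 2 = j + 1 by lia, show 2 * (0 + j + 1) - 1 - (j + 1) = j by lia,
      show ((2 * (0 + j + 1) : ℕ) : ℝ) / 2 - 1 = (j : ℝ) by push_cast; ring,
      Real.rpow_natCast, pow_succ]
    linarith
  · rw [show (2 * k + 1) / 2 = k by lia, show 2 * k + 1 - 1 - k = k by lia,
      show ((2 * k + 1 : ℕ) : ℝ) / 2 - 1 = (k : ℝ) - 1 / 2 by push_cast; ring,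
      Real.rpow_sub two_pos, Real.rpow_natCast, ← Real.sqrt_eq_rpow]
    have hs : √2 ≤ (3 / 2 : ℝ) := Real.sqrt_le_iff.2 (by norm_num)
    have : (2 : ℝ) * 2 ^ k ≤ 3 * (2 ^ k / √2) := by
      rw [← mul_div_assoc, le_div_iff₀ (by positivity)]
      nlinarith [pow_pos (two_pos : (0 : ℝ) < 2) k]
    linarith

/-- For every tree `T` with `n` vertices there is a vertex `v` such that the
number of subtrees of `T` (as distinct subgraphs) avoiding `v` is at most
`3·2^(n/2-1)`. -/
theorem exists_vertex_few_avoiding_subtrees {V : Type*} [Fintype V]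
    (G : SimpleGraph V) (hG : G.IsTree) :
    ∃ v : V, (Nat.card {S : Set V // (G.induce S).Connected ∧ v ∉ S} : ℝ) ≤
      3 * (2 : ℝ) ^ ((Fintype.card V : ℝ) / 2 - 1) := by
  obtain ⟨v, hv⟩ := hG.exists_card_connected_avoiding_le
  refine ⟨v, ?_⟩
  have := hG.connected.nonempty
  have h := two_pow_half_add_le (Fintype.card V) Fintype.card_pos
  have hv' : (Nat.card {S : Set V // (G.induce S).Connected ∧ v ∉ S} : ℝ) + 2 ≤
      2 ^ (Fintype.card V / 2) + 2 ^ (Fintype.card V - 1 - Fintype.card V / 2) := by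
    exact_mod_cast hv
  linarith
end

section
/- Let T be a tree with n vertices, let v be a centroid vertex of T (a vertex minimizing the sum of distances to all other vertices), and let T₁, …, T_k be the connected components of T with v removed. Then the number of subtrees of T (counted as distinct subgraphs) that do not contain v is at most ∑_{i=1}^{k} 2^{|T_i|}, and this quantity is at most 3·2^{n/2 − 1}. -/
open SimpleGraph

theorem mul_two_pow_le_mul_two_pow {x m : ℕ} (hx : 1 ≤ x) (hm : x ≤ m) :
    m * 2 ^ x ≤ x * 2 ^ m := by
  induction m, hm using Nat.le_induction with
  | base => exact le_rfl
  | succ m hxm ih =>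
    calc (m + 1) * 2 ^ x ≤ (2 * m) * 2 ^ x := Nat.mul_le_mul_right _ (by omega)
      _ = 2 * (m * 2 ^ x) := by ring
      _ ≤ 2 * (x * 2 ^ m) := Nat.mul_le_mul_left _ ih
      _ = x * 2 ^ (m + 1) := by ring

theorem Finset.mul_sum_two_pow_le {ι : Type*} (s : Finset ι) (b : ι → ℕ) (m : ℕ)
    (h₁ : ∀ i ∈ s, 1 ≤ b i) (h₂ : ∀ i ∈ s, b i ≤ m) :
    m * ∑ i ∈ s, 2 ^ b i ≤ (∑ i ∈ s, b i) * 2 ^ m := by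
  rw [Finset.mul_sum, Finset.sum_mul]
  exact Finset.sum_le_sum fun i hi => mul_two_pow_le_mul_two_pow (h₁ i hi) (h₂ i hi)

theorem sum_two_pow_le_of_sum_eq_two_mul {ι : Type*} [Fintype ι] (b : ι → ℕ) (m : ℕ)
    (h₁ : ∀ i, 1 ≤ b i) (h₂ : ∀ i, b i ≤ m) (hsum : ∑ i, b i = 2 * m) :
    ∑ i, 2 ^ b i ≤ 2 * 2 ^ m := by
  rcases Nat.eq_zero_or_pos m with rfl | hm
  · have : IsEmpty ι := ⟨fun i => by have := h₁ i; have := h₂ i; omega⟩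
    simp
  · have h := Finset.univ.mul_sum_two_pow_le b m (fun i _ => h₁ i) (fun i _ => h₂ i)
    rw [hsum] at h
    exact Nat.le_of_mul_le_mul_left (by linarith) hm

theorem sum_two_pow_le_of_sum_eq_two_mul_add_one {ι : Type*} [Fintype ι] (b : ι → ℕ) (m : ℕ)
    (h₁ : ∀ i, 1 ≤ b i) (h₂ : ∀ i, b i ≤ m + 1) (hsum : ∑ i, b i = 2 * m + 1) :
    ∑ i, 2 ^ b i ≤ 3 * 2 ^ m := by
  classical
  by_cases hmax : ∃ i₀, b i₀ = m + 1
  · obtain ⟨i₀, hi₀⟩ := hmax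
    have hb := Finset.add_sum_erase Finset.univ b (Finset.mem_univ i₀)
    have hrest : ∑ i ∈ Finset.univ.erase i₀, b i = m := by omega
    have hle : ∀ i ∈ Finset.univ.erase i₀, b i ≤ m := fun i hi =>
      hrest ▸ Finset.single_le_sum (fun _ _ => Nat.zero_le _) hi
    have hpow : ∑ i ∈ Finset.univ.erase i₀, 2 ^ b i ≤ 2 ^ m := by
      rcases Nat.eq_zero_or_pos m with rfl | hm
      · rw [Finset.sum_eq_zero fun i hi => ?_]
        · exact Nat.zero_le _
        · have := h₁ i
          have := hle i hi
          omega
      · have h := (Finset.univ.erase i₀).mul_sum_two_pow_le b m (fun i _ => h₁ i) hle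
        rw [hrest] at h
        exact Nat.le_of_mul_le_mul_left h hm
    rw [← Finset.add_sum_erase Finset.univ (fun i => 2 ^ b i) (Finset.mem_univ i₀), hi₀, pow_succ]
    linarith
  · have hle : ∀ i, b i ≤ m := fun i => by
      have := h₂ i
      have : b i ≠ m + 1 := fun h => hmax ⟨i, h⟩
      omega
    rcases Nat.eq_zero_or_pos m with rfl | hm
    · have : IsEmpty ι := ⟨fun i => by have := h₁ i; have := hle i; omega⟩
      simp
    · have h := Finset.univ.mul_sum_two_pow_le b m (fun i _ => h₁ i) (fun i _ => hle i)
      rw [hsum] at h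
      refine Nat.le_of_mul_le_mul_left (h.trans ?_) hm
      calc (2 * m + 1) * 2 ^ m ≤ (m * 3) * 2 ^ m := Nat.mul_le_mul_right _ (by omega)
        _ = m * (3 * 2 ^ m) := by ring

theorem sum_two_pow_le_three_mul_rpow {ι : Type*} [Fintype ι] (b : ι → ℕ) (n : ℕ)
    (h₁ : ∀ i, 1 ≤ b i) (h₂ : ∀ i, 2 * b i ≤ n) (hsum : ∑ i, b i + 1 = n) :
    ∑ i, (2 : ℝ) ^ b i ≤ 3 * (2 : ℝ) ^ ((n : ℝ) / 2 - 1) := by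
  obtain ⟨m, hm | hm⟩ : ∃ m, n = 2 * m + 2 ∨ n = 2 * m + 1 := ⟨(n - 1) / 2, by omega⟩
  · have h := sum_two_pow_le_of_sum_eq_two_mul_add_one b m h₁
      (fun i => by have := h₂ i; omega) (by omega)
    have hexp : (n : ℝ) / 2 - 1 = m := by rw [hm]; push_cast; ring
    rw [hexp, Real.rpow_natCast]
    exact_mod_cast h
  · have h := sum_two_pow_le_of_sum_eq_two_mul b m h₁
      (fun i => by have := h₂ i; omega) (by omega)
    have hexp : (n : ℝ) / 2 - 1 = m + -(1 / 2) := by rw [hm]; push_cast; ring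
    have hsqrt : 2 ≤ 3 * (2 : ℝ) ^ (-(1 / 2) : ℝ) := by
      rw [Real.rpow_neg zero_le_two, ← Real.sqrt_eq_rpow, ← div_eq_mul_inv,
        le_div_iff₀ (by positivity)]
      nlinarith [Real.sq_sqrt (zero_le_two (α := ℝ)), Real.sqrt_nonneg 2]
    rw [hexp, Real.rpow_add zero_lt_two, Real.rpow_natCast]
    calc ∑ i, (2 : ℝ) ^ b i ≤ 2 * 2 ^ m := by exact_mod_cast h
      _ ≤ (3 * (2 : ℝ) ^ (-(1 / 2) : ℝ)) * 2 ^ m := by gcongr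
      _ = _ := by ring

namespace SimpleGraph

variable {V : Type*} {G : SimpleGraph V}

theorem IsTree.dist_eq_add_one_of_induce_connected (hG : G.IsTree) {C : Set V}
    (hC : (G.induce C).Connected) {v u w : V} (hv : v ∉ C) (hu : u ∈ C) (hw : w ∈ C)
    (hvu : G.Adj v u) : G.dist v w = G.dist u w + 1 := by
  obtain ⟨p, hp⟩ := hC.exists_isPath ⟨u, hu⟩ ⟨w, hw⟩
  obtain ⟨q, hq, hvq⟩ : ∃ q : G.Walk u w, q.IsPath ∧ v ∉ q.support := by
    refine ⟨p.map (Embedding.induce C).toHom, hp.map Subtype.val_injective, fun h => ?_⟩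
    obtain ⟨x, -, rfl⟩ := List.mem_map.1 ((Walk.support_map _ p) ▸ h)
    exact hv x.2
  have dist_eq_length : ∀ {a b : V} (q : G.Walk a b), q.IsPath → G.dist a b = q.length := by
    intro a b q hq
    obtain ⟨r, hr, hlen⟩ := hG.connected.exists_path_of_dist a b
    rw [← hlen, (hG.existsUnique_path a b).unique hq hr]
  rw [dist_eq_length q hq, dist_eq_length (Walk.cons hvu q) (hq.cons hvq), Walk.length_cons]

theorem IsTree.two_mul_ncard_le_of_sum_dist_le [Fintype V] (hG : G.IsTree) {C : Set V}
    (hC : (G.induce C).Connected) {v u : V} (hv : v ∉ C) (hu : u ∈ C) (hvu : G.Adj v u)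
    (hle : ∑ w, G.dist v w ≤ ∑ w, G.dist u w) : 2 * C.ncard ≤ Fintype.card V := by
  classical
  have hpt : ∀ w, G.dist u w + 2 * (if w ∈ C then 1 else 0) ≤ G.dist v w + 1 := by
    intro w
    split_ifs with hw
    · rw [hG.dist_eq_add_one_of_induce_connected hC hv hu hw hvu]
    · have h := hG.connected.dist_triangle (u := u) (v := v) (w := w)
      rw [dist_eq_one_iff_adj.2 hvu.symm] at h
      omega
  have h := Finset.sum_le_sum fun w (_ : w ∈ Finset.univ) => hpt w
  rw [Finset.sum_add_distrib, Finset.sum_add_distrib, ← Finset.mul_sum, Finset.sum_boole,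
    Finset.sum_const, Finset.card_univ, smul_eq_mul, mul_one, Nat.cast_id] at h
  rw [Set.ncard_eq_toFinset_card', ← Set.filter_mem_univ_eq_toFinset]
  omega

theorem Connected.subset_of_forall_adj {S C : Set V} (hS : (G.induce S).Connected)
    (hne : (S ∩ C).Nonempty) (h : ∀ x ∈ S, ∀ y ∈ S, x ∈ C → G.Adj x y → y ∈ C) : S ⊆ C := by
  obtain ⟨x, hxS, hxC⟩ := hne
  intro y hyS
  by_contra hyC
  obtain ⟨p⟩ := hS.preconnected ⟨x, hxS⟩ ⟨y, hyS⟩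
  obtain ⟨d, -, hd₁, hd₂⟩ := p.exists_boundary_dart (Subtype.val ⁻¹' C) hxC hyC
  exact hd₂ (h _ d.fst.2 _ d.snd.2 hd₁ d.adj)

end SimpleGraph

/-- Let `v` be a centroid vertex of a tree `T` with `n` vertices and let
`B 0, …, B (k-1)` be the connected components of `T` with `v` removed. Then the
number of subtrees of `T` (as distinct subgraphs) avoiding `v` is at most
`∑ i, 2 ^ |B i|`, which in turn is at most `3·2^(n/2-1)`. -/
theorem centroid_avoiding_subtrees {V : Type*} [Fintype V] (G : SimpleGraph V)
    (hG : G.IsTree) (v : V)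
    (hcentroid : ∀ u : V, ∑ w : V, G.dist v w ≤ ∑ w : V, G.dist u w)
    (k : ℕ) (B : Fin k → Set V)
    (hdisj : Pairwise fun i j => Disjoint (B i) (B j))
    (hcover : (⋃ i, B i) = {u | u ≠ v})
    (hconn : ∀ i, (G.induce (B i)).Connected)
    (hcross : ∀ i j, i ≠ j → ∀ x ∈ B i, ∀ y ∈ B j, ¬ G.Adj x y) :
    (Nat.card {S : Set V // (G.induce S).Connected ∧ v ∉ S} : ℝ) ≤
        ∑ i, (2 : ℝ) ^ (B i).ncard ∧
      ∑ i, (2 : ℝ) ^ (B i).ncard ≤ 3 * (2 : ℝ) ^ ((Fintype.card V : ℝ) / 2 - 1) := by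
  have hv : ∀ i, v ∉ B i := fun i hi =>
    (hcover.subset (Set.mem_iUnion_of_mem i hi) : v ≠ v) rfl
  have hmem : ∀ x, x ≠ v → ∃ i, x ∈ B i := fun x hx =>
    Set.mem_iUnion.1 (hcover.symm.subset hx)
  have hadj : ∀ i, ∀ x ∈ B i, ∀ y, y ≠ v → G.Adj x y → y ∈ B i := by
    intro i x hx y hy hxy
    obtain ⟨j, hj⟩ := hmem y hy
    by_cases hij : i = j
    · exact hij ▸ hj
    · exact absurd hxy (hcross i j hij x hx y hj)
  have hnonempty : ∀ i, (B i).Nonempty := fun i => Set.nonempty_coe_sort.1 (hconn i).nonempty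
  constructor
  · have hsub : {S : Set V | (G.induce S).Connected ∧ v ∉ S} ⊆ ⋃ i, 𝒫 (B i) := by
      rintro S ⟨hS, hvS⟩
      have hne_v : ∀ x ∈ S, x ≠ v := fun x hx h => hvS (h ▸ hx)
      obtain ⟨x, hx⟩ := hS.nonempty
      obtain ⟨i, hi⟩ := hmem x (hne_v x hx)
      exact Set.mem_iUnion_of_mem i <| hS.subset_of_forall_adj ⟨x, hx, hi⟩
        fun a _ b hb ha hab => hadj i a ha b (hne_v b hb) hab
    have h := (Set.ncard_le_ncard hsub).trans (Set.ncard_iUnion_le_of_fintype _)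
    simp only [fun i => Set.ncard_powerset (B i)] at h
    exact_mod_cast h
  · refine sum_two_pow_le_three_mul_rpow _ _ (fun i => (hnonempty i).ncard_pos) (fun i => ?_) ?_
    · obtain ⟨w, hw⟩ := hnonempty i
      obtain ⟨p⟩ := hG.connected.preconnected w v
      obtain ⟨d, -, hd₁, hd₂⟩ := p.exists_boundary_dart (B i) hw (hv i)
      have hd : d.snd = v := by
        by_contra hne
        exact hd₂ (hadj i _ hd₁ _ hne d.adj)
      exact hG.two_mul_ncard_le_of_sum_dist_le (hconn i) (hv i) hd₁ (hd ▸ d.adj.symm)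
        (hcentroid _)
    · have hcard := Set.ncard_iUnion_of_finite (fun i => (B i).toFinite) hdisj
      rw [finsum_eq_sum_of_fintype, hcover] at hcard
      have hcompl : {u | u ≠ v} = ({v} : Set V)ᶜ := rfl
      rw [← hcard, hcompl, ← Set.ncard_singleton v, add_comm, Set.ncard_add_ncard_compl,
        Nat.card_eq_fintype_card]
end
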